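/- arXiv:1310.6683 — 12 statements merged into one kernel-verified Lean document; each statement's English description precedes it below -/
import Mathlib

section
/- For every continuous function h : [0,R] → ℝ, the singular ordinary differential equation −v(r)φ′(r) + f(r)φ(r) = h(r) for r ∈ (0,R) has exactly one solution φ belonging to C[0,R] ∩ C¹(0,R), and this solution satisfies the boundary values φ(0) = h(0)/f(0) and φ(R) = h(R)/f(R). -/
open MeasureTheory Set Filter Topology

/-- `φ` is a solution in `C[0,R] ∩ C¹(0,R)` of the singular ODE
`-v(r)φ'(r) + f(r)φ(r) = h(r)` on `(0,R)`. -/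
def IsSingODESol (v f h φ : ℝ → ℝ) (R : ℝ) : Prop :=
  ContinuousOn φ (Set.Icc 0 R) ∧
  (∀ r ∈ Set.Ioo 0 R, DifferentiableAt ℝ φ r) ∧
  ContinuousOn (deriv φ) (Set.Ioo 0 R) ∧
  ∀ r ∈ Set.Ioo 0 R, -v r * deriv φ r + f r * φ r = h r

lemma aux_Phi (q : ℝ → ℝ) (hq : Continuous q) (B a b : ℝ) (hB : ∀ x, |q x| ≤ B)
    (ha : Tendsto q atBot (𝓝 a)) (hb : Tendsto q atTop (𝓝 b)) :
    ∃ Φ : ℝ → ℝ, (∀ y, HasDerivAt Φ (Φ y - q y) y) ∧ Tendsto Φ atBot (𝓝 a) ∧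
      Tendsto Φ atTop (𝓝 b) := by
  have hexp : IntegrableOn (fun x : ℝ => Real.exp (-x)) (Ioi 0) := integrableOn_exp_neg_Ioi 0
  have hint : ∀ y, IntegrableOn (fun x : ℝ => Real.exp (-x) * q x) (Ioi y) := by
    intro y
    refine Integrable.mul_bdd (c := B) (integrableOn_exp_neg_Ioi y) hq.aestronglyMeasurable ?_
    exact Eventually.of_forall (fun x => hB x)
  have hlim : ∀ (l : Filter ℝ) [l.IsCountablyGenerated] (c : ℝ),
      (∀ x : ℝ, Tendsto (fun y => q (x + y)) l (𝓝 c)) →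
      Tendsto (fun y => ∫ x in Ioi (0:ℝ), Real.exp (-x) * q (x + y)) l (𝓝 c) := by
    intro l _ c hc
    have h1 : ∫ x in Ioi (0:ℝ), Real.exp (-x) * c = c := by
      rw [integral_mul_const, integral_exp_neg_Ioi_zero, one_mul]
    rw [← h1]
    refine tendsto_integral_filter_of_dominated_convergence
      (fun x => Real.exp (-x) * B) ?_ ?_ (hexp.mul_const B) ?_
    · exact Eventually.of_forall fun y =>
        (by fun_prop : Continuous fun x => Real.exp (-x) * q (x + y)).aestronglyMeasurable
    · refine Eventually.of_forall fun y => Eventually.of_forall fun x => ?_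
      rw [norm_mul, Real.norm_eq_abs, Real.abs_exp]
      exact mul_le_mul_of_nonneg_left (hB _) (Real.exp_pos _).le
    · exact Eventually.of_forall fun x => (hc x).const_mul _
  have hrep : ∀ y, Real.exp y * ((∫ x in Ioi (0:ℝ), Real.exp (-x) * q x)
      - ∫ x in (0:ℝ)..y, Real.exp (-x) * q x)
      = ∫ x in Ioi (0:ℝ), Real.exp (-x) * q (x + y) := by
    intro y
    have h1 := intervalIntegral.integral_Ioi_sub_Ioi' (hint 0) (hint y)
    have h2 : (∫ x in Ioi (0:ℝ), Real.exp (-(x+y)) * q (x + y))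
        = ∫ x in Ioi y, Real.exp (-x) * q x := by
      have := (measurePreserving_add_right (volume : Measure ℝ) y).setIntegral_preimage_emb
        (measurableEmbedding_addRight y) (fun x => Real.exp (-x) * q x) (Ioi y)
      simpa using this
    rw [← h1, sub_sub_cancel, ← h2, ← integral_const_mul]
    congr 1
    ext x
    rw [← mul_assoc, ← Real.exp_add]
    congr 2
    ring
  refine ⟨fun y => Real.exp y * ((∫ x in Ioi (0:ℝ), Real.exp (-x) * q x)
      - ∫ x in (0:ℝ)..y, Real.exp (-x) * q x), ?_, ?_, ?_⟩
  · intro y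
    have hc : Continuous fun x => Real.exp (-x) * q x := by fun_prop
    have h1 := (hc.integral_hasStrictDerivAt 0 y).hasDerivAt
    have h2 := (Real.hasDerivAt_exp y).mul (h1.const_sub (∫ x in Ioi (0:ℝ), Real.exp (-x) * q x))
    refine h2.congr_deriv ?_
    have : Real.exp y * Real.exp (-y) = 1 := by rw [← Real.exp_add]; simp
    linear_combination (-q y) * this
  · simp_rw [hrep]
    exact hlim _ _ fun x => ha.comp (tendsto_atBot_add_const_left _ x tendsto_id)
  · simp_rw [hrep]
    exact hlim _ _ fun x => hb.comp (tendsto_atTop_add_const_left _ x tendsto_id)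

lemma aux_G (R : ℝ) (hR : 0 < R) (p : ℝ → ℝ) (hp : ContinuousOn p (Ioo 0 R)) (m : ℝ)
    (hm : 0 < m) (hpm : ∀ r ∈ Ioo 0 R, m * (R / (r * (R - r))) ≤ p r) :
    ∃ G : ℝ → ℝ, (∀ r ∈ Ioo 0 R, HasDerivAt G (p r) r) ∧
      Tendsto G (𝓝[>] 0) atBot ∧ Tendsto G (𝓝[<] R) atTop := by
  have hmid : R / 2 ∈ Ioo 0 R := ⟨by linarith, by linarith⟩
  have hG : ∀ r ∈ Ioo 0 R, HasDerivAt (fun r => ∫ x in (R/2)..r, p x) (p r) r := by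
    intro r hr
    apply intervalIntegral.integral_hasDerivAt_right
    · apply ContinuousOn.intervalIntegrable
      exact hp.mono (ordConnected_Ioo.uIcc_subset hmid hr)
    · exact hp.stronglyMeasurableAtFilter isOpen_Ioo r hr
    · exact hp.continuousAt (isOpen_Ioo.mem_nhds hr)
  have hL : ∀ r ∈ Ioo 0 R, HasDerivAt (fun r => m * (Real.log r - Real.log (R - r)))
      (m * (R / (r * (R - r)))) r := by
    intro r hr
    have h0 : r ≠ 0 := hr.1.ne'
    have h1 : R - r ≠ 0 := (sub_pos.2 hr.2).ne'
    have := ((Real.hasDerivAt_log h0).sub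
      (((hasDerivAt_id r).const_sub R).log h1)).const_mul m
    refine this.congr_deriv ?_
    simp only [id]
    field_simp
    ring
  have hmono : MonotoneOn (fun r => (∫ x in (R/2)..r, p x) - m * (Real.log r - Real.log (R - r)))
      (Ioo 0 R) := by
    apply monotoneOn_of_deriv_nonneg (convex_Ioo 0 R)
    · intro r hr
      exact ((hG r hr).sub (hL r hr)).continuousAt.continuousWithinAt
    · intro r hr
      rw [interior_Ioo] at hr
      exact ((hG r hr).sub (hL r hr)).differentiableAt.differentiableWithinAt
    · intro r hr
      rw [interior_Ioo] at hr
      have := ((hG r hr).sub (hL r hr)).deriv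
      have h2 := hpm r hr
      erw [this]
      linarith
  have hz : Real.log (R/2) - Real.log (R - R/2) = 0 := by
    rw [show R - R/2 = R/2 by ring, sub_self]
  refine ⟨_, hG, ?_, ?_⟩
  · have hT : Tendsto (fun r => m * (Real.log r - Real.log (R - r))) (𝓝[>] 0) atBot := by
      refine Tendsto.const_mul_atBot hm ?_
      simp_rw [sub_eq_add_neg]
      refine Tendsto.atBot_add (C := -Real.log (R - 0)) Real.tendsto_log_nhdsGT_zero ?_
      have : ContinuousAt (fun r => -Real.log (R - r)) 0 := by
        refine ((continuousAt_const.sub continuousAt_id).log ?_).neg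
        simpa using hR.ne'
      exact this.tendsto.mono_left nhdsWithin_le_nhds
    refine tendsto_atBot_mono' _ ?_ hT
    filter_upwards [Ioo_mem_nhdsGT hmid.1] with r hr
    have := hmono ⟨hr.1, hr.2.trans hmid.2⟩ hmid hr.2.le
    simp only [intervalIntegral.integral_same, hz] at this
    linarith
  · have hT : Tendsto (fun r => m * (Real.log r - Real.log (R - r))) (𝓝[<] R) atTop := by
      refine Tendsto.const_mul_atTop hm ?_
      simp_rw [sub_eq_add_neg]
      refine Tendsto.add_atTop (C := Real.log R) ?_ ?_
      · exact (Real.continuousAt_log hR.ne').tendsto.mono_left nhdsWithin_le_nhds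
      · refine tendsto_neg_atBot_atTop.comp (Real.tendsto_log_nhdsGT_zero.comp ?_)
        refine tendsto_nhdsWithin_iff.2 ⟨?_, ?_⟩
        · have : ContinuousAt (fun r => R + -r) R := by fun_prop
          have h2 := this.tendsto
          simp only [add_neg_cancel] at h2
          exact h2.mono_left nhdsWithin_le_nhds
        · filter_upwards [self_mem_nhdsWithin] with r hr
          have : r < R := hr
          show 0 < R + -r
          linarith
    refine tendsto_atTop_mono' _ ?_ hT
    filter_upwards [Ioo_mem_nhdsLT hmid.2] with r hr
    have := hmono hmid ⟨hmid.1.trans hr.1, hr.2⟩ hr.1.le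
    simp only [intervalIntegral.integral_same, hz] at this
    linarith

lemma aux_inv (R : ℝ) (hR : 0 < R) (G : ℝ → ℝ) (hc : ContinuousOn G (Ioo 0 R))
    (hs : StrictMonoOn G (Ioo 0 R))
    (h0 : Tendsto G (𝓝[>] 0) atBot) (h1 : Tendsto G (𝓝[<] R) atTop) :
    ∃ ρ : ℝ → ℝ, Continuous ρ ∧ (∀ y, ρ y ∈ Ioo 0 R) ∧ (∀ r ∈ Ioo 0 R, ρ (G r) = r) ∧
      Tendsto ρ atBot (𝓝 0) ∧ Tendsto ρ atTop (𝓝 R) := by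
  have hsurj : ∀ y, ∃ r : Ioo 0 R, G r = y := by
    intro y
    have := hc.surjOn_of_tendsto (nonempty_Ioo.2 hR)
      (by rw [← tendsto_comp_coe_Ioo_atBot hR] at h0; exact h0)
      (by rw [← tendsto_comp_coe_Ioo_atTop hR] at h1; exact h1)
    obtain ⟨r, hr, e⟩ := this (mem_univ y)
    exact ⟨⟨r, hr⟩, e⟩
  choose ρ hρ using hsurj
  have hinv : ∀ r : Ioo 0 R, ρ (G r) = r := fun r =>
    Subtype.ext (hs.injOn (ρ (G r)).2 r.2 (hρ _))
  have hmono : Monotone ρ := by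
    intro x y hxy
    have := (hs.le_iff_le (ρ x).2 (ρ y).2).1 (by rw [hρ, hρ]; exact hxy)
    exact this
  have hcont : Continuous ρ := hmono.continuous_of_surjective fun r => ⟨_, hinv r⟩
  refine ⟨fun y => ρ y, continuous_subtype_val.comp hcont, fun y => (ρ y).2, fun r hr => ?_, ?_, ?_⟩
  · exact congrArg Subtype.val (hinv ⟨r, hr⟩)
  · rw [tendsto_order]
    refine ⟨fun a ha => Eventually.of_forall fun y => ha.trans (ρ y).2.1, fun a ha => ?_⟩
    have hm : min (a/2) (R/2) ∈ Ioo 0 R :=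
      ⟨lt_min (by linarith) (by linarith), (min_le_right _ _).trans_lt (by linarith)⟩
    filter_upwards [eventually_le_atBot (G (min (a/2) (R/2)))] with y hy
    have : ρ y ≤ ⟨_, hm⟩ := by rw [← hinv ⟨_, hm⟩]; exact hmono hy
    exact (show (ρ y : ℝ) ≤ min (a/2) (R/2) from this).trans_lt
      ((min_le_left _ _).trans_lt (by linarith))
  · rw [tendsto_order]
    refine ⟨fun a ha => ?_, fun a ha => Eventually.of_forall fun y => (ρ y).2.2.trans ha⟩
    have hm : max ((a+R)/2) (R/2) ∈ Ioo 0 R :=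
      ⟨lt_of_lt_of_le (by linarith) (le_max_right _ _), max_lt (by linarith) (by linarith)⟩
    filter_upwards [eventually_ge_atTop (G (max ((a+R)/2) (R/2)))] with y hy
    have : ⟨_, hm⟩ ≤ ρ y := by rw [← hinv ⟨_, hm⟩]; exact hmono hy
    exact lt_of_lt_of_le (by linarith)
      ((le_max_left ((a+R)/2) (R/2)).trans (show max ((a+R)/2) (R/2) ≤ (ρ y : ℝ) from this))

theorem stmt_0
    (R : ℝ) (hR : 0 < R)
    (v f : ℝ → ℝ)
    (hv : ContDiff ℝ (⊤ : ℕ∞) v) (hf : ContDiff ℝ (⊤ : ℕ∞) f)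
    (hv0 : v 0 = 0) (hvR : v R = 0)
    (c₁ c₂ : ℝ) (hc₂ : 0 < c₂) (hc : c₂ ≤ c₁)
    (hvb : ∀ r ∈ Set.Icc 0 R,
      -c₁ * (r * (R - r)) ≤ v r ∧ v r ≤ -c₂ * (r * (R - r)))
    (hfneg : ∀ r ∈ Set.Icc 0 R, f r < 0)
    (h : ℝ → ℝ) (hh : ContinuousOn h (Set.Icc 0 R)) :
    (∃ φ : ℝ → ℝ, IsSingODESol v f h φ R ∧
      φ 0 = h 0 / f 0 ∧ φ R = h R / f R) ∧
    (∀ φ₁ φ₂ : ℝ → ℝ, IsSingODESol v f h φ₁ R → IsSingODESol v f h φ₂ R →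
      Set.EqOn φ₁ φ₂ (Set.Icc 0 R)) := by
  have hc₁ : 0 < c₁ := hc₂.trans_le hc
  have hvneg : ∀ r ∈ Ioo 0 R, v r < 0 := by
    intro r hr
    have h1 := (hvb r (Ioo_subset_Icc_self hr)).2
    have h2 : 0 < c₂ * (r * (R - r)) := mul_pos hc₂ (mul_pos hr.1 (sub_pos.2 hr.2))
    linarith
  have hvc : Continuous v := hv.continuous
  have hfc : Continuous f := hf.continuous
  -- lower bound of -f
  obtain ⟨x₀, hx₀, hmax⟩ := isCompact_Icc.exists_isMaxOn (nonempty_Icc.2 hR.le) hfc.continuousOn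
  have hx₀' := hfneg x₀ hx₀
  have hpc : ContinuousOn (fun r => f r / v r) (Ioo 0 R) :=
    hfc.continuousOn.div hvc.continuousOn fun r hr => (hvneg r hr).ne
  have hpm : ∀ r ∈ Ioo 0 R, (-f x₀ / (c₁ * R)) * (R / (r * (R - r))) ≤ f r / v r := by
    intro r hr
    have h1 := (hvb r (Ioo_subset_Icc_self hr)).1
    have h2 : f r ≤ f x₀ := hmax (Ioo_subset_Icc_self hr)
    have h3 : 0 < r * (R - r) := mul_pos hr.1 (sub_pos.2 hr.2)
    have h4 := hvneg r hr
    have e : (-f x₀ / (c₁ * R)) * (R / (r * (R - r))) = -f x₀ / (c₁ * (r * (R - r))) := by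
      have := h3.ne'
      have h5 : R - r ≠ 0 := (sub_pos.2 hr.2).ne'
      have h6 : r ≠ 0 := hr.1.ne'
      field_simp
    rw [e, ← neg_div_neg_eq (f r)]
    exact div_le_div₀ (by linarith) (by linarith) (by linarith) (by linarith)
  obtain ⟨G, hG, hG0, hGR⟩ := aux_G R hR _ hpc _ (div_pos (neg_pos.2 hx₀') (mul_pos hc₁ hR)) hpm
  have hGc : ContinuousOn G (Ioo 0 R) := fun r hr => (hG r hr).continuousAt.continuousWithinAt
  constructor
  · have hGs : StrictMonoOn G (Ioo 0 R) := by
      apply strictMonoOn_of_deriv_pos (convex_Ioo 0 R) hGc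
      intro r hr
      rw [interior_Ioo] at hr
      rw [(hG r hr).deriv]
      exact div_pos_of_neg_of_neg (hfneg r (Ioo_subset_Icc_self hr)) (hvneg r hr)
    obtain ⟨ρ, hρc, hρm, hρG, hρ0, hρR⟩ := aux_inv R hR G hGc hGs hG0 hGR
    have hk : ContinuousOn (fun r => h r / f r) (Icc 0 R) :=
      hh.div hfc.continuousOn fun r hr => (hfneg r hr).ne
    have hρm' : ∀ y, ρ y ∈ Icc 0 R := fun y => Ioo_subset_Icc_self (hρm y)
    obtain ⟨B, hB⟩ := isCompact_Icc.exists_bound_of_continuousOn hk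
    have hlim : ∀ (l : Filter ℝ) (c : ℝ), c ∈ Icc 0 R → Tendsto ρ l (𝓝 c) →
        Tendsto (fun y => h (ρ y) / f (ρ y)) l (𝓝 (h c / f c)) := by
      intro l c hc' hl
      exact Tendsto.comp (hk c hc') (tendsto_nhdsWithin_iff.2 ⟨hl, Eventually.of_forall hρm'⟩)
    obtain ⟨Φ, hΦ, hΦ0, hΦR⟩ := aux_Phi (fun y => h (ρ y) / f (ρ y))
      (hk.comp_continuous hρc hρm') B _ _ (fun x => hB _ (hρm' x))
      (hlim _ 0 (left_mem_Icc.2 hR.le) hρ0) (hlim _ R (right_mem_Icc.2 hR.le) hρR)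
    let φ : ℝ → ℝ := fun r => if r ≤ 0 then h 0 / f 0 else if R ≤ r then h R / f R else Φ (G r)
    have φ0 : φ 0 = h 0 / f 0 := by simp [φ]
    have φR : φ R = h R / f R := by simp [φ, hR]
    have φin : ∀ r ∈ Ioo 0 R, φ r = Φ (G r) := fun r hr => by
      simp [φ, not_le.2 hr.1, not_le.2 hr.2]
    have hd : ∀ r ∈ Ioo 0 R, HasDerivAt φ ((φ r - h r / f r) * (f r / v r)) r := by
      intro r hr
      have h1 := (hΦ (G r)).comp r (hG r hr)
      rw [hρG r hr, ← φin r hr] at h1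
      refine h1.congr_of_eventuallyEq ?_
      filter_upwards [isOpen_Ioo.mem_nhds hr] with x hx using φin x hx
    have hφc : ContinuousOn φ (Icc 0 R) := by
      intro r hr
      rcases eq_or_lt_of_le hr.1 with h0 | h0
      · subst h0
        rw [continuousWithinAt_Icc_iff_Ici hR, ← continuousWithinAt_Ioi_iff_Ici,
          ContinuousWithinAt, φ0]
        refine (hΦ0.comp hG0).congr' ?_
        filter_upwards [Ioo_mem_nhdsGT hR] with x hx using (φin x hx).symm
      rcases eq_or_lt_of_le hr.2 with h1 | h1
      · subst h1
        rw [continuousWithinAt_Icc_iff_Iic hR, ← continuousWithinAt_Iio_iff_Iic,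
          ContinuousWithinAt, φR]
        refine (hΦR.comp hGR).congr' ?_
        filter_upwards [Ioo_mem_nhdsLT hR] with x hx using (φin x hx).symm
      exact (hd r ⟨h0, h1⟩).continuousAt.continuousWithinAt
    refine ⟨φ, ⟨hφc, fun r hr => (hd r hr).differentiableAt, ?_, ?_⟩, φ0, φR⟩
    · have : ContinuousOn (fun r => (φ r - h r / f r) * (f r / v r)) (Ioo 0 R) :=
        ((hφc.sub hk).mono Ioo_subset_Icc_self).mul hpc
      exact this.congr fun r hr => (hd r hr).deriv
    · intro r hr
      rw [(hd r hr).deriv]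
      have h1 := (hvneg r hr).ne
      have h2 := (hfneg r (Ioo_subset_Icc_self hr)).ne
      field_simp
      ring
  · rintro φ₁ φ₂ ⟨hc1, hd1, -, he1⟩ ⟨hc2, hd2, -, he2⟩
    have hD : ∀ r ∈ Ioo 0 R,
        HasDerivAt (fun r => (φ₁ r - φ₂ r) * Real.exp (-G r)) 0 r := by
      intro r hr
      have h1 := ((hd1 r hr).hasDerivAt.sub (hd2 r hr).hasDerivAt).mul (hG r hr).neg.exp
      refine h1.congr_deriv ?_
      have e : v r * (deriv φ₁ r - deriv φ₂ r) = f r * (φ₁ r - φ₂ r) := by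
        linear_combination he2 r hr - he1 r hr
      have e2 : deriv φ₁ r - deriv φ₂ r = f r / v r * (φ₁ r - φ₂ r) := by
        have := (hvneg r hr).ne
        field_simp
        linarith
      simp only [Pi.sub_apply, Pi.neg_apply, e2]
      ring
    have hconst : ∀ x ∈ Ioo 0 R, ∀ y ∈ Ioo 0 R, (φ₁ x - φ₂ x) * Real.exp (-G x)
        = (φ₁ y - φ₂ y) * Real.exp (-G y) := by
      intro x hx y hy
      refine isOpen_Ioo.is_const_of_deriv_eq_zero isPreconnected_Ioo
        (fun r hr => (hD r hr).differentiableAt.differentiableWithinAt)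
        (fun r hr => (hD r hr).deriv) hx hy
    have hEq : EqOn φ₁ φ₂ (Ioo 0 R) := by
      intro x hx
      have hR' : R ∈ Icc 0 R := right_mem_Icc.2 hR.le
      have t1 : Tendsto (fun r => φ₁ r - φ₂ r) (𝓝[<] R) (𝓝 (φ₁ R - φ₂ R)) := by
        have := (hc1.sub hc2) R hR'
        rw [continuousWithinAt_Icc_iff_Iic hR] at this
        exact this.mono_left (nhdsWithin_mono _ Iio_subset_Iic_self)
      have t2 : Tendsto (fun r => Real.exp (-G r)) (𝓝[<] R) (𝓝 0) :=
        Real.tendsto_exp_neg_atTop_nhds_zero.comp hGR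
      have t3 := t1.mul t2
      rw [mul_zero] at t3
      have t4 : Tendsto (fun r => (φ₁ r - φ₂ r) * Real.exp (-G r)) (𝓝[<] R)
          (𝓝 ((φ₁ x - φ₂ x) * Real.exp (-G x))) := by
        refine tendsto_const_nhds.congr' ?_
        filter_upwards [Ioo_mem_nhdsLT hR] with y hy using hconst x hx y hy
      have := tendsto_nhds_unique t4 t3
      rcases mul_eq_zero.1 this with h | h
      · linarith
      · exact absurd h (Real.exp_pos _).ne'
    refine hEq.of_subset_closure hc1 hc2 Ioo_subset_Icc_self ?_
    rw [closure_Ioo hR.ne]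
end

section
/- There exists a constant C > 0, depending only on v, f and R, such that for every continuous function h : [0,R] → ℝ, the unique solution φ ∈ C[0,R] ∩ C¹(0,R) of the singular ODE −v(r)φ′(r) + f(r)φ(r) = h(r) on (0,R) satisfies max_{0≤r≤R} |φ(r)| ≤ C · max_{0≤r≤R} |h(r)|. -/
open MeasureTheory Set Filter Topology

lemma upper_aux (R K m M : ℝ) (hR : 0 < R) (hK : 0 < K) (hm : 0 < m) (hM : 0 ≤ M)
    (w φ : ℝ → ℝ) (hφ : ContinuousOn φ (Icc 0 R))
    (hd : ∀ r ∈ Ioo 0 R, DifferentiableAt ℝ φ r)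
    (hw : ∀ r ∈ Ioo 0 R, 0 < w r ∧ w r ≤ K * (R - r))
    (hP : ∀ r ∈ Ioo 0 R, 0 < φ r → m * φ r - M ≤ w r * deriv φ r) :
    ∀ r ∈ Icc 0 R, φ r ≤ M / m := by
  obtain ⟨x, hx, hmax⟩ := isCompact_Icc.exists_isMaxOn (nonempty_Icc.2 hR.le) hφ
  suffices hxx : φ x ≤ M / m from fun r hr => (hmax hr).trans hxx
  by_contra! hcon
  obtain ⟨b, hb1, hb2⟩ := exists_between hcon
  have hbM : M < m * b := by rwa [div_lt_iff₀' hm] at hb1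
  have hb0 : 0 < b := lt_of_le_of_lt (by positivity) hb1
  have hev : ∀ᶠ y in 𝓝[Icc 0 R] x, b < φ y := (hφ x hx).eventually (lt_mem_nhds hb2)
  obtain ⟨ε, hε, hball⟩ := Metric.mem_nhdsWithin_iff.1 hev
  have hnear : ∀ y ∈ Ioo 0 R, |y - x| < ε → m * b - M ≤ w y * deriv φ y := by
    intro y hy hyx
    have h1 : b < φ y := hball ⟨by simpa [Real.dist_eq] using hyx, Ioo_subset_Icc_self hy⟩
    have := hP y hy (hb0.trans h1)
    nlinarith
  rcases eq_or_lt_of_le hx.1 with h0 | h0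
  · subst h0
    obtain ⟨t, ht0, ht⟩ := exists_between (lt_min hε hR)
    have htε := ht.trans_le (min_le_left _ _)
    have htR := ht.trans_le (min_le_right _ _)
    have hs : StrictMonoOn φ (Icc 0 t) := by
      apply strictMonoOn_of_deriv_pos (convex_Icc _ _) (hφ.mono (Icc_subset_Icc_right htR.le))
      intro y hy
      rw [interior_Icc] at hy
      have hy' : y ∈ Ioo 0 R := ⟨hy.1, hy.2.trans htR⟩
      have h1 := hnear y hy' (by rw [sub_zero, abs_of_pos hy.1]; exact hy.2.trans htε)
      exact pos_of_mul_pos_right (lt_of_lt_of_le (by linarith) h1) (hw y hy').1.le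
    have h1 := hs (left_mem_Icc.2 ht0.le) (right_mem_Icc.2 ht0.le) ht0
    have h2 : φ t ≤ φ 0 := hmax ⟨ht0.le, htR.le⟩
    linarith
  rcases eq_or_lt_of_le hx.2 with h1 | h1
  · subst h1
    obtain ⟨a, ha, hax⟩ := exists_between (max_lt h0 (sub_lt_self x hε))
    have ha0 := (le_max_left _ _).trans_lt ha
    have haε := (le_max_right _ _).trans_lt ha
    set k := (m * b - M) / K with hk
    have hk0 : 0 < k := div_pos (by linarith) hK
    have hdψ : ∀ y ∈ Ioo 0 x, HasDerivAt (fun r => φ r + k * Real.log (x - r))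
        (deriv φ y + k * (-1 / (x - y))) y := by
      intro y hy
      have hne : x - y ≠ 0 := (sub_pos.2 hy.2).ne'
      exact (hd y hy).hasDerivAt.add ((((hasDerivAt_id y).const_sub x).log hne).const_mul k)
    have hmono : MonotoneOn (fun r => φ r + k * Real.log (x - r)) (Ico a x) := by
      apply monotoneOn_of_deriv_nonneg (convex_Ico _ _)
      · intro y hy
        exact (hdψ y ⟨ha0.trans_le hy.1, hy.2⟩).continuousAt.continuousWithinAt
      · intro y hy
        rw [interior_Ico] at hy
        exact (hdψ y ⟨ha0.trans hy.1, hy.2⟩).differentiableAt.differentiableWithinAt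
      · intro y hy
        rw [interior_Ico] at hy
        have hy' : y ∈ Ioo 0 x := ⟨ha0.trans hy.1, hy.2⟩
        rw [(hdψ y hy').deriv]
        have h1 := hnear y hy' (by rw [abs_lt]; constructor <;> linarith [hy.1, hy.2])
        have hpos : 0 < x - y := sub_pos.2 hy.2
        obtain ⟨hw1, hw2⟩ := hw y hy'
        have hd0 : 0 < deriv φ y :=
          pos_of_mul_pos_right (lt_of_lt_of_le (by linarith) h1) hw1.le
        have h2 : m * b - M ≤ K * (x - y) * deriv φ y :=
          h1.trans (mul_le_mul_of_nonneg_right hw2 hd0.le)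
        have h3 : k / (x - y) ≤ deriv φ y := by
          rw [hk, div_div, div_le_iff₀ (by positivity)]
          linarith
        have h4 : k * (-1 / (x - y)) = - (k / (x - y)) := by ring
        linarith
    have hlim : Tendsto (fun n : ℝ => Real.exp (-n)) atTop (𝓝 0) :=
      Real.tendsto_exp_neg_atTop_nhds_zero
    have hE := hlim.eventually (gt_mem_nhds (sub_pos.2 hax))
    obtain ⟨n, hn1, hn2⟩ :=
      (hE.and (eventually_gt_atTop ((φ x - (φ a + k * Real.log (x - a))) / k))).exists
    have hnp := Real.exp_pos (-n)
    have h2 := hmono (a := a) (b := x - Real.exp (-n)) ⟨le_rfl, hax⟩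
      ⟨by linarith, by linarith⟩ (by linarith)
    have h3 : φ (x - Real.exp (-n)) ≤ φ x := hmax ⟨by linarith, by linarith⟩
    simp only [sub_sub_cancel, Real.log_exp] at h2
    rw [div_lt_iff₀ hk0] at hn2
    linarith
  · have hloc : IsLocalMax φ x := hmax.isLocalMax (Icc_mem_nhds h0 h1)
    have h2 := hnear x ⟨h0, h1⟩ (by simpa using hε)
    rw [hloc.deriv_eq_zero] at h2
    linarith

theorem stmt_1
    (R : ℝ) (hR : 0 < R)
    (v f : ℝ → ℝ)
    (hv : ContDiff ℝ (⊤ : ℕ∞) v) (hf : ContDiff ℝ (⊤ : ℕ∞) f)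
    (hv0 : v 0 = 0) (hvR : v R = 0)
    (c₁ c₂ : ℝ) (hc₂ : 0 < c₂) (hc : c₂ ≤ c₁)
    (hvb : ∀ r ∈ Set.Icc 0 R,
      -c₁ * (r * (R - r)) ≤ v r ∧ v r ≤ -c₂ * (r * (R - r)))
    (hfneg : ∀ r ∈ Set.Icc 0 R, f r < 0) :
    ∃ C > 0, ∀ h φ : ℝ → ℝ, ContinuousOn h (Set.Icc 0 R) →
      IsSingODESol v f h φ R →
      ∀ M : ℝ, (∀ s ∈ Set.Icc 0 R, |h s| ≤ M) →
        ∀ r ∈ Set.Icc 0 R, |φ r| ≤ C * M := by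
  obtain ⟨x, hx, hmax⟩ := isCompact_Icc.exists_isMaxOn (nonempty_Icc.2 hR.le)
    hf.continuous.continuousOn
  have hm : 0 < -f x := neg_pos.2 (hfneg x hx)
  have hfm : ∀ r ∈ Icc 0 R, f r ≤ f x := fun r hr => hmax hr
  have hw : ∀ r ∈ Ioo 0 R, 0 < -v r ∧ -v r ≤ (c₁ * R) * (R - r) := by
    intro r hr
    obtain ⟨h1, h2⟩ := hvb r (Ioo_subset_Icc_self hr)
    have h3 : 0 < R - r := sub_pos.2 hr.2
    have h4 : 0 < c₂ * (r * (R - r)) := mul_pos hc₂ (mul_pos hr.1 h3)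
    have h5 : 0 < c₁ * (R - r) * (R - r) := by
      have : 0 < c₁ := by linarith
      positivity
    constructor <;> nlinarith
  refine ⟨1 / (-f x), by positivity, ?_⟩
  rintro h φ - ⟨hφ, hd, -, hode⟩ M hM r hr
  have hM0 : 0 ≤ M := (abs_nonneg _).trans (hM r hr)
  have hK : 0 < c₁ * R := mul_pos (by linarith) hR
  have e1 := upper_aux R (c₁ * R) (-f x) M hR hK hm hM0 (fun r => -v r) φ hφ hd hw (by
    intro y hy hpos
    have h1 := hode y hy
    have hy' := Ioo_subset_Icc_self hy
    have h2 := abs_le.1 (hM y hy')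
    have h3 := mul_le_mul_of_nonneg_right (hfm y hy') hpos.le
    linarith [h2.1]) r hr
  have e2 := upper_aux R (c₁ * R) (-f x) M hR hK hm hM0 (fun r => -v r) (fun r => - φ r)
    hφ.neg (fun y hy => (hd y hy).neg) hw (by
    intro y hy hpos
    have h1 := hode y hy
    have hy' := Ioo_subset_Icc_self hy
    have h2 := abs_le.1 (hM y hy')
    have h3 := mul_le_mul_of_nonneg_right (hfm y hy') hpos.le
    have h4 : deriv (fun r => - φ r) y = - deriv φ y := (hd y hy).hasDerivAt.neg.deriv
    simp only [h4]
    linarith [h2.2]) r hr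
  have e3 : 1 / (-f x) * M = M / (-f x) := by ring
  rw [e3, abs_le]
  constructor <;> linarith
end

section
/- Suppose h : [0,R] → ℝ is continuous and there exist constants A > 0 and μ > 0 with |h(r)| ≤ A r^μ for all r ∈ (0,R]. Then the unique solution φ ∈ C[0,R] ∩ C¹(0,R) of the singular ODE −v(r)φ′(r) + f(r)φ(r) = h(r) on (0,R) satisfies |φ(r)| ≤ C m_μ(r) for all 0 < r < R, where C > 0 depends on v, f, μ and A but not otherwise on h, and where m_μ(r) = r^{α₀} if μ > α₀, m_μ(r) = r^{α₀} ln(2R/r) if μ = α₀, and m_μ(r) = r^μ if μ < α₀. -/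
open MeasureTheory Set Filter Topology

/-- The comparison function `m_μ`, where `α₀` is the parameter `f(0)/v'(0)`. -/
noncomputable def mFun (α₀ R μ r : ℝ) : ℝ :=
  if α₀ < μ then r ^ α₀
  else if μ = α₀ then r ^ α₀ * Real.log (2 * R / r)
  else r ^ μ

/-- Maximum principle. -/
lemma aux_cmp (a b : ℝ) (hab : a < b) (u u' : ℝ → ℝ) (hc : ContinuousOn u (Icc a b))
    (hb : u b ≤ 0) (hd : ∀ x ∈ Ico a b, HasDerivAt u (u' x) x)
    (hp : ∀ x ∈ Ico a b, 0 < u x → 0 < u' x) : u a ≤ 0 := by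
  by_contra! ha
  obtain ⟨x, hx, hmax⟩ := isCompact_Icc.exists_isMaxOn (nonempty_Icc.2 hab.le) hc
  have h1 : u a ≤ u x := hmax (left_mem_Icc.2 hab.le)
  have hxb : x < b := by
    rcases hx.2.lt_or_eq with h | h
    · exact h
    · subst h; linarith
  have hxm : x ∈ Ico a b := ⟨hx.1, hxb⟩
  have h2 := hp x hxm (by linarith)
  have h3 : Tendsto (slope u x) (𝓝[>] x) (𝓝 (u' x)) :=
    (hasDerivAt_iff_tendsto_slope.1 (hd x hxm)).mono_left
      (nhdsWithin_mono _ (fun y hy => ne_of_gt hy))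
  have h4 : ∀ᶠ y in 𝓝[>] x, 0 < slope u x y := h3.eventually (lt_mem_nhds h2)
  have h5 : ∀ᶠ y in 𝓝[>] x, y ∈ Ioo x b := Ioo_mem_nhdsGT hxb
  obtain ⟨y, hy1, hy2⟩ := (h4.and h5).exists
  have h6 : u y ≤ u x := hmax ⟨hx.1.trans hy2.1.le, hy2.2.le⟩
  rw [slope_def_field] at hy1
  have h7 : 0 < y - x := sub_pos.2 hy2.1
  have := (div_pos_iff_of_pos_right h7).1 hy1
  linarith

/-- Global one-sided bound. -/
lemma aux_global (R : ℝ) (hR : 0 < R) (w g h φ φ' : ℝ → ℝ) (c₁ g0 K : ℝ) (hc₁ : 0 < c₁)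
    (hg0 : 0 < g0)
    (hw : ∀ r ∈ Ioo 0 R, 0 < w r) (hw1 : ∀ r ∈ Ioo 0 R, w r ≤ c₁ * (r * (R - r)))
    (hg : ∀ r ∈ Ioo 0 R, g0 ≤ g r) (hK : 0 < K)
    (hh : ∀ r ∈ Ioo 0 R, h r < g0 * K)
    (hφ : ContinuousOn φ (Icc 0 R)) (hd : ∀ r ∈ Ioo 0 R, HasDerivAt φ (φ' r) r)
    (he : ∀ r ∈ Ioo 0 R, w r * φ' r = g r * φ r - h r * (-1)) :
    (∀ r ∈ Ioo 0 R, -h r < g0 * K) → ∀ r ∈ Ioo 0 R, φ r ≤ K := by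
  intro hh' r hr
  set β : ℝ := g0 / (c₁ * R) with hβ
  have hβ0 : 0 < β := by positivity
  have hβ1 : β * (c₁ * R) = g0 := by rw [hβ]; field_simp
  have key := aux_cmp r R hr.2 (fun x => (φ x - K) * (R - x) ^ β)
    (fun x => φ' x * (R - x) ^ β + (φ x - K) * (-1 * β * (R - x) ^ (β - 1))) ?_ ?_ ?_ ?_
  · have h1 : 0 < (R - r) ^ β := Real.rpow_pos_of_pos (sub_pos.2 hr.2) _
    by_contra! h2
    have : 0 < (φ r - K) * (R - r) ^ β := mul_pos (by linarith) h1
    linarith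
  · refine ContinuousOn.mul ((hφ.mono (Icc_subset_Icc_left hr.1.le)).sub continuousOn_const) ?_
    refine ContinuousOn.rpow_const (by fun_prop) (fun x _ => Or.inr hβ0.le)
  · simp [Real.zero_rpow hβ0.ne']
  · intro x hx
    have hx' : x ∈ Ioo 0 R := ⟨hr.1.trans_le hx.1, hx.2⟩
    have h1 : HasDerivAt (fun x => R - x) (-1) x := by
      simpa using (hasDerivAt_id x).const_sub R
    exact ((hd x hx').sub_const K).mul (h1.rpow_const (Or.inl (sub_pos.2 hx.2).ne'))
  · intro x hx hpos
    have hx' : x ∈ Ioo 0 R := ⟨hr.1.trans_le hx.1, hx.2⟩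
    have hs : 0 < R - x := sub_pos.2 hx.2
    have hP : 0 < (R - x) ^ (β - 1) := Real.rpow_pos_of_pos hs _
    have hP2 : (R - x) ^ β = (R - x) ^ (β - 1) * (R - x) := by
      rw [← Real.rpow_add_one hs.ne']; ring_nf
    have hu : 0 < φ x - K := by
      by_contra! h2
      have := mul_nonpos_of_nonpos_of_nonneg h2 (Real.rpow_nonneg hs.le β)
      linarith
    have e : φ' x * (R - x) ^ β + (φ x - K) * (-1 * β * (R - x) ^ (β - 1))
        = (R - x) ^ (β - 1) * (φ' x * (R - x) - β * (φ x - K)) := by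
      rw [hP2]; ring
    rw [e]
    refine mul_pos hP ?_
    have hwx := hw x hx'
    refine pos_of_mul_pos_right (a := w x) ?_ hwx.le
    have e2 : w x * (φ' x * (R - x) - β * (φ x - K))
        = (R - x) * (g x * φ x + h x) - β * w x * (φ x - K) := by
      have := he x hx'
      linear_combination (R - x) * this
    rw [e2]
    have b1 : β * w x ≤ (R - x) * g0 := by
      calc β * w x ≤ β * (c₁ * (x * (R - x))) := by gcongr; exact hw1 x hx'
        _ ≤ β * (c₁ * (R * (R - x))) := by gcongr; exact hx.2.le
        _ = (R - x) * g0 := by rw [← hβ1]; ring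
    have b2 : β * w x * (φ x - K) ≤ (R - x) * g0 * (φ x - K) := by gcongr
    have b3 : g0 * φ x ≤ g x * φ x := by
      have : 0 < φ x := by linarith
      gcongr; exact hg x hx'
    have b4 := hh' x hx'
    have b5 : 0 < (R - x) * (g x * φ x + h x - g0 * (φ x - K)) := by
      apply mul_pos hs; linarith
    linarith

/-- Local one-sided barrier. -/
lemma aux_local (r0 : ℝ) (w g h φ φ' p p' : ℝ → ℝ)
    (hw : ∀ r ∈ Ioc 0 r0, 0 < w r) (hg : ∀ r ∈ Ioc 0 r0, 0 < g r)
    (hd : ∀ r ∈ Ioc 0 r0, HasDerivAt φ (φ' r) r)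
    (hdp : ∀ r ∈ Ioc 0 r0, HasDerivAt p (p' r) r)
    (he : ∀ r ∈ Ioc 0 r0, w r * φ' r = g r * φ r + h r)
    (hp : ∀ r ∈ Ioc 0 r0, -h r < g r * p r - w r * p' r)
    (h0 : φ r0 ≤ p r0) : ∀ r ∈ Ioc 0 r0, φ r ≤ p r := by
  intro r hr
  rcases hr.2.lt_or_eq with hlt | heq
  swap
  · rw [heq]; exact h0
  have key := aux_cmp r r0 hlt (fun x => φ x - p x) (fun x => φ' x - p' x) ?_ ?_ ?_ ?_
  · linarith
  · intro x hx
    have hx' : x ∈ Ioc 0 r0 := ⟨hr.1.trans_le hx.1, hx.2⟩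
    exact ((hd x hx').sub (hdp x hx')).continuousAt.continuousWithinAt
  · linarith
  · intro x hx
    have hx' : x ∈ Ioc 0 r0 := ⟨hr.1.trans_le hx.1, hx.2.le⟩
    exact (hd x hx').sub (hdp x hx')
  · intro x hx hpos
    have hx' : x ∈ Ioc 0 r0 := ⟨hr.1.trans_le hx.1, hx.2.le⟩
    refine pos_of_mul_pos_right (a := w x) ?_ (hw x hx').le
    have := mul_pos (hg x hx') hpos
    have := he x hx'
    have := hp x hx'
    nlinarith

/-- Abstract conclusion from a barrier. -/
lemma aux_main (R : ℝ) (hR : 0 < R) (w g : ℝ → ℝ) (c₁ g0 μ A : ℝ) (hc₁ : 0 < c₁)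
    (hg0 : 0 < g0) (hA : 0 < A) (hμ : 0 < μ)
    (hw : ∀ r ∈ Ioo 0 R, 0 < w r) (hw1 : ∀ r ∈ Ioo 0 R, w r ≤ c₁ * (r * (R - r)))
    (hg : ∀ r ∈ Ioo 0 R, g0 ≤ g r)
    (p p' mF : ℝ → ℝ) (c : ℝ) (hc : 0 < c)
    (hp : ∀ᶠ r in 𝓝[>] (0:ℝ), HasDerivAt p (p' r) r ∧ c * r ^ μ ≤ g r * p r - w r * p' r ∧
      0 < p r ∧ p r ≤ mF r)
    (hm : ∀ r0 ∈ Ioo 0 R, ∃ l > 0, ∀ r ∈ Ico r0 R, l ≤ mF r) :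
    ∃ C > 0, ∀ h φ φ' : ℝ → ℝ, (∀ r ∈ Ioc 0 R, |h r| ≤ A * r ^ μ) →
      ContinuousOn φ (Icc 0 R) → (∀ r ∈ Ioo 0 R, HasDerivAt φ (φ' r) r) →
      (∀ r ∈ Ioo 0 R, w r * φ' r = g r * φ r + h r) →
      ∀ r ∈ Ioo 0 R, φ r ≤ C * mF r := by
  have hp2 : ∀ᶠ r in 𝓝[>] (0:ℝ), r < R := nhdsWithin_le_nhds (gt_mem_nhds hR)
  obtain ⟨r1, hr1, hp3⟩ := (mem_nhdsGT_iff_exists_Ioc_subset).1 (hp.and hp2)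
  have hr1 : 0 < r1 := hr1
  have hr1R : r1 < R := (hp3 ⟨hr1, le_rfl⟩).2
  obtain ⟨l, hl, hml⟩ := hm r1 ⟨hr1, hr1R⟩
  have hpr1 : 0 < p r1 := (hp3 ⟨hr1, le_rfl⟩).1.2.2.1
  set K : ℝ := A * R ^ μ / g0 + 1 with hK
  have hRμ : 0 < R ^ μ := Real.rpow_pos_of_pos hR _
  have hK0 : 0 < K := by positivity
  set M : ℝ := K / p r1 + 2 * A / c with hM
  have hM0 : 0 < M := by positivity
  refine ⟨M + K / l, by positivity, ?_⟩
  intro h φ φ' hh hφ hd he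
  have hKg : g0 * K = A * R ^ μ + g0 := by rw [hK]; field_simp
  have hhb : ∀ r ∈ Ioo 0 R, |h r| < g0 * K := by
    intro r hr
    have h1 := hh r ⟨hr.1, hr.2.le⟩
    have h2 : r ^ μ ≤ R ^ μ := Real.rpow_le_rpow hr.1.le hr.2.le hμ.le
    have := mul_le_mul_of_nonneg_left h2 hA.le
    linarith
  have hG := aux_global R hR w g h φ φ' c₁ g0 K hc₁ hg0 hw hw1 hg hK0
    (fun r hr => (abs_lt.1 (hhb r hr)).2) hφ hd (fun r hr => by rw [he r hr]; ring)
    (fun r hr => by linarith [(abs_lt.1 (hhb r hr)).1])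
  have sub : ∀ r ∈ Ioc 0 r1, r ∈ Ioo 0 R := fun r hr => ⟨hr.1, hr.2.trans_lt hr1R⟩
  have hL := aux_local r1 w g h φ φ' (fun x => M * p x) (fun x => M * p' x)
    (fun r hr => hw r (sub r hr)) (fun r hr => hg0.trans_le (hg r (sub r hr)))
    (fun r hr => hd r (sub r hr)) (fun r hr => ((hp3 hr).1.1).const_mul M)
    (fun r hr => he r (sub r hr)) ?_ ?_
  · intro r hr
    rcases le_or_gt r r1 with h1 | h1
    · have h2 := hL r ⟨hr.1, h1⟩
      obtain ⟨_, _, h3, h4⟩ := (hp3 ⟨hr.1, h1⟩).1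
      have h5 : 0 < K / l * mF r := mul_pos (by positivity) (h3.trans_le h4)
      have h6 : M * p r ≤ M * mF r := by gcongr
      linarith
    · have h2 := hG r hr
      have h3 := hml r ⟨h1.le, hr.2⟩
      have h4 : K / l * l ≤ K / l * mF r := by gcongr
      rw [div_mul_cancel₀ _ hl.ne'] at h4
      have h5 : 0 < M * mF r := mul_pos hM0 (by linarith)
      linarith
  · intro r hr
    obtain ⟨_, h2, _, _⟩ := (hp3 hr).1
    have h1 := hh r ⟨hr.1, (sub r hr).2.le⟩
    have hrμ : 0 < r ^ μ := Real.rpow_pos_of_pos hr.1 _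
    have h3 : 2 * A ≤ M * c := by
      rw [hM, add_mul, div_mul_cancel₀ _ hc.ne']
      have : 0 < K / p r1 * c := by positivity
      linarith
    have h4 : M * (c * r ^ μ) ≤ M * (g r * p r - w r * p' r) := by gcongr
    have h5 : 2 * A * r ^ μ ≤ M * c * r ^ μ := by gcongr
    have h6 : 0 < A * r ^ μ := by positivity
    have h7 := neg_le_abs (h r)
    nlinarith
  · have h1 := hG r1 ⟨hr1, hr1R⟩
    have : K / p r1 * p r1 = K := div_mul_cancel₀ _ hpr1.ne'
    have h2 : 0 < 2 * A / c * p r1 := by positivity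
    simp only [hM, add_mul]
    linarith

/-- Second-order Taylor lower bound. -/
lemma aux_taylor (q : ℝ → ℝ) (hq : ContDiff ℝ (⊤ : ℕ∞) q) (h0 : q 0 = 0) (h1 : deriv q 0 = 0) :
    ∃ B > 0, ∀ r ∈ Ioo (0:ℝ) 1, |q r| ≤ B * r ^ 2 := by
  obtain ⟨C, hC⟩ := exists_taylor_mean_remainder_bound (f := q) (a := 0) (b := 1) (n := 1)
    zero_le_one ((hq.of_le (by norm_cast)).contDiffOn)
  refine ⟨|C| + 1, by positivity, fun r hr => ?_⟩
  have h2 := hC r ⟨hr.1.le, hr.2.le⟩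
  have hd : derivWithin q (Icc 0 1) 0 = 0 := by
    rw [(hq.differentiable (by simp)).differentiableAt.derivWithin
      (uniqueDiffOn_Icc zero_lt_one 0 (by simp)), h1]
  have e : taylorWithinEval q 1 (Icc 0 1) 0 r = 0 := by
    rw [taylorWithinEval_succ, taylor_within_zero_eval, h0, iteratedDerivWithin_one, hd]
    simp
  rw [e] at h2
  simp only [sub_zero, Real.norm_eq_abs] at h2
  norm_num at h2
  have := le_abs_self C
  nlinarith [sq_nonneg r]

/-- Existence of the barrier. -/
lemma aux_barrier (R : ℝ) (hR : 0 < R) (w g : ℝ → ℝ) (α μ d B : ℝ) (hα : 0 < α)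
    (hd : 0 < d) (hB : 0 < B)
    (hw : ∀ᶠ r in 𝓝[>] (0:ℝ), d * r ≤ w r)
    (hq : ∀ᶠ r in 𝓝[>] (0:ℝ), |r * g r - α * w r| ≤ B * r ^ 2) :
    ∃ p p' : ℝ → ℝ, ∃ c > 0, ∀ᶠ r in 𝓝[>] (0:ℝ), HasDerivAt p (p' r) r ∧
      c * r ^ μ ≤ g r * p r - w r * p' r ∧ 0 < p r ∧ p r ≤ mFun α R μ r := by
  have hpos : ∀ᶠ r in 𝓝[>] (0:ℝ), 0 < r := self_mem_nhdsWithin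
  have hlt : ∀ ε > 0, ∀ᶠ r in 𝓝[>] (0:ℝ), r < ε :=
    fun ε hε => nhdsWithin_le_nhds (gt_mem_nhds hε)
  have hpow : ∀ s : ℝ, 0 < s → ∀ ε > (0:ℝ), ∀ᶠ r in 𝓝[>] (0:ℝ), r ^ s < ε := by
    intro s hs ε hε
    have : Tendsto (fun r : ℝ => r ^ s) (𝓝[>] 0) (𝓝 0) := by
      have := (Real.continuousAt_rpow_const 0 s (Or.inr hs.le)).tendsto
      rw [Real.zero_rpow hs.ne'] at this
      exact this.mono_left nhdsWithin_le_nhds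
    exact this.eventually (gt_mem_nhds hε)
  rcases lt_trichotomy α μ with h | h | h
  · -- μ > α
    set ν : ℝ := min (μ - α) (1 / 2) with hν
    have hν0 : 0 < ν := lt_min (by linarith) (by norm_num)
    have hν1 : ν ≤ 1 / 2 := min_le_right _ _
    have hν2 : ν ≤ μ - α := min_le_left _ _
    refine ⟨fun r => r ^ α - r ^ (α + ν),
      fun r => α * r ^ (α - 1) - (α + ν) * r ^ (α + ν - 1), ν * d / 2, by positivity, ?_⟩
    filter_upwards [hpos, hw, hq, hlt 1 one_pos, hlt (ν * d / (4 * B)) (by positivity),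
      hpow (1 - ν) (by linarith) (ν * d / (4 * B)) (by positivity), hpow ν hν0 1 one_pos]
      with r hr hw hq hr1 hr2 hr3 hr4
    have eα : r ^ α = r ^ (α - 1) * r := by rw [← Real.rpow_add_one hr.ne']; ring_nf
    have hP : 0 < r ^ (α - 1) := Real.rpow_pos_of_pos hr _
    have hPα : 0 < r ^ α := Real.rpow_pos_of_pos hr _
    have hPν : 0 < r ^ ν := Real.rpow_pos_of_pos hr _
    have e1 : r ^ (α + ν) = r ^ (α - 1) * r * r ^ ν := by
      rw [Real.rpow_add hr, eα]
    have e2 : r ^ (α + ν - 1) = r ^ (α - 1) * r ^ ν := by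
      rw [← Real.rpow_add hr]; ring_nf
    have e3 : r = r ^ (1 - ν) * r ^ ν := by
      rw [← Real.rpow_add hr]; simp
    refine ⟨?_, ?_, ?_, ?_⟩
    · exact (Real.hasDerivAt_rpow_const (Or.inl hr.ne')).sub
        (Real.hasDerivAt_rpow_const (Or.inl hr.ne'))
    · have b0 : r ^ μ ≤ r ^ (α + ν) :=
        Real.rpow_le_rpow_of_exponent_ge hr hr1.le (by linarith)
      have b1 : ν * d / 2 * r ^ μ ≤ ν * d / 2 * r ^ (α + ν) := by gcongr
      refine b1.trans ?_
      rw [e2, e1, eα]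
      set P := r ^ (α - 1)
      set T := r ^ ν
      set S := r ^ (1 - ν)
      have e4 : g r * (P * r - P * r * T) - w r * (α * P - (α + ν) * (P * T))
        = P * ((r * g r - α * w r) * (1 - T) + ν * T * w r) := by ring
      rw [e4]
      have e5 : ν * d / 2 * (P * r * T) = P * (ν * d / 2 * r * T) := by ring
      rw [e5]
      refine mul_le_mul_of_nonneg_left ?_ hP.le
      have b2 : -(B * r ^ 2) ≤ (r * g r - α * w r) * (1 - T) := by
        have := (abs_le.1 hq).1
        have hBr : 0 ≤ B * r ^ 2 := by positivity
        nlinarith [mul_le_mul_of_nonneg_right this (by linarith : (0:ℝ) ≤ 1 - T)]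
      have b3 : ν * T * (d * r) ≤ ν * T * w r := by gcongr
      have b4 : S * (4 * B) ≤ ν * d := ((lt_div_iff₀ (by positivity)).1 hr3).le
      have b5 : B * r ^ 2 = (S * (4 * B)) * (T * r) / 4 := by
        linear_combination (B * r) * e3
      have b6 : (S * (4 * B)) * (T * r) ≤ ν * d * (T * r) := by gcongr
      have b7 : 0 < ν * d * (T * r) := by positivity
      nlinarith
    · simp only [Real.rpow_add hr]
      nlinarith
    · simp only [mFun, if_pos h]
      have := Real.rpow_pos_of_pos hr (α + ν)
      linarith
  · -- μ = α
    subst h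
    refine ⟨fun r => r ^ α * Real.log (2 * R / r),
      fun r => α * r ^ (α - 1) * Real.log (2 * R / r) + r ^ α * (-r⁻¹), d / 2, by positivity, ?_⟩
    have hT : Tendsto (fun r : ℝ => r * Real.log (2 * R) - Real.log r * r) (𝓝[>] 0) (𝓝 0) := by
      have t1 : Tendsto (fun r : ℝ => Real.log r * r) (𝓝[>] 0) (𝓝 0) := by
        simpa using tendsto_log_mul_rpow_nhdsGT_zero (r := 1) one_pos
      have t2 : Tendsto (fun r : ℝ => r * Real.log (2 * R)) (𝓝[>] 0) (𝓝 0) := by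
        have : Continuous (fun r : ℝ => r * Real.log (2 * R)) := by fun_prop
        have := this.tendsto 0
        rw [zero_mul] at this
        exact this.mono_left nhdsWithin_le_nhds
      simpa using t2.sub t1
    have hT2 := hT.eventually (gt_mem_nhds (show 0 < d / (2 * B) by positivity))
    filter_upwards [hpos, hw, hq, hlt R hR, hT2] with r hr hw hq hr1 hr2
    have eα : r ^ α = r ^ (α - 1) * r := by rw [← Real.rpow_add_one hr.ne']; ring_nf
    have hP : 0 < r ^ (α - 1) := Real.rpow_pos_of_pos hr _
    have hPα : 0 < r ^ α := Real.rpow_pos_of_pos hr _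
    have hlog : Real.log (2 * R / r) = Real.log (2 * R) - Real.log r :=
      Real.log_div (by positivity) hr.ne'
    have hlog0 : 0 < Real.log (2 * R / r) :=
      Real.log_pos (by rw [lt_div_iff₀ hr]; linarith)
    refine ⟨?_, ?_, ?_, ?_⟩
    · refine (Real.hasDerivAt_rpow_const (Or.inl hr.ne')).mul ?_
      have h1 : HasDerivAt (fun x => Real.log (2 * R) - Real.log x) (-r⁻¹) r :=
        (Real.hasDerivAt_log hr.ne').const_sub _
      refine h1.congr_of_eventuallyEq ?_
      filter_upwards [lt_mem_nhds hr] with x hx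
      exact Real.log_div (by positivity) hx.ne'
    · replace hr2 : r * Real.log (2 * R / r) < d / (2 * B) := by
        rw [hlog]; linarith
      rw [eα]
      set P := r ^ (α - 1)
      set L := Real.log (2 * R / r)
      have e4 : g r * (P * r * L) - w r * (α * P * L + P * r * (-r⁻¹))
        = P * ((r * g r - α * w r) * L + w r) := by field_simp; ring
      rw [e4]
      have e5 : d / 2 * (P * r) = P * (d / 2 * r) := by ring
      rw [e5]
      refine mul_le_mul_of_nonneg_left ?_ hP.le
      have b2 : -(B * r ^ 2) * L ≤ (r * g r - α * w r) * L :=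
        mul_le_mul_of_nonneg_right (abs_le.1 hq).1 hlog0.le
      have b4 : (r * L) * (2 * B) ≤ d := ((lt_div_iff₀ (by positivity)).1 hr2).le
      have b5 := mul_le_mul_of_nonneg_right b4 hr.le
      nlinarith
    · positivity
    · simp [mFun]
  · -- μ < α
    refine ⟨fun r => r ^ μ, fun r => μ * r ^ (μ - 1), (α - μ) * d / 2,
      by have := sub_pos.2 h; positivity, ?_⟩
    have hαμ : 0 < α - μ := sub_pos.2 h
    filter_upwards [hpos, hw, hq, hlt ((α - μ) * d / (2 * B)) (by positivity)]
      with r hr hw hq hr1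
    have eα : r ^ μ = r ^ (μ - 1) * r := by rw [← Real.rpow_add_one hr.ne']; ring_nf
    have hP : 0 < r ^ (μ - 1) := Real.rpow_pos_of_pos hr _
    refine ⟨Real.hasDerivAt_rpow_const (Or.inl hr.ne'), ?_, Real.rpow_pos_of_pos hr _, ?_⟩
    · rw [eα]
      set P := r ^ (μ - 1)
      have e4 : g r * (P * r) - w r * (μ * P)
        = P * ((r * g r - α * w r) + (α - μ) * w r) := by ring
      rw [e4]
      have e5 : (α - μ) * d / 2 * (P * r) = P * ((α - μ) * d / 2 * r) := by ring
      rw [e5]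
      refine mul_le_mul_of_nonneg_left ?_ hP.le
      have b2 := (abs_le.1 hq).1
      have b3 : (α - μ) * (d * r) ≤ (α - μ) * w r := by gcongr
      have b4 : r * (2 * B) ≤ (α - μ) * d := ((lt_div_iff₀ (by positivity)).1 hr1).le
      have b5 := mul_le_mul_of_nonneg_right b4 hr.le
      nlinarith
    · simp only [mFun, if_neg h.not_gt, if_neg h.ne, le_refl]

lemma aux_mlower (R α μ : ℝ) (hα : 0 < α) (hμ : 0 < μ) :
    ∀ r0 ∈ Ioo 0 R, ∃ l > 0, ∀ r ∈ Ico r0 R, l ≤ mFun α R μ r := by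
  intro r0 hr0
  have h2 : 0 < Real.log 2 := Real.log_pos (by norm_num)
  have ha : 0 < r0 ^ α := Real.rpow_pos_of_pos hr0.1 _
  have hm : 0 < r0 ^ μ := Real.rpow_pos_of_pos hr0.1 _
  unfold mFun
  split_ifs with h1 h3
  · exact ⟨r0 ^ α, ha, fun r hr => Real.rpow_le_rpow hr0.1.le hr.1 hα.le⟩
  · refine ⟨r0 ^ α * Real.log 2, by positivity, fun r hr => ?_⟩
    have hr' : 0 < r := hr0.1.trans_le hr.1
    refine mul_le_mul (Real.rpow_le_rpow hr0.1.le hr.1 hα.le) ?_ h2.le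
      (Real.rpow_nonneg hr'.le _)
    apply Real.log_le_log (by norm_num)
    rw [le_div_iff₀ hr']
    linarith [hr.2]
  · exact ⟨r0 ^ μ, hm, fun r hr => Real.rpow_le_rpow hr0.1.le hr.1 hμ.le⟩

theorem stmt_2
    (R : ℝ) (hR : 0 < R)
    (v f : ℝ → ℝ)
    (hv : ContDiff ℝ (⊤ : ℕ∞) v) (hf : ContDiff ℝ (⊤ : ℕ∞) f)
    (hv0 : v 0 = 0) (hvR : v R = 0)
    (c₁ c₂ : ℝ) (hc₂ : 0 < c₂) (hc : c₂ ≤ c₁)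
    (hvb : ∀ r ∈ Set.Icc 0 R,
      -c₁ * (r * (R - r)) ≤ v r ∧ v r ≤ -c₂ * (r * (R - r)))
    (hfneg : ∀ r ∈ Set.Icc 0 R, f r < 0)
    (μ A : ℝ) (hμ : 0 < μ) (hA : 0 < A) :
    ∃ C > 0, ∀ h φ : ℝ → ℝ,
      ContinuousOn h (Set.Icc 0 R) →
      (∀ r ∈ Set.Ioc 0 R, |h r| ≤ A * r ^ μ) →
      IsSingODESol v f h φ R →
      ∀ r ∈ Set.Ioo 0 R, |φ r| ≤ C * mFun (f 0 / deriv v 0) R μ r := by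
  have hvd : ∀ x, HasDerivAt v (deriv v x) x := fun x =>
    (hv.differentiable (by simp)).differentiableAt.hasDerivAt
  have hfd : ∀ x, HasDerivAt f (deriv f x) x := fun x =>
    (hf.differentiable (by simp)).differentiableAt.hasDerivAt
  have hpos : ∀ᶠ r in 𝓝[>] (0:ℝ), 0 < r := self_mem_nhdsWithin
  have hlt : ∀ ε > 0, ∀ᶠ r in 𝓝[>] (0:ℝ), r < ε :=
    fun ε hε => nhdsWithin_le_nhds (gt_mem_nhds hε)
  set d : ℝ := c₂ * R / 2 with hd
  have hd0 : 0 < d := by positivity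
  have hw : ∀ᶠ r in 𝓝[>] (0:ℝ), d * r ≤ -v r := by
    filter_upwards [hpos, hlt (R / 2) (by positivity)] with r hr hr2
    have h1 := (hvb r ⟨hr.le, by linarith⟩).2
    have h2 : c₂ * (r * (R / 2)) ≤ c₂ * (r * (R - r)) := by gcongr; linarith
    rw [hd]; linarith
  have hv' : deriv v 0 < 0 := by
    have h3 : Tendsto (slope v 0) (𝓝[>] 0) (𝓝 (deriv v 0)) :=
      (hasDerivAt_iff_tendsto_slope.1 (hvd 0)).mono_left
        (nhdsWithin_mono _ (fun y hy => ne_of_gt hy))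
    have : deriv v 0 ≤ -d := by
      refine le_of_tendsto h3 ?_
      filter_upwards [hpos, hw] with r hr hw
      rw [slope_def_field, hv0, sub_zero, sub_zero, div_le_iff₀ hr]
      linarith
    linarith
  have hf0 : f 0 < 0 := hfneg 0 ⟨le_rfl, hR.le⟩
  set α : ℝ := f 0 / deriv v 0 with hα
  have hα0 : 0 < α := div_pos_of_neg_of_neg hf0 hv'
  obtain ⟨x0, hx0, hmin⟩ := isCompact_Icc.exists_isMaxOn (nonempty_Icc.2 hR.le)
    (hf.continuous.continuousOn (s := Icc 0 R))
  obtain ⟨B, hB, hBq⟩ := aux_taylor (fun r => r * (-f r) - α * (-v r))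
    (by fun_prop) (by simp [hv0]) (by
      have := (((hasDerivAt_id (0:ℝ)).mul (hfd 0).neg).sub ((hvd 0).neg.const_mul α)).deriv
      refine Eq.trans ?_ (this.trans ?_)
      · rfl
      · simp [hα]; rw [div_mul_cancel₀ _ hv'.ne]; ring)
  obtain ⟨p, p', c, hcpos, hp⟩ := aux_barrier R hR (fun r => -v r) (fun r => -f r) α μ d B hα0 hd0
    hB hw (by
      filter_upwards [hpos, hlt 1 one_pos] with r h1 h2
      exact hBq r ⟨h1, h2⟩)
  obtain ⟨C, hC, H⟩ := aux_main R hR (fun r => -v r) (fun r => -f r) c₁ (-f x0) μ A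
    (hc₂.trans_le hc) (by have := hfneg x0 hx0; linarith) hA hμ
    (fun r hr => by
      have h1 := (hvb r ⟨hr.1.le, hr.2.le⟩).2
      have h2 : 0 < c₂ * (r * (R - r)) :=
        mul_pos hc₂ (mul_pos hr.1 (sub_pos.2 hr.2))
      linarith)
    (fun r hr => by have h1 := (hvb r ⟨hr.1.le, hr.2.le⟩).1; linarith)
    (fun r hr => by
      have : f r ≤ f x0 := hmin (show r ∈ Icc 0 R from ⟨hr.1.le, hr.2.le⟩)
      linarith)
    p p' (mFun α R μ) c hcpos hp (aux_mlower R α μ hα0 hμ)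
  refine ⟨C, hC, ?_⟩
  rintro h φ - hh ⟨hφ, hφd, -, hode⟩ r hr
  rw [abs_le']
  refine ⟨?_, ?_⟩
  · exact H h φ (deriv φ) hh hφ (fun r hr => (hφd r hr).hasDerivAt)
      (fun r hr => by linarith [hode r hr]) r hr
  · exact H (fun x => -h x) (fun x => -φ x) (fun x => -deriv φ x) (fun r hr => by
      rw [abs_neg]; exact hh r hr) hφ.neg (fun r hr => (hφd r hr).hasDerivAt.neg)
      (fun r hr => by linarith [hode r hr]) r hr
end

section
/- Suppose h : [0,R] → ℝ is continuous and, in addition, h is C^∞ on the half-open interval (0,R]. Then the unique solution φ ∈ C[0,R] ∩ C¹(0,R) of the singular ODE −v(r)φ′(r) + f(r)φ(r) = h(r) on (0,R) is C^∞ on (0,R]. -/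
open MeasureTheory Set Filter Topology

lemma key_aux (R : ℝ) (v v' ψ ψ' b k : ℝ → ℝ) (m b0 : ℝ) (hR : 0 < R)
    (hv : ∀ x ∈ Ioo 0 R, HasDerivAt v (v' x) x) (hneg : ∀ x ∈ Ioo 0 R, v x < 0)
    (hψ : ∀ x ∈ Ioo 0 R, HasDerivAt ψ (ψ' x) x)
    (heq : ∀ x ∈ Ioo 0 R, v x * ψ' x = b x * ψ x - k x)
    (hm : 0 < m) (hbm : b0 + m < 0)
    (tv' : Tendsto v' (𝓝[<] R) (𝓝 m)) (tb : Tendsto b (𝓝[<] R) (𝓝 b0))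
    (tk : Tendsto k (𝓝[<] R) (𝓝 0)) (tv : Tendsto v (𝓝[<] R) (𝓝 0))
    (tvψ : Tendsto (fun x => v x * ψ x) (𝓝[<] R) (𝓝 0)) :
    Tendsto ψ (𝓝[<] R) (𝓝 0) := by
  have main : ∀ ε > 0, ∀ᶠ x in 𝓝[<] R, ψ x ^ 2 ≤ ε := by
    intro ε hε
    have t1 : Tendsto (fun x => k x ^ 2 + 4 * (b x + v' x) * ε * v' x) (𝓝[<] R)
        (𝓝 (0 ^ 2 + 4 * (b0 + m) * ε * m)) :=
      (tk.pow 2).add ((((tb.add tv').const_mul 4).mul_const ε).mul tv')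
    have e1 := t1.eventually_lt_const (u := 0) (by
      have : 0 < -(b0 + m) * ε * m := by
        have : 0 < -(b0 + m) := by linarith
        positivity
      nlinarith)
    have e2 := (tb.add tv').eventually_lt_const hbm
    have e3 : ∀ᶠ x in 𝓝[<] R, x ∈ Ioo 0 R := Ioo_mem_nhdsLT hR
    obtain ⟨l, hl, hlR⟩ := (mem_nhdsLT_iff_exists_Ioo_subset).1 (e1.and (e2.and e3))
    have hl' : l < R := hl
    have hder : ∀ x ∈ Ioo l R, HasDerivAt (fun x => (v x * ψ x) ^ 2 - ε * v x ^ 2)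
        (2 * (v x * ψ x) * (v' x * ψ x + v x * ψ' x) - ε * (2 * v x * v' x)) x := by
      intro x hx
      obtain ⟨-, -, h3⟩ := hlR hx
      have := (((hv x h3).mul (hψ x h3)).pow 2).sub (((hv x h3).pow 2).const_mul ε)
      refine this.congr_deriv ?_
      simp only [Nat.cast_ofNat, Nat.add_one_sub_one, pow_one, Pi.mul_apply]
    have hmono : MonotoneOn (fun x => (v x * ψ x) ^ 2 - ε * v x ^ 2) (Ioo l R) := by
      apply monotoneOn_of_deriv_nonneg (convex_Ioo l R)
      · exact fun x hx => (hder x hx).continuousAt.continuousWithinAt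
      · rw [interior_Ioo]
        exact fun x hx => (hder x hx).differentiableAt.differentiableWithinAt
      · rw [interior_Ioo]
        intro x hx
        rw [(hder x hx).deriv]
        obtain ⟨h1, h2, h3⟩ := hlR hx
        have hvn := hneg x h3
        rw [heq x h3]
        have q : 0 ≤ -(b x + v' x) * ψ x ^ 2 + k x * ψ x + ε * v' x := by
          have hβ : 0 < -(b x + v' x) := by linarith
          have : 0 ≤ 4 * (-(b x + v' x)) *
              (-(b x + v' x) * ψ x ^ 2 + k x * ψ x + ε * v' x) := by
            nlinarith [sq_nonneg (2 * (-(b x + v' x)) * ψ x + k x)]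
          exact nonneg_of_mul_nonneg_right this (by positivity)
        nlinarith [mul_nonneg (neg_nonneg.2 hvn.le) q]
    have t2 : Tendsto (fun x => (v x * ψ x) ^ 2 - ε * v x ^ 2) (𝓝[<] R) (𝓝 0) := by
      simpa using (tvψ.pow 2).sub ((tv.pow 2).const_mul ε)
    filter_upwards [Ioo_mem_nhdsLT hl'] with x hx
    have hle : (v x * ψ x) ^ 2 - ε * v x ^ 2 ≤ 0 := by
      apply ge_of_tendsto t2
      filter_upwards [Ioo_mem_nhdsLT hx.2] with y hy
      exact hmono hx ⟨hx.1.trans hy.1, hy.2⟩ hy.1.le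
    obtain ⟨h1, h2, h3⟩ := hlR hx
    have hvn := hneg x h3
    have : 0 < v x ^ 2 := sq_pos_of_neg hvn
    by_contra! hc
    nlinarith [mul_pos this (sub_pos.2 hc)]
  rw [Metric.tendsto_nhds]
  intro ε hε
  filter_upwards [main ((ε / 2) ^ 2) (by positivity)] with x hx
  rw [dist_zero_right, Real.norm_eq_abs]
  have := abs_le_of_sq_le_sq hx (by positivity)
  linarith

lemma smooth_aux (R : ℝ) (hR : 0 < R) (v : ℝ → ℝ) (hv : ContDiff ℝ (⊤ : ℕ∞) v) (hvR : v R = 0)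
    (hneg : ∀ x ∈ Ioo 0 R, v x < 0) (hm : 0 < deriv v R) (n : ℕ) :
    ∀ (f h φ : ℝ → ℝ), ContDiff ℝ (⊤ : ℕ∞) f → f R < 0 → ContDiffOn ℝ n h (Ioc 0 R) →
      ContinuousOn φ (Ioc 0 R) → (∀ r ∈ Ioo 0 R, DifferentiableAt ℝ φ r) →
      (∀ r ∈ Ioo 0 R, -v r * deriv φ r + f r * φ r = h r) → ContDiffOn ℝ n φ (Ioc 0 R) := by
  induction n with
  | zero =>
    intro f h φ _ _ _ hc _ _
    exact contDiffOn_zero.2 hc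
  | succ n ih =>
    intro f h φ hf hfR hh hφ hd heq
    have hU : UniqueDiffOn ℝ (Ioc (0:ℝ) R) := uniqueDiffOn_Ioc 0 R
    have hhn : ContDiffOn ℝ ((n : WithTop ℕ∞) + 1) h (Ioc 0 R) := by exact_mod_cast hh
    have hh' := (contDiffOn_succ_iff_derivWithin hU).1 hhn
    have hnh : ∀ r ∈ Ioo 0 R, Ioc 0 R ∈ 𝓝 r := fun r hr => Ioc_mem_nhds hr.1 hr.2
    have hRm : R ∈ Ioc 0 R := ⟨hR, le_rfl⟩
    have hvd : ∀ x, HasDerivAt v (deriv v x) x := fun x =>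
      (hv.differentiable (by simp) x).hasDerivAt
    have hfd : ∀ x, HasDerivAt f (deriv f x) x := fun x =>
      (hf.differentiable (by simp) x).hasDerivAt
    have hvs : ContDiff ℝ (⊤ : ℕ∞) (deriv v) := (contDiff_infty_iff_deriv.1 hv).2
    have hfs : ContDiff ℝ (⊤ : ℕ∞) (deriv f) := (contDiff_infty_iff_deriv.1 hf).2
    have hhd : ∀ r ∈ Ioo 0 R, HasDerivAt h (derivWithin h (Ioc 0 R) r) r := fun r hr =>
      (hh'.1 r ⟨hr.1, hr.2.le⟩).hasDerivWithinAt.hasDerivAt (hnh r hr)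
    set h1 := derivWithin h (Ioc 0 R) with hh1
    set ψ := derivWithin φ (Ioc 0 R) with hψ
    have hψd : ∀ r ∈ Ioo 0 R, deriv φ r = ψ r := fun r hr =>
      (derivWithin_of_mem_nhds (hnh r hr)).symm
    have heq2 : ∀ r ∈ Ioo 0 R, v r * ψ r = f r * φ r - h r := by
      intro r hr
      rw [← hψd r hr, ← heq r hr]; ring
    have hφd : ∀ r ∈ Ioo 0 R, HasDerivAt φ (ψ r) r := fun r hr =>
      hψd r hr ▸ (hd r hr).hasDerivAt
    -- second derivative
    have hψdiff : ∀ r ∈ Ioo 0 R, DifferentiableAt ℝ ψ r := by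
      intro r hr
      have e : ψ =ᶠ[𝓝 r] fun x => (f x * φ x - h x) / v x := by
        filter_upwards [isOpen_Ioo.mem_nhds hr] with x hx
        rw [← heq2 x hx]
        field_simp [(hneg x hx).ne]
      refine DifferentiableAt.congr_of_eventuallyEq ?_ e
      exact (((hfd r).differentiableAt.mul (hd r hr)).sub (hhd r hr).differentiableAt).div
        (hvd r).differentiableAt (hneg r hr).ne
    have heq3 : ∀ r ∈ Ioo 0 R,
        deriv v r * ψ r + v r * deriv ψ r = deriv f r * φ r + f r * ψ r - h1 r := by
      intro r hr
      have d1 := (hvd r).mul (hψdiff r hr).hasDerivAt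
      have d2 := ((hfd r).mul (hφd r hr)).sub (hhd r hr)
      refine d1.unique (d2.congr_of_eventuallyEq ?_)
      filter_upwards [isOpen_Ioo.mem_nhds hr] with x hx
      exact heq2 x hx
    -- limits
    have hle : 𝓝[<] R ≤ 𝓝[Ioc 0 R] R := by
      rw [← nhdsWithin_Ioo_eq_nhdsLT hR]
      exact nhdsWithin_mono _ Ioo_subset_Ioc_self
    have tφ : Tendsto φ (𝓝[<] R) (𝓝 (φ R)) := (hφ R hRm).mono_left hle
    have th : Tendsto h (𝓝[<] R) (𝓝 (h R)) := (hh.continuousOn R hRm).mono_left hle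
    have th1 : Tendsto h1 (𝓝[<] R) (𝓝 (h1 R)) := (hh'.2.2.continuousOn R hRm).mono_left hle
    have tc : ∀ g : ℝ → ℝ, Continuous g → Tendsto g (𝓝[<] R) (𝓝 (g R)) := fun g hg =>
      (hg.tendsto R).mono_left nhdsWithin_le_nhds
    have tv := tc v hv.continuous
    rw [hvR] at tv
    have tv' := tc _ hvs.continuous
    have tf := tc f hf.continuous
    have tf' := tc _ hfs.continuous
    have eI : ∀ᶠ x in 𝓝[<] R, x ∈ Ioo 0 R := Ioo_mem_nhdsLT hR
    have tvψ0 : Tendsto (fun x => v x * ψ x) (𝓝[<] R) (𝓝 (f R * φ R - h R)) := by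
      refine ((tf.mul tφ).sub th).congr' ?_
      filter_upwards [eI] with x hx
      exact (heq2 x hx).symm
    have hL : f R * φ R - h R = 0 := by
      have ev' : ∀ᶠ x in 𝓝[<] R, deriv v x ≠ 0 := tv'.eventually_ne hm.ne'
      have hlh : Tendsto (fun x => (v x * φ x) / v x) (𝓝[<] R)
          (𝓝 (φ R + (f R * φ R - h R) / deriv v R)) := by
        apply HasDerivAt.lhopital_zero_nhdsLT (f := fun x => v x * φ x)
          (f' := fun x => deriv v x * φ x + v x * ψ x) (g := v) (g' := deriv v)
        · filter_upwards [eI] with x hx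
          exact (hvd x).mul (hφd x hx)
        · exact Eventually.of_forall hvd
        · exact ev'
        · simpa using tv.mul tφ
        · exact tv
        · refine (tφ.add (tvψ0.div tv' hm.ne')).congr' ?_
          filter_upwards [ev'] with x hx
          simp only [Pi.div_apply]
          field_simp
      have := tendsto_nhds_unique (hlh.congr' (f₂ := φ) (by
        filter_upwards [eI] with x hx
        field_simp [(hneg x hx).ne])) tφ
      have h0 : (f R * φ R - h R) / deriv v R = 0 := by linarith
      exact (div_eq_zero_iff.1 h0).resolve_right hm.ne'
    rw [hL] at tvψ0
    set b0 := f R - deriv v R with hb0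
    have hb0n : b0 < 0 := by linarith
    set k0 := h1 R - deriv f R * φ R with hk0
    set c := k0 / b0 with hc
    have tψ : Tendsto ψ (𝓝[<] R) (𝓝 c) := by
      have := key_aux R v (deriv v) (fun x => ψ x - c) (deriv ψ) (fun x => f x - deriv v x)
        (fun x => (h1 x - deriv f x * φ x) - (f x - deriv v x) * c) (deriv v R) b0 hR
        (fun x _ => hvd x) hneg (fun x hx => (hψdiff x hx).hasDerivAt.sub_const c)
        (fun x hx => by have := heq3 x hx; linear_combination this)
        hm (by linarith) tv' (tf.sub tv')
        (by
          have := (th1.sub (tf'.mul tφ)).sub ((tf.sub tv').mul_const c)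
          convert this using 2
          rw [← hb0, ← hk0, hc, mul_div_cancel₀ _ hb0n.ne, sub_self]) tv
        (by
          have := tvψ0.sub (tv.mul_const c)
          simp only [zero_mul, sub_zero] at this
          refine this.congr fun x => ?_
          ring)
      simpa using this.add_const c
    have hφR : HasDerivWithinAt φ c (Iic R) R := by
      apply hasDerivWithinAt_Iic_of_tendsto_deriv (s := Ioo 0 R)
      · exact fun x hx => (hd x hx).differentiableWithinAt
      · exact (hφ R hRm).mono Ioo_subset_Ioc_self
      · exact Ioo_mem_nhdsLT hR
      · refine tψ.congr' ?_
        filter_upwards [eI] with x hx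
        exact (hψd x hx).symm
    have hφR' : HasDerivWithinAt φ c (Ioc 0 R) R := hφR.mono Ioc_subset_Iic_self
    have hψR : ψ R = c := hφR'.derivWithin (hU R hRm)
    have hψc : ContinuousOn ψ (Ioc 0 R) := by
      intro x hx
      rcases hx.2.lt_or_eq with hlt | rfl
      · exact (hψdiff x ⟨hx.1, hlt⟩).continuousAt.continuousWithinAt
      · rw [← Ioo_insert_right hR, continuousWithinAt_insert_self]
        unfold ContinuousWithinAt
        rw [nhdsWithin_Ioo_eq_nhdsLT hR, hψR]
        exact tψ
    have hφn : ContDiffOn ℝ n φ (Ioc 0 R) :=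
      ih f h φ hf hfR (hh.of_le (by exact_mod_cast Nat.le_succ n)) hφ hd heq
    have hψn : ContDiffOn ℝ n ψ (Ioc 0 R) := by
      refine ih (fun x => f x - deriv v x) (fun x => h1 x - deriv f x * φ x) ψ (hf.sub hvs) hb0n
        ?_ hψc hψdiff ?_
      · exact hh'.2.2.sub (((hfs.of_le (by exact_mod_cast le_top)).contDiffOn).mul hφn)
      · intro r hr
        have := heq3 r hr
        linear_combination -this
    have : ContDiffOn ℝ ((n : WithTop ℕ∞) + 1) φ (Ioc 0 R) := by
      refine (contDiffOn_succ_iff_derivWithin hU).2 ⟨?_, by simp, hψn⟩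
      intro x hx
      rcases hx.2.lt_or_eq with hlt | rfl
      · exact (hd x ⟨hx.1, hlt⟩).differentiableWithinAt
      · exact hφR'.differentiableWithinAt
    exact_mod_cast this

theorem stmt_3
    (R : ℝ) (hR : 0 < R)
    (v f : ℝ → ℝ)
    (hv : ContDiff ℝ (⊤ : ℕ∞) v) (hf : ContDiff ℝ (⊤ : ℕ∞) f)
    (hv0 : v 0 = 0) (hvR : v R = 0)
    (c₁ c₂ : ℝ) (hc₂ : 0 < c₂) (hc : c₂ ≤ c₁)
    (hvb : ∀ r ∈ Set.Icc 0 R,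
      -c₁ * (r * (R - r)) ≤ v r ∧ v r ≤ -c₂ * (r * (R - r)))
    (hfneg : ∀ r ∈ Set.Icc 0 R, f r < 0)
    (h φ : ℝ → ℝ)
    (hh : ContinuousOn h (Set.Icc 0 R))
    (hhsmooth : ContDiffOn ℝ (⊤ : ℕ∞) h (Set.Ioc 0 R))
    (hφ : IsSingODESol v f h φ R) :
    ContDiffOn ℝ (⊤ : ℕ∞) φ (Set.Ioc 0 R) := by
  have hneg : ∀ x ∈ Ioo 0 R, v x < 0 := by
    intro x hx
    have := (hvb x ⟨hx.1.le, hx.2.le⟩).2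
    have h2 : 0 < c₂ * (x * (R - x)) := mul_pos hc₂ (mul_pos hx.1 (sub_pos.2 hx.2))
    linarith
  have hm : 0 < deriv v R := by
    have hd := (hv.differentiable (by simp) R).hasDerivAt
    have hs : Tendsto (slope v R) (𝓝[<] R) (𝓝 (deriv v R)) :=
      (hasDerivAt_iff_tendsto_slope.1 hd).mono_left
        (nhdsWithin_mono _ (fun x hx => ne_of_lt hx))
    have ht : Tendsto (fun x : ℝ => c₂ * x) (𝓝[<] R) (𝓝 (c₂ * R)) :=
      ((continuous_const.mul continuous_id).tendsto R).mono_left nhdsWithin_le_nhds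
    refine lt_of_lt_of_le (mul_pos hc₂ hR) (le_of_tendsto_of_tendsto ht hs ?_)
    filter_upwards [Ioo_mem_nhdsLT hR] with x hx
    have := (hvb x ⟨hx.1.le, hx.2.le⟩).2
    rw [slope_comm, slope_def_field, hvR, le_div_iff₀ (sub_pos.2 hx.2)]
    linarith
  obtain ⟨h1, h2, -, h4⟩ := hφ
  rw [contDiffOn_infty]
  intro n
  exact smooth_aux R hR v hv hvR hneg hm n f h φ hf (hfneg R ⟨hR.le, le_rfl⟩)
    (hhsmooth.of_le (by exact_mod_cast le_top)) (h1.mono Ioc_subset_Icc_self) h2 h4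
end

section
/- For every continuous function h : [0,R] → ℝ and every r ∈ (0,R), the integral ∫_r^R h(η)W(η)/v(η) dη is absolutely convergent, and the function φ(r) = (1/W(r)) ∫_r^R h(η)W(η)/v(η) dη solves −v(r)φ′(r) + f(r)φ(r) = h(r) on (0,R); moreover lim_{r→0⁺} φ(r) = h(0)/f(0) and lim_{r→R⁻} φ(r) = h(R)/f(R), so that φ extends to the unique solution in C[0,R] ∩ C¹(0,R) of this singular ODE. -/
open MeasureTheory Set Filter Topology

/-- The weight function `W(r) = exp(-∫_{r₀}^r f(ρ)/v(ρ) dρ)`. -/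
noncomputable def Wfun (v f : ℝ → ℝ) (r₀ r : ℝ) : ℝ :=
  Real.exp (-∫ ρ in r₀..r, f ρ / v ρ)

/-- The explicit solution formula `φ(r) = W(r)⁻¹ ∫_r^R h(η)W(η)/v(η) dη`. -/
noncomputable def phiFormula (v f h : ℝ → ℝ) (r₀ R r : ℝ) : ℝ :=
  (Wfun v f r₀ r)⁻¹ * ∫ η in r..R, h η * Wfun v f r₀ η / v η

theorem sing_lhop_lower {I W I' W' : ℝ → ℝ} {a b L : ℝ}
    (hab : a < b)
    (hI : ∀ x ∈ Ioo a b, HasDerivAt I (I' x) x)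
    (hW : ∀ x ∈ Ioo a b, HasDerivAt W (W' x) x)
    (hneg : ∀ x ∈ Ioo a b, W' x < 0)
    (hinf : Tendsto W (𝓝[>] a) atTop)
    (hlim : Tendsto (fun x => I' x / W' x) (𝓝[>] a) (𝓝 L)) (K : ℝ) (hK : K < L) :
    ∀ᶠ x in 𝓝[>] a, K < I x / W x := by
  obtain ⟨K', hKK', hK'L⟩ := exists_between hK
  have h1 : ∀ᶠ x in 𝓝[>] a, K' < I' x / W' x := hlim.eventually (lt_mem_nhds hK'L)
  have h2 : ∀ᶠ x in 𝓝[>] a, x ∈ Ioo a b := Ioo_mem_nhdsGT hab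
  obtain ⟨d, hd, hd'⟩ := mem_nhdsGT_iff_exists_Ioo_subset.1 (h1.and h2)
  have hd : a < d := hd
  obtain ⟨x1, hx1⟩ := exists_between hd
  have hmem : ∀ x ∈ Ioo a d, x ∈ Ioo a b := fun x hx => (hd' hx).2
  have hder : ∀ x ∈ Ioo a d, HasDerivAt (fun x => I x - K' * W x) (I' x - K' * W' x) x :=
    fun x hx => (hI x (hmem x hx)).sub ((hW x (hmem x hx)).const_mul K')
  have hanti : AntitoneOn (fun x => I x - K' * W x) (Ioo a d) := by
    apply antitoneOn_of_deriv_nonpos (convex_Ioo a d)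
    · exact fun x hx => (hder x hx).continuousAt.continuousWithinAt
    · rw [interior_Ioo]
      exact fun x hx => (hder x hx).differentiableAt.differentiableWithinAt
    · rw [interior_Ioo]
      intro x hx
      rw [(hder x hx).deriv]
      have h3 : K' < I' x / W' x := (hd' hx).1
      rw [lt_div_iff_of_neg (hneg x (hmem x hx))] at h3
      linarith
  have h4 : ∀ᶠ x in 𝓝[>] a, x ∈ Ioo a x1 := Ioo_mem_nhdsGT hx1.1
  filter_upwards [h4, hinf.eventually_gt_atTop 0,
    hinf.eventually_gt_atTop (-(I x1 - K' * W x1) / (K' - K))] with x hx hpos hbig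
  have h5 := hanti (show x ∈ Ioo a d from ⟨hx.1, hx.2.trans hx1.2⟩) hx1 hx.2.le
  rw [lt_div_iff₀ hpos]
  rw [div_lt_iff₀ (by linarith)] at hbig
  simp only at h5
  nlinarith

theorem sing_lhop {I W I' W' : ℝ → ℝ} {a b L : ℝ}
    (hab : a < b)
    (hI : ∀ x ∈ Ioo a b, HasDerivAt I (I' x) x)
    (hW : ∀ x ∈ Ioo a b, HasDerivAt W (W' x) x)
    (hneg : ∀ x ∈ Ioo a b, W' x < 0)
    (hinf : Tendsto W (𝓝[>] a) atTop)
    (hlim : Tendsto (fun x => I' x / W' x) (𝓝[>] a) (𝓝 L)) :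
    Tendsto (fun x => I x / W x) (𝓝[>] a) (𝓝 L) := by
  rw [tendsto_order]
  refine ⟨fun K hK => sing_lhop_lower hab hI hW hneg hinf hlim K hK, fun K hK => ?_⟩
  have := sing_lhop_lower (I := fun x => - I x) (I' := fun x => - I' x) (L := -L) hab
    (fun x hx => (hI x hx).neg) hW hneg hinf (by simpa [neg_div] using hlim.neg) (-K) (by linarith)
  filter_upwards [this] with x hx
  rw [neg_div] at hx
  linarith

/-- Integrability of the derivative of a decreasing function with a finite limit. -/
theorem sing_integrable {W W' : ℝ → ℝ} {a b c l : ℝ} (hca : c < a) (hab : a < b)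
    (hW : ∀ x ∈ Ioo c b, HasDerivAt W (W' x) x)
    (hneg : ∀ x ∈ Ioo c b, W' x < 0)
    (hlim : Tendsto W (𝓝[<] b) (𝓝 l)) :
    IntervalIntegrable W' volume a b := by
  have hsub : ∀ x ∈ Ioo a b, x ∈ Ioo c b := fun x hx => ⟨hca.trans hx.1, hx.2⟩
  have hc : ContinuousOn W (Ioo a b) :=
    fun x hx => (hW x (hsub x hx)).continuousAt.continuousWithinAt
  have hcont := continuousOn_Icc_extendFrom_Ioo hc
    ((hW a ⟨hca, hab⟩).continuousAt.tendsto.mono_left nhdsWithin_le_nhds) hlim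
  have h1 : IntegrableOn (fun x => - W' x) (Ioc a b) := by
    refine intervalIntegral.integrableOn_deriv_of_nonneg hcont.neg (fun x hx => ?_)
      (fun x hx => by linarith [hneg x (hsub x hx)])
    refine ((hW x (hsub x hx)).congr_of_eventuallyEq ?_).neg
    filter_upwards [isOpen_Ioo.mem_nhds hx] with y hy
    exact extendFrom_extends hc y hy
  rw [intervalIntegrable_iff_integrableOn_Ioc_of_le hab.le]
  simpa using h1.neg

theorem stmt_4
    (R : ℝ) (hR : 0 < R)
    (v f : ℝ → ℝ)
    (hv : ContDiff ℝ (⊤ : ℕ∞) v) (hf : ContDiff ℝ (⊤ : ℕ∞) f)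
    (hv0 : v 0 = 0) (hvR : v R = 0)
    (c₁ c₂ : ℝ) (hc₂ : 0 < c₂) (hc : c₂ ≤ c₁)
    (hvb : ∀ r ∈ Set.Icc 0 R,
      -c₁ * (r * (R - r)) ≤ v r ∧ v r ≤ -c₂ * (r * (R - r)))
    (hfneg : ∀ r ∈ Set.Icc 0 R, f r < 0)
    (r₀ : ℝ) (hr₀ : r₀ ∈ Set.Ioo 0 R)
    (h : ℝ → ℝ) (hh : ContinuousOn h (Set.Icc 0 R)) :
    -- absolute convergence of the defining integral
    (∀ r ∈ Set.Ioo 0 R,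
      IntervalIntegrable (fun η => h η * Wfun v f r₀ η / v η) volume r R) ∧
    -- the formula solves the singular ODE on (0,R)
    (∀ r ∈ Set.Ioo 0 R,
      DifferentiableAt ℝ (phiFormula v f h r₀ R) r ∧
      -v r * deriv (phiFormula v f h r₀ R) r + f r * phiFormula v f h r₀ R r = h r) ∧
    -- boundary limits
    Tendsto (phiFormula v f h r₀ R) (nhdsWithin 0 (Set.Ioi 0)) (nhds (h 0 / f 0)) ∧
    Tendsto (phiFormula v f h r₀ R) (nhdsWithin R (Set.Iio R)) (nhds (h R / f R)) ∧
    -- φ extends to the unique solution in C[0,R] ∩ C¹(0,R)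
    (∃ φ : ℝ → ℝ, IsSingODESol v f h φ R ∧
      Set.EqOn φ (phiFormula v f h r₀ R) (Set.Ioo 0 R)) ∧
    (∀ ψ : ℝ → ℝ, IsSingODESol v f h ψ R →
      Set.EqOn ψ (phiFormula v f h r₀ R) (Set.Ioo 0 R)) := by
  have hfc : Continuous f := hf.continuous
  have hvc : Continuous v := hv.continuous
  have hvneg : ∀ r ∈ Ioo 0 R, v r < 0 := by
    intro r hr
    have h1 := (hvb r ⟨hr.1.le, hr.2.le⟩).2
    have h2 : 0 < r * (R - r) := mul_pos hr.1 (by linarith [hr.2])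
    nlinarith
  have hqc : ContinuousOn (fun r => f r / v r) (Ioo 0 R) :=
    hfc.continuousOn.div hvc.continuousOn (fun r hr => (hvneg r hr).ne)
  have hqpos : ∀ r ∈ Ioo 0 R, 0 < f r / v r := fun r hr =>
    div_pos_of_neg_of_neg (hfneg r ⟨hr.1.le, hr.2.le⟩) (hvneg r hr)
  -- primitive
  have hG : ∀ r ∈ Ioo 0 R, HasDerivAt (fun r => ∫ ρ in r₀..r, f ρ / v ρ) (f r / v r) r := by
    intro r hr
    refine intervalIntegral.integral_hasDerivAt_right ?_
      (hqc.stronglyMeasurableAtFilter isOpen_Ioo r hr) (hqc.continuousAt (isOpen_Ioo.mem_nhds hr))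
    refine (hqc.mono ?_).intervalIntegrable
    exact (ordConnected_Ioo).uIcc_subset hr₀ hr
  have hWpos : ∀ r, 0 < Wfun v f r₀ r := fun r => Real.exp_pos _
  have hW : ∀ r ∈ Ioo 0 R, HasDerivAt (Wfun v f r₀) (-(f r / v r) * Wfun v f r₀ r) r := by
    intro r hr
    have := (hG r hr).neg.exp
    rw [mul_comm] at this
    exact this
  have hWneg : ∀ r ∈ Ioo 0 R, -(f r / v r) * Wfun v f r₀ r < 0 := fun r hr => by
    have := mul_pos (hqpos r hr) (hWpos r)
    linarith
  -- lower bound on f / v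
  obtain ⟨m, hm, hfm⟩ : ∃ m > 0, ∀ r ∈ Icc 0 R, f r ≤ -m := by
    obtain ⟨x, hx, hmax⟩ := isCompact_Icc.exists_isMaxOn (nonempty_Icc.2 hR.le)
      (hfc.continuousOn (s := Icc 0 R))
    exact ⟨-f x, by linarith [hfneg x hx], fun r hr => by simpa using hmax hr⟩
  have hc₁ : 0 < c₁ := hc₂.trans_le hc
  obtain ⟨β, hβ⟩ : ∃ β, β = m / (c₁ * R) := ⟨_, rfl⟩
  have hβpos : 0 < β := by rw [hβ]; positivity
  have hqlow : ∀ r ∈ Ioo 0 R, m ≤ (f r / v r) * (c₁ * (r * (R - r))) := by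
    intro r hr
    have h1 := (hvb r ⟨hr.1.le, hr.2.le⟩).1
    have h2 := hfm r ⟨hr.1.le, hr.2.le⟩
    have h3 : f r = (f r / v r) * v r := by field_simp [(hvneg r hr).ne]
    have h4 := mul_le_mul_of_nonneg_left h1 (hqpos r hr).le
    nlinarith
  have hβm : m = β * (c₁ * R) := by rw [hβ]; field_simp
  have hq0 : ∀ r ∈ Ioo 0 R, β * r⁻¹ ≤ f r / v r := by
    intro r hr
    have h1 := hqlow r hr
    have h2 := hqpos r hr
    rw [← div_eq_mul_inv, div_le_iff₀ hr.1]
    have h3 : (f r / v r) * (c₁ * (r * (R - r))) ≤ (f r / v r * r) * (c₁ * R) := by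
      have : 0 ≤ (f r / v r) * c₁ * r * r := by have := hr.1; positivity
      nlinarith
    have h4 : 0 < c₁ * R := by positivity
    rw [hβm] at h1
    exact le_of_mul_le_mul_right (h1.trans h3) h4
  have hqR : ∀ r ∈ Ioo 0 R, β * (R - r)⁻¹ ≤ f r / v r := by
    intro r hr
    have h1 := hqlow r hr
    have h2 := hqpos r hr
    have h0 : 0 < R - r := by linarith [hr.2]
    rw [← div_eq_mul_inv, div_le_iff₀ h0]
    have h3 : (f r / v r) * (c₁ * (r * (R - r))) ≤ (f r / v r * (R - r)) * (c₁ * R) := by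
      have : 0 ≤ (f r / v r) * c₁ * (R - r) * (R - r) := by positivity
      nlinarith
    have h4 : 0 < c₁ * R := by positivity
    rw [hβm] at h1
    exact le_of_mul_le_mul_right (h1.trans h3) h4
  have hev0 : ∀ᶠ r in 𝓝[>] (0:ℝ), r ∈ Ioo 0 r₀ := Ioo_mem_nhdsGT hr₀.1
  have hevR : ∀ᶠ r in 𝓝[<] R, r ∈ Ioo r₀ R := Ioo_mem_nhdsLT hr₀.2
  -- limits of W
  have hW0 : Tendsto (Wfun v f r₀) (𝓝[>] 0) atTop := by
    have hder : ∀ r ∈ Ioo 0 R, HasDerivAt (fun r => (∫ ρ in r₀..r, f ρ / v ρ) - β * Real.log r)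
        (f r / v r - β * r⁻¹) r := fun r hr =>
      (hG r hr).sub ((Real.hasDerivAt_log hr.1.ne').const_mul β)
    have hmono : MonotoneOn (fun r => (∫ ρ in r₀..r, f ρ / v ρ) - β * Real.log r) (Ioo 0 R) := by
      apply monotoneOn_of_deriv_nonneg (convex_Ioo 0 R)
      · exact fun x hx => (hder x hx).continuousAt.continuousWithinAt
      · rw [interior_Ioo]
        exact fun x hx => (hder x hx).differentiableAt.differentiableWithinAt
      · rw [interior_Ioo]
        intro x hx
        rw [(hder x hx).deriv]
        linarith [hq0 x hx]
    refine Real.tendsto_exp_atTop.comp ?_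
    have hlog : Tendsto (fun r => -β * Real.log r + β * Real.log r₀) (𝓝[>] 0) atTop := by
      refine tendsto_atTop_add_const_right _ _ ?_
      exact Real.tendsto_log_nhdsGT_zero.const_mul_atBot_of_neg (by linarith)
    refine tendsto_atTop_mono' _ ?_ hlog
    filter_upwards [hev0] with r hr
    have := hmono (show r ∈ Ioo 0 R from ⟨hr.1, hr.2.trans hr₀.2⟩) hr₀ hr.2.le
    simp only [intervalIntegral.integral_same] at this
    linarith
  have hWR : Tendsto (Wfun v f r₀) (𝓝[<] R) (𝓝 0) := by
    have hder : ∀ r ∈ Ioo 0 R, HasDerivAt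
        (fun r => (∫ ρ in r₀..r, f ρ / v ρ) + β * Real.log (R - r))
        (f r / v r + β * (-1 / (R - r))) r := fun r hr =>
      (hG r hr).add ((((hasDerivAt_id r).const_sub R).log
        (by have := hr.2; simp only [id]; linarith)).const_mul β)
    have hmono : MonotoneOn (fun r => (∫ ρ in r₀..r, f ρ / v ρ) + β * Real.log (R - r))
        (Ioo 0 R) := by
      apply monotoneOn_of_deriv_nonneg (convex_Ioo 0 R)
      · exact fun x hx => (hder x hx).continuousAt.continuousWithinAt
      · rw [interior_Ioo]
        exact fun x hx => (hder x hx).differentiableAt.differentiableWithinAt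
      · rw [interior_Ioo]
        intro x hx
        rw [(hder x hx).deriv]
        have := hqR x hx
        rw [neg_div, one_div]
        linarith
    refine Real.tendsto_exp_atBot.comp ?_
    have hsub : Tendsto (fun r => R - r) (𝓝[<] R) (𝓝[>] 0) := by
      refine tendsto_nhdsWithin_iff.2 ⟨?_, ?_⟩
      · have : Tendsto (fun r => R - r) (𝓝 R) (𝓝 (R - R)) := by
          exact (continuous_const.sub continuous_id).tendsto R
        rw [sub_self] at this
        exact this.mono_left nhdsWithin_le_nhds
      · filter_upwards [hevR] with r hr
        simpa using hr.2
    have hlog : Tendsto (fun r => β * Real.log (R - r) + - (β * Real.log (R - r₀)))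
        (𝓝[<] R) atBot := by
      refine tendsto_atBot_add_const_right _ _ ?_
      exact (Real.tendsto_log_nhdsGT_zero.comp hsub).const_mul_atBot hβpos
    refine tendsto_atBot_mono' _ ?_ hlog
    filter_upwards [hevR] with r hr
    have := hmono hr₀ (show r ∈ Ioo 0 R from ⟨hr₀.1.trans hr.1, hr.2⟩) hr.1.le
    simp only [intervalIntegral.integral_same] at this
    linarith
  -- integrability
  have hint : ∀ r ∈ Ioo 0 R,
      IntervalIntegrable (fun η => h η * Wfun v f r₀ η / v η) volume r R := by
    intro r hr
    have h1 := sing_integrable hr.1 hr.2 hW hWneg hWR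
    have h2 : ContinuousOn (fun x => - (h x / f x)) (uIcc r R) := by
      rw [uIcc_of_le hr.2.le]
      have hs : Icc r R ⊆ Icc 0 R := Icc_subset_Icc_left hr.1.le
      exact ((hh.mono hs).div hfc.continuousOn (fun x hx => (hfneg x (hs hx)).ne)).neg
    refine (h1.continuousOn_mul h2).congr ?_
    intro x hx
    rw [uIoc_of_le hr.2.le] at hx
    have := (hfneg x ⟨(hr.1.trans hx.1).le, hx.2⟩).ne
    simp only
    field_simp
  have hgc : ContinuousOn (fun η => h η * Wfun v f r₀ η / v η) (Ioo 0 R) := by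
    refine ((hh.mono Ioo_subset_Icc_self).mul ?_).div hvc.continuousOn
      (fun r hr => (hvneg r hr).ne)
    exact fun x hx => (hW x hx).continuousAt.continuousWithinAt
  have hI : ∀ r ∈ Ioo 0 R, HasDerivAt (fun r => ∫ η in r..R, h η * Wfun v f r₀ η / v η)
      (-(h r * Wfun v f r₀ r / v r)) r := fun r hr =>
    intervalIntegral.integral_hasDerivAt_left (hint r hr)
      (hgc.stronglyMeasurableAtFilter isOpen_Ioo r hr) (hgc.continuousAt (isOpen_Ioo.mem_nhds hr))
  have hIR : Tendsto (fun r => ∫ η in r..R, h η * Wfun v f r₀ η / v η) (𝓝[<] R) (𝓝 0) := by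
    have h1 := (intervalIntegrable_iff_integrableOn_Icc_of_le hr₀.2.le).1 (hint r₀ hr₀)
    rw [← uIcc_of_le hr₀.2.le] at h1
    have h2 := intervalIntegral.continuousOn_primitive_interval_left h1 R right_mem_uIcc
    have h3 := h2.tendsto
    rw [intervalIntegral.integral_same, uIcc_of_le hr₀.2.le] at h3
    refine h3.mono_left ?_
    rw [← nhdsWithin_Ioo_eq_nhdsLT hr₀.2]
    exact nhdsWithin_mono _ Ioo_subset_Icc_self
  have hphi : phiFormula v f h r₀ R =
      fun r => (∫ η in r..R, h η * Wfun v f r₀ η / v η) / Wfun v f r₀ r := by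
    funext r
    rw [phiFormula, mul_comm, div_eq_mul_inv]
  have hratio : ∀ r ∈ Ioo 0 R,
      h r / f r = -(h r * Wfun v f r₀ r / v r) / (-(f r / v r) * Wfun v f r₀ r) := by
    intro r hr
    have h1 := (hfneg r ⟨hr.1.le, hr.2.le⟩).ne
    have h2 := (hvneg r hr).ne
    have h3 := (hWpos r).ne'
    field_simp
  have hhf : ContinuousOn (fun x => h x / f x) (Icc 0 R) :=
    hh.div hfc.continuousOn (fun x hx => (hfneg x hx).ne)
  have hlim0 : Tendsto (phiFormula v f h r₀ R) (𝓝[>] 0) (𝓝 (h 0 / f 0)) := by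
    rw [hphi]
    refine sing_lhop hR hI hW hWneg hW0 ?_
    have h1 := (hhf 0 (left_mem_Icc.2 hR.le)).tendsto.mono_left
      (nhdsWithin_mono _ Ioo_subset_Icc_self)
    rw [nhdsWithin_Ioo_eq_nhdsGT hR] at h1
    refine h1.congr' ?_
    filter_upwards [Ioo_mem_nhdsGT hR] with r hr
    exact hratio r hr
  have hlimR : Tendsto (phiFormula v f h r₀ R) (𝓝[<] R) (𝓝 (h R / f R)) := by
    rw [hphi]
    refine HasDerivAt.lhopital_zero_left_on_Ioo hR hI hW (fun r hr => (hWneg r hr).ne) hIR hWR ?_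
    have h1 := (hhf R (right_mem_Icc.2 hR.le)).tendsto.mono_left
      (nhdsWithin_mono _ Ioo_subset_Icc_self)
    rw [nhdsWithin_Ioo_eq_nhdsLT hR] at h1
    refine h1.congr' ?_
    filter_upwards [Ioo_mem_nhdsLT hR] with r hr
    exact hratio r hr
  have hphid : ∀ r ∈ Ioo 0 R, HasDerivAt (phiFormula v f h r₀ R)
      ((f r * phiFormula v f h r₀ R r - h r) / v r) r := by
    intro r hr
    have h1 := (hI r hr).div (hW r hr) (hWpos r).ne'
    have h2 := (hvneg r hr).ne
    have h3 := (hWpos r).ne'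
    rw [hphi]
    refine h1.congr_deriv ?_
    field_simp
    ring
  have hphic : ContinuousOn (phiFormula v f h r₀ R) (Ioo 0 R) :=
    fun x hx => (hphid x hx).continuousAt.continuousWithinAt
  refine ⟨hint, ?_, hlim0, hlimR, ?_, ?_⟩
  · intro r hr
    refine ⟨(hphid r hr).differentiableAt, ?_⟩
    rw [(hphid r hr).deriv]
    have h2 := (hvneg r hr).ne
    field_simp
    ring
  · have heq : EqOn (extendFrom (Ioo 0 R) (phiFormula v f h r₀ R)) (phiFormula v f h r₀ R)
        (Ioo 0 R) := fun x hx => extendFrom_extends hphic x hx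
    have hd : ∀ r ∈ Ioo 0 R, HasDerivAt (extendFrom (Ioo 0 R) (phiFormula v f h r₀ R))
        ((f r * phiFormula v f h r₀ R r - h r) / v r) r := by
      intro r hr
      refine (hphid r hr).congr_of_eventuallyEq ?_
      filter_upwards [isOpen_Ioo.mem_nhds hr] with y hy
      exact heq hy
    refine ⟨_, ⟨continuousOn_Icc_extendFrom_Ioo hphic hlim0 hlimR,
      fun r hr => (hd r hr).differentiableAt, ?_, ?_⟩, heq⟩
    · refine ContinuousOn.congr (f := fun r => (f r * phiFormula v f h r₀ R r - h r) / v r) ?_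
        (fun r hr => (hd r hr).deriv)
      exact ((hfc.continuousOn.mul hphic).sub (hh.mono Ioo_subset_Icc_self)).div
        hvc.continuousOn (fun r hr => (hvneg r hr).ne)
    · intro r hr
      rw [(hd r hr).deriv, heq hr]
      have h2 := (hvneg r hr).ne
      field_simp
      ring
  · rintro ψ ⟨hψc, hψd, -, hψ⟩
    have hD : ∀ r ∈ Ioo 0 R, HasDerivAt
        (fun r => ψ r * Wfun v f r₀ r - ∫ η in r..R, h η * Wfun v f r₀ η / v η) 0 r := by
      intro r hr
      refine (((hψd r hr).hasDerivAt.mul (hW r hr)).sub (hI r hr)).congr_deriv ?_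
      have h2 := (hvneg r hr).ne
      rw [← hψ r hr]
      field_simp
      ring
    obtain ⟨C, hC⟩ := isOpen_Ioo.exists_is_const_of_deriv_eq_zero isPreconnected_Ioo
      (fun r hr => (hD r hr).differentiableAt.differentiableWithinAt)
      (fun r hr => (hD r hr).deriv)
    have hψR : Tendsto ψ (𝓝[<] R) (𝓝 (ψ R)) := by
      rw [← nhdsWithin_Ioo_eq_nhdsLT hR]
      exact (hψc R (right_mem_Icc.2 hR.le)).tendsto.mono_left
        (nhdsWithin_mono _ Ioo_subset_Icc_self)
    have hlim := (hψR.mul hWR).sub hIR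
    rw [mul_zero, sub_zero] at hlim
    have hC0 : C = 0 := by
      refine tendsto_nhds_unique (tendsto_const_nhds.congr' ?_) hlim
      filter_upwards [Ioo_mem_nhdsLT hR] with r hr
      exact (hC r hr).symm
    intro r hr
    have h1 := hC r hr
    rw [hphi]
    simp only
    rw [eq_div_iff (hWpos r).ne']
    linarith
end

section
/- There exist positive constants C₀ and C₁ (depending on v, f and the choice of r₀) such that lim_{r→0⁺} r^{α₀} W(r) = C₀ and lim_{r→R⁻} (R−r)^{−α₁} W(r) = C₁; that is, W(r) = C₀ r^{−α₀}(1+o(1)) as r → 0⁺ and W(r) = C₁ (R−r)^{α₁}(1+o(1)) as r → R⁻. -/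
open MeasureTheory Set Filter Topology

theorem left_aux (b c : ℝ) (hb : 0 < b) (hc : 0 < c) (v f : ℝ → ℝ)
    (hv : ContDiff ℝ (⊤ : ℕ∞) v) (hf : ContDiff ℝ (⊤ : ℕ∞) f) (hv0 : v 0 = 0)
    (hvb : ∀ r ∈ Set.Icc 0 b, v r ≤ -c * r) :
    ∃ C > (0:ℝ), Tendsto (fun r => r ^ (f 0 / deriv v 0) * Real.exp (-∫ ρ in b..r, f ρ / v ρ))
      (nhdsWithin 0 (Set.Ioi 0)) (nhds C) := by
  have hvd : HasDerivAt v (deriv v 0) 0 :=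
    ((hv.differentiable (by simp)) 0).hasDerivAt
  have hfd : HasDerivAt f (deriv f 0) 0 :=
    ((hf.differentiable (by simp)) 0).hasDerivAt
  have hmem : ∀ᶠ r in 𝓝[>] (0:ℝ), r ∈ Ioo 0 b := Ioo_mem_nhdsGT hb
  have hneg : deriv v 0 ≤ -c := by
    have h1 : Tendsto (slope v 0) (𝓝[>] 0) (𝓝 (deriv v 0)) :=
      (hasDerivAt_iff_tendsto_slope.1 hvd).mono_left
        (nhdsWithin_mono _ (fun x hx => ne_of_gt hx))
    refine le_of_tendsto h1 ?_
    filter_upwards [hmem] with r hr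
    rw [slope_def_field, hv0, sub_zero, sub_zero, div_le_iff₀ hr.1]
    exact hvb r ⟨hr.1.le, hr.2.le⟩
  have hd0 : deriv v 0 ≠ 0 := by linarith
  set α := f 0 / deriv v 0 with hα
  set N : ℝ → ℝ := fun x => x * f x - α * v x with hN
  have hNc : ContDiff ℝ (⊤ : ℕ∞) N := (contDiff_id.mul hf).sub (contDiff_const.mul hv)
  have hNd : HasDerivAt N 0 0 := by
    have h1 : HasDerivAt N (1 * f 0 + 0 * deriv f 0 - α * deriv v 0) 0 :=
      ((hasDerivAt_id (0:ℝ)).mul hfd).sub (hvd.const_mul α)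
    have h2 : α * deriv v 0 = f 0 := div_mul_cancel₀ _ hd0
    have h3 : 1 * f 0 + 0 * deriv f 0 - α * deriv v 0 = 0 := by rw [h2]; ring
    rwa [h3] at h1
  obtain ⟨K, hK⟩ := exists_taylor_mean_remainder_bound (f := N) (a := 0) (b := b) (n := 1) hb.le
    ((contDiff_infty.1 hNc 2).contDiffOn)
  have hKb : ∀ x ∈ Icc 0 b, |N x| ≤ K * x ^ 2 := by
    intro x hx
    have := hK x hx
    have hdw : derivWithin N (Icc 0 b) 0 = 0 :=
      hNd.hasDerivWithinAt.derivWithin (uniqueDiffOn_Icc hb 0 ⟨le_rfl, hb.le⟩)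
    have hN0 : N 0 = 0 := by simp [hN, hv0]
    rw [taylorWithinEval_succ, taylor_within_zero_eval, iteratedDerivWithin_one, hdw, hN0] at this
    simpa using this
  set h : ℝ → ℝ := fun x => f x / v x - α / x with hh
  have hvne : ∀ x ∈ Ioc 0 b, v x < 0 := fun x hx => by
    have := hvb x ⟨hx.1.le, hx.2⟩
    nlinarith [mul_pos hc hx.1]
  have hbd : ∀ x ∈ Ioc 0 b, ‖h x‖ ≤ K / c := by
    intro x hx
    have h1 := hKb x ⟨hx.1.le, hx.2⟩
    have h2 := hvne x hx
    have h3 := hvb x ⟨hx.1.le, hx.2⟩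
    have h4 : h x = N x / (x * v x) := by
      have := hx.1.ne'
      have := h2.ne
      simp only [hh, hN]; field_simp
    have h5 : c * x ^ 2 ≤ |x * v x| := by
      rw [abs_mul, abs_of_pos hx.1, abs_of_neg h2]; nlinarith [hx.1]
    have h6 : 0 < c * x ^ 2 := mul_pos hc (pow_pos hx.1 2)
    rw [h4, norm_div, Real.norm_eq_abs, Real.norm_eq_abs]
    calc |N x| / |x * v x| ≤ (K * x ^ 2) / (c * x ^ 2) :=
          div_le_div₀ ((abs_nonneg _).trans h1) h1 h6 h5
      _ = K / c := by
          have := hx.1.ne'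
          field_simp
  have hmeas : Measurable h := by
    have := hf.continuous.measurable
    have := hv.continuous.measurable
    simp only [hh]
    fun_prop
  have hint : IntervalIntegrable h volume 0 b := by
    rw [intervalIntegrable_iff_integrableOn_Ioc_of_le hb.le]
    refine Measure.integrableOn_of_bounded (M := K / c) (by simp) hmeas.aestronglyMeasurable ?_
    exact (ae_restrict_iff' measurableSet_Ioc).2 (Eventually.of_forall hbd)
  have hlim : Tendsto (fun r => ∫ ρ in b..r, h ρ) (𝓝[>] 0) (𝓝 (∫ ρ in b..0, h ρ)) := by
    have hc1 : ContinuousOn (fun r => ∫ ρ in b..r, h ρ) (uIcc b 0) :=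
      intervalIntegral.continuousOn_primitive_interval' hint.symm left_mem_uIcc
    have hc2 := hc1 0 right_mem_uIcc
    refine hc2.mono_left ?_
    rw [uIcc_of_ge hb.le, ← nhdsWithin_Ioo_eq_nhdsGT hb]
    exact nhdsWithin_mono _ Ioo_subset_Icc_self
  refine ⟨b ^ α * Real.exp (-∫ ρ in b..0, h ρ), by positivity, ?_⟩
  refine ((Real.continuous_exp.tendsto _).comp hlim.neg |>.const_mul (b ^ α)).congr' ?_
  filter_upwards [hmem] with r hr
  have hsub : uIcc b r ⊆ Ioc 0 b := by
    rw [uIcc_of_ge hr.2.le]; exact fun x hx => ⟨hr.1.trans_le hx.1, hx.2⟩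
  have i1 : IntervalIntegrable (fun x => f x / v x) volume b r :=
    (hf.continuous.continuousOn.div hv.continuous.continuousOn
      (fun x hx => (hvne x (hsub hx)).ne)).intervalIntegrable
  have i2 : IntervalIntegrable (fun x => α / x) volume b r :=
    (continuousOn_const.div continuousOn_id
      (fun x hx => (hsub hx).1.ne')).intervalIntegrable
  have e1 : ∫ ρ in b..r, h ρ = (∫ ρ in b..r, f ρ / v ρ) - α * Real.log (r / b) := by
    simp only [hh]
    rw [intervalIntegral.integral_sub i1 i2]
    congr 1
    simp only [div_eq_mul_inv α]
    rw [intervalIntegral.integral_const_mul, integral_inv_of_pos hb hr.1]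
  simp only [Function.comp]
  rw [e1, Real.rpow_def_of_pos hb, Real.rpow_def_of_pos hr.1, ← Real.exp_add, ← Real.exp_add,
    Real.log_div hr.1.ne' hb.ne']
  congr 1; ring


theorem stmt_5
    (R : ℝ) (hR : 0 < R)
    (v f : ℝ → ℝ)
    (hv : ContDiff ℝ (⊤ : ℕ∞) v) (hf : ContDiff ℝ (⊤ : ℕ∞) f)
    (hv0 : v 0 = 0) (hvR : v R = 0)
    (c₁ c₂ : ℝ) (hc₂ : 0 < c₂) (hc : c₂ ≤ c₁)
    (hvb : ∀ r ∈ Set.Icc 0 R,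
      -c₁ * (r * (R - r)) ≤ v r ∧ v r ≤ -c₂ * (r * (R - r)))
    (hfneg : ∀ r ∈ Set.Icc 0 R, f r < 0)
    (r₀ : ℝ) (hr₀ : r₀ ∈ Set.Ioo 0 R)
    (α₀ α₁ : ℝ) (hα₀ : α₀ = f 0 / deriv v 0) (hα₁ : α₁ = -f R / deriv v R) :
    ∃ C₀ > (0:ℝ), ∃ C₁ > (0:ℝ),
      Tendsto (fun r => r ^ α₀ * Wfun v f r₀ r)
        (nhdsWithin 0 (Set.Ioi 0)) (nhds C₀) ∧
      Tendsto (fun r => (R - r) ^ (-α₁) * Wfun v f r₀ r)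
        (nhdsWithin R (Set.Iio R)) (nhds C₁) := by
  obtain ⟨h0, hR0⟩ := hr₀
  obtain ⟨C₀, hC₀, h1⟩ := left_aux r₀ (c₂ * (R - r₀)) h0 (mul_pos hc₂ (by linarith)) v f hv hf hv0
    (by
      intro r hr
      have := (hvb r ⟨hr.1, by linarith [hr.2]⟩).2
      nlinarith [mul_nonneg (mul_nonneg hc₂.le hr.1) (sub_nonneg.2 hr.2)])
  obtain ⟨C₁, hC₁, h2⟩ := left_aux (R - r₀) (c₂ * r₀) (by linarith) (mul_pos hc₂ h0)
    (fun x => v (R - x)) (fun x => - f (R - x)) (hv.comp (contDiff_const.sub contDiff_id))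
    (hf.comp (contDiff_const.sub contDiff_id)).neg (by simpa using hvR)
    (by
      intro r hr
      have := (hvb (R - r) ⟨by linarith [hr.2], by linarith [hr.1]⟩).2
      have h3 : 0 ≤ (R - r₀) - r := by linarith [hr.2]
      nlinarith [mul_nonneg (mul_nonneg hc₂.le hr.1) h3])
  refine ⟨C₀, hC₀, C₁, hC₁, ?_, ?_⟩
  · rw [hα₀]; exact h1
  · have ht : Tendsto (fun r => R - r) (𝓝[<] R) (𝓝[>] 0) := by
      refine tendsto_nhdsWithin_iff.2 ⟨?_, ?_⟩
      · have : Tendsto (fun r => R - r) (𝓝 R) (𝓝 (R - R)) :=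
          (continuous_const.sub continuous_id).tendsto R
        rw [sub_self] at this
        exact this.mono_left nhdsWithin_le_nhds
      · filter_upwards [self_mem_nhdsWithin] with r hr
        exact sub_pos.2 (mem_Iio.1 hr)
    refine (h2.comp ht).congr ?_
    intro r
    have e1 : deriv (fun x => v (R - x)) 0 = - deriv v R := by
      rw [deriv_comp_const_sub]; simp
    have e2 : ∫ ρ in (R - r₀)..(R - r), -f (R - ρ) / v (R - ρ) = ∫ ρ in r₀..r, f ρ / v ρ := by
      rw [intervalIntegral.integral_comp_sub_left (fun x => -f x / v x) R]
      simp only [sub_sub_cancel, neg_div]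
      rw [intervalIntegral.integral_neg, ← intervalIntegral.integral_symm]
    simp only [Function.comp, Wfun, e1, e2, hα₁, sub_zero]
    rw [neg_div_neg_eq, neg_div, neg_neg]
end

section
/- There exist constants 0 < C₁ < C₂ such that C₁ r^{−α₀} (R−r)^{α₁} ≤ W(r) ≤ C₂ r^{−α₀} (R−r)^{α₁} for all r ∈ (0,R). -/
open MeasureTheory Set Filter Topology

lemma taylor_aux (N : ℝ → ℝ) (hN : ContDiff ℝ (⊤ : ℕ∞) N) (R a : ℝ) (ha : a ∈ Set.Icc 0 R)
    (h0 : N a = 0) (h1 : deriv N a = 0) :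
    ∃ K : ℝ, 0 ≤ K ∧ ∀ x ∈ Set.Icc 0 R, |N x| ≤ K * (x - a) ^ 2 := by
  have hN2 : ContDiff ℝ 2 N := contDiff_infty.1 hN 2
  have hd : Differentiable ℝ N := hN2.differentiable (by norm_num)
  have hN1 : ContDiff ℝ 1 (deriv N) := by
    have h2 : ContDiff ℝ (1 + 1) N := by
      rw [one_add_one_eq_two]; exact hN2
    exact (contDiff_succ_iff_deriv.1 h2).2.2
  have hd1 : Differentiable ℝ (deriv N) := hN1.differentiable (by norm_num)
  have hc : Continuous (deriv (deriv N)) := hN1.continuous_deriv (by norm_num)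
  obtain ⟨K, hK⟩ := (isCompact_Icc (a := (0:ℝ)) (b := R)).exists_bound_of_continuousOn
    hc.continuousOn
  have hK0 : 0 ≤ K := (norm_nonneg _).trans (hK a ha)
  have hb : ∀ x ∈ Set.Icc 0 R, |deriv N x| ≤ K * |x - a| := by
    intro x hx
    have := (convex_Icc 0 R).norm_image_sub_le_of_norm_deriv_le (f := deriv N)
      (fun y _ => hd1 y) hK ha hx
    simpa [h1] using this
  refine ⟨K, hK0, fun x hx => ?_⟩
  have hsub : Set.uIcc a x ⊆ Set.Icc 0 R := (Set.ordConnected_Icc).uIcc_subset ha hx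
  have := (convex_uIcc a x).norm_image_sub_le_of_norm_deriv_le (f := N) (C := K * |x - a|)
      (fun y _ => hd y) (fun y hy => (hb y (hsub hy)).trans
        (mul_le_mul_of_nonneg_left (Set.abs_sub_left_of_mem_uIcc hy) hK0))
      Set.left_mem_uIcc Set.right_mem_uIcc
  rw [h0, sub_zero, Real.norm_eq_abs, Real.norm_eq_abs, mul_assoc, abs_mul_abs_self] at this
  rw [pow_two]; exact this

theorem stmt_6
    (R : ℝ) (hR : 0 < R)
    (v f : ℝ → ℝ)
    (hv : ContDiff ℝ (⊤ : ℕ∞) v) (hf : ContDiff ℝ (⊤ : ℕ∞) f)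
    (hv0 : v 0 = 0) (hvR : v R = 0)
    (c₁ c₂ : ℝ) (hc₂ : 0 < c₂) (hc : c₂ ≤ c₁)
    (hvb : ∀ r ∈ Set.Icc 0 R,
      -c₁ * (r * (R - r)) ≤ v r ∧ v r ≤ -c₂ * (r * (R - r)))
    (hfneg : ∀ r ∈ Set.Icc 0 R, f r < 0)
    (r₀ : ℝ) (hr₀ : r₀ ∈ Set.Ioo 0 R)
    (α₀ α₁ : ℝ) (hα₀ : α₀ = f 0 / deriv v 0) (hα₁ : α₁ = -f R / deriv v R) :
    ∃ C₁ C₂ : ℝ, 0 < C₁ ∧ C₁ < C₂ ∧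
      ∀ r ∈ Set.Ioo 0 R,
        C₁ * r ^ (-α₀) * (R - r) ^ α₁ ≤ Wfun v f r₀ r ∧
        Wfun v f r₀ r ≤ C₂ * r ^ (-α₀) * (R - r) ^ α₁ := by
  have hvd : Differentiable ℝ v := hv.differentiable (by simp)
  have hfd : Differentiable ℝ f := hf.differentiable (by simp)
  have hvlow : ∀ r ∈ Set.Icc 0 R, c₂ * (r * (R - r)) ≤ |v r| := by
    intro r hr
    have := (hvb r hr).2
    have := neg_le_abs (v r)
    linarith
  have hd0 : deriv v 0 ≠ 0 := by
    intro h
    obtain ⟨K, hK, hb⟩ := taylor_aux v hv R 0 ⟨le_rfl, hR.le⟩ hv0 h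
    have hp : 0 < K + c₂ := by linarith
    set r := c₂ * R / (2 * (K + c₂)) with hr
    have hr0 : 0 < r := by positivity
    have hre : 2 * (K + c₂) * r = c₂ * R := by rw [hr]; field_simp
    have hrR : r ≤ R := by
      have : c₂ * r ≤ c₂ * R := by nlinarith [mul_nonneg hK hr0.le]
      exact le_of_mul_le_mul_left this hc₂
    have h1 := hb r ⟨hr0.le, hrR⟩
    have h2 := hvlow r ⟨hr0.le, hrR⟩
    have h3 : r * (c₂ * (R - r)) ≤ r * (K * r) := by nlinarith
    have h4 := le_of_mul_le_mul_left h3 hr0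
    nlinarith [mul_pos hp hr0]
  have hdR : deriv v R ≠ 0 := by
    intro h
    obtain ⟨K, hK, hb⟩ := taylor_aux v hv R R ⟨hR.le, le_rfl⟩ hvR h
    have hp : 0 < K + c₂ := by linarith
    set r := c₂ * R / (2 * (K + c₂)) with hr
    have hr0 : 0 < r := by positivity
    have hre : 2 * (K + c₂) * r = c₂ * R := by rw [hr]; field_simp
    have hrR : r ≤ R := by
      have : c₂ * r ≤ c₂ * R := by nlinarith [mul_nonneg hK hr0.le]
      exact le_of_mul_le_mul_left this hc₂
    have h1 := hb (R - r) ⟨by linarith, by linarith⟩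
    have h2 := hvlow (R - r) ⟨by linarith, by linarith⟩
    have h3 : r * (c₂ * (R - r)) ≤ r * (K * r) := by nlinarith
    have h4 := le_of_mul_le_mul_left h3 hr0
    nlinarith [mul_pos hp hr0]
  have e0 : α₀ * deriv v 0 = f 0 := by rw [hα₀]; field_simp
  have eR : α₁ * deriv v R = - f R := by rw [hα₁]; field_simp
  set N : ℝ → ℝ := fun r => f r * (r * (R - r)) - v r * (α₀ * (R - r) + α₁ * r) with hNdef
  have hN : ContDiff ℝ (⊤ : ℕ∞) N := by rw [hNdef]; fun_prop
  have hND : ∀ r, HasDerivAt N (deriv f r * (r * (R - r)) + f r * (1 * (R - r) + r * (-1))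
      - (deriv v r * (α₀ * (R - r) + α₁ * r) + v r * (α₀ * (-1) + α₁ * 1))) r := by
    intro r
    have hid := hasDerivAt_id' r
    have hs : HasDerivAt (fun r : ℝ => R - r) (-1) r := hid.const_sub R
    exact ((hfd r).hasDerivAt.mul (hid.mul hs)).sub
      ((hvd r).hasDerivAt.mul ((hs.const_mul α₀).add (hid.const_mul α₁)))
  obtain ⟨K, hK, hKb⟩ := taylor_aux N hN R 0 ⟨le_rfl, hR.le⟩ (by simp [hNdef, hv0]) (by
    rw [(hND 0).deriv, hv0]; linear_combination -R * e0)
  obtain ⟨L, hL, hLb⟩ := taylor_aux N hN R R ⟨hR.le, le_rfl⟩ (by simp [hNdef, hvR]) (by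
    rw [(hND R).deriv, hvR]; linear_combination -R * eR)
  have hvneg : ∀ r ∈ Set.Ioo 0 R, v r < 0 := by
    intro r hr
    have h1 := (hvb r ⟨hr.1.le, hr.2.le⟩).2
    have h2 : 0 < c₂ * (r * (R - r)) := mul_pos hc₂ (mul_pos hr.1 (sub_pos.2 hr.2))
    linarith
  -- bounded remainder
  set M : ℝ := 4 * (K + L) / (c₂ * R ^ 2) with hM
  have hMe : M * c₂ * R ^ 2 = 4 * (K + L) := by rw [hM]; field_simp
  have hM0 : 0 ≤ M := by positivity
  have hNb : ∀ r ∈ Set.Ioo 0 R, |N r| ≤ M * (c₂ * (r * (R - r)) * (r * (R - r))) := by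
    intro r hr
    have h1 := hKb r ⟨hr.1.le, hr.2.le⟩
    have h2 := hLb r ⟨hr.1.le, hr.2.le⟩
    have hs : 0 < R - r := sub_pos.2 hr.2
    have hMc : 0 ≤ M * c₂ := by positivity
    rcases le_total r (R / 2) with h | h
    · have h3 : R ^ 2 ≤ 4 * (R - r) ^ 2 := by nlinarith
      have h4 : K ≤ M * c₂ * (R - r) ^ 2 := by nlinarith [mul_le_mul_of_nonneg_left h3 hMc]
      have h5 := mul_le_mul_of_nonneg_right h4 (sq_nonneg r)
      rw [sub_zero] at h1
      linarith
    · have h3 : R ^ 2 ≤ 4 * r ^ 2 := by nlinarith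
      have h4 : L ≤ M * c₂ * r ^ 2 := by nlinarith [mul_le_mul_of_nonneg_left h3 hMc]
      have h5 := mul_le_mul_of_nonneg_right h4 (sq_nonneg (r - R))
      linarith
  have hh : ∀ r ∈ Set.Ioo 0 R, |f r / v r - α₀ / r - α₁ / (R - r)| ≤ M := by
    intro r hr
    have hs : 0 < R - r := sub_pos.2 hr.2
    have hr0 : 0 < r := hr.1
    have hv' := hvneg r hr
    have hvn : v r ≠ 0 := hv'.ne
    have e : f r / v r - α₀ / r - α₁ / (R - r) = N r / (v r * (r * (R - r))) := by
      rw [hNdef]; field_simp; ring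
    have hrs : 0 < r * (R - r) := mul_pos hr0 hs
    rw [e, abs_div, div_le_iff₀ (abs_pos.2 (mul_ne_zero hvn hrs.ne')), abs_mul, abs_of_pos hrs]
    refine (hNb r hr).trans (mul_le_mul_of_nonneg_left ?_ hM0)
    exact mul_le_mul_of_nonneg_right (hvlow r ⟨hr.1.le, hr.2.le⟩) hrs.le
  have hcont : ContinuousOn (fun ρ => f ρ / v ρ) (Set.Ioo 0 R) :=
    hfd.continuous.continuousOn.div hvd.continuous.continuousOn (fun r hr => (hvneg r hr).ne)
  set G : ℝ → ℝ := fun r => (∫ ρ in r₀..r, f ρ / v ρ) - α₀ * Real.log r + α₁ * Real.log (R - r)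
    with hG
  have hGD : ∀ r ∈ Set.Ioo 0 R,
      HasDerivWithinAt G (f r / v r - α₀ / r - α₁ / (R - r)) (Set.Ioo 0 R) r := by
    intro r hr
    have hs : 0 < R - r := sub_pos.2 hr.2
    have hsub : Set.uIcc r₀ r ⊆ Set.Ioo 0 R := (Set.ordConnected_Ioo).uIcc_subset hr₀ hr
    have i1 : HasDerivAt (fun r => ∫ ρ in r₀..r, f ρ / v ρ) (f r / v r) r :=
      intervalIntegral.integral_hasDerivAt_right ((hcont.mono hsub).intervalIntegrable)
        (hcont.stronglyMeasurableAtFilter isOpen_Ioo r hr)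
        (hcont.continuousAt (isOpen_Ioo.mem_nhds hr))
    have i2 := (Real.hasDerivAt_log hr.1.ne').const_mul α₀
    have i3 := (((hasDerivAt_id' r).const_sub R).log hs.ne').const_mul α₁
    have := ((i1.sub i2).add i3).hasDerivWithinAt (s := Set.Ioo 0 R)
    refine this.congr_deriv ?_
    ring
  have hGb : ∀ r ∈ Set.Ioo 0 R, |G r - G r₀| ≤ M * R := by
    intro r hr
    have := (convex_Ioo 0 R).norm_image_sub_le_of_norm_hasDerivWithin_le hGD hh hr₀ hr
    refine this.trans (mul_le_mul_of_nonneg_left ?_ hM0)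
    rw [Real.norm_eq_abs, abs_le]
    constructor <;> linarith [hr.1, hr.2, hr₀.1, hr₀.2]
  refine ⟨Real.exp (-G r₀ - M * R - 1), Real.exp (-G r₀ + M * R), Real.exp_pos _,
    Real.exp_lt_exp.2 (by nlinarith [mul_nonneg hM0 hR.le]), fun r hr => ?_⟩
  have hs : 0 < R - r := sub_pos.2 hr.2
  have hb := abs_le.1 (hGb r hr)
  have hGr : G r = (∫ ρ in r₀..r, f ρ / v ρ) - α₀ * Real.log r + α₁ * Real.log (R - r) := rfl
  rw [Wfun, Real.rpow_def_of_pos hr.1, Real.rpow_def_of_pos hs, ← Real.exp_add, ← Real.exp_add,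
    ← Real.exp_add, ← Real.exp_add, Real.exp_le_exp, Real.exp_le_exp]
  constructor <;> nlinarith [hb.1, hb.2]
end

section
/- If φ ∈ C¹(0,R) solves the homogeneous singular ODE −v(r)φ′(r) + f(r)φ(r) = 0 on (0,R) and φ is bounded on (R−δ, R) for some δ > 0, then φ is identically zero on (0,R). -/
open MeasureTheory Set Filter Topology

theorem stmt_7
    (R : ℝ) (hR : 0 < R)
    (v f : ℝ → ℝ)
    (hv : ContDiff ℝ (⊤ : ℕ∞) v) (hf : ContDiff ℝ (⊤ : ℕ∞) f)
    (hv0 : v 0 = 0) (hvR : v R = 0)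
    (c₁ c₂ : ℝ) (hc₂ : 0 < c₂) (hc : c₂ ≤ c₁)
    (hvb : ∀ r ∈ Set.Icc 0 R,
      -c₁ * (r * (R - r)) ≤ v r ∧ v r ≤ -c₂ * (r * (R - r)))
    (hfneg : ∀ r ∈ Set.Icc 0 R, f r < 0)
    (φ : ℝ → ℝ)
    (hdiff : ∀ r ∈ Set.Ioo 0 R, DifferentiableAt ℝ φ r)
    (hderiv : ContinuousOn (deriv φ) (Set.Ioo 0 R))
    (heq : ∀ r ∈ Set.Ioo 0 R, -v r * deriv φ r + f r * φ r = 0)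
    (hbdd : ∃ δ > (0:ℝ), ∃ M : ℝ, ∀ r ∈ Set.Ioo (R - δ) R, |φ r| ≤ M) :
    ∀ r ∈ Set.Ioo 0 R, φ r = 0 := by
  intro r₀ hr₀
  by_contra hne
  obtain ⟨δ, hδ, M, hM⟩ := hbdd
  have hc₁ : 0 < c₁ := lt_of_lt_of_le hc₂ hc
  obtain ⟨x, hx, hxmax⟩ := isCompact_Icc.exists_isMaxOn (Set.nonempty_Icc.2 hR.le)
    (hf.continuous.continuousOn (s := Set.Icc 0 R))
  have hfx : ∀ r ∈ Set.Icc 0 R, f r ≤ f x := fun r hr => hxmax hr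
  obtain ⟨m, hm⟩ : ∃ m, m = - f x := ⟨_, rfl⟩
  have hmpos : 0 < m := by have := hfneg x hx; linarith
  have hvneg : ∀ r ∈ Set.Ioo 0 R, 0 < - v r := by
    intro r hr
    have h1 := (hvb r ⟨hr.1.le, hr.2.le⟩).2
    have h2 : 0 < c₂ * (r * (R - r)) := mul_pos hc₂ (mul_pos hr.1 (by linarith [hr.2]))
    linarith
  have hsq : ∀ r ∈ Set.Ioo 0 R, HasDerivAt (fun r => φ r ^ 2) (2 * φ r * deriv φ r) r := by
    intro r hr
    have := (hdiff r hr).hasDerivAt.pow 2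
    exact this.congr_deriv (by norm_num)
  have hkey : ∀ r ∈ Set.Ioo 0 R, (2 * φ r * deriv φ r) * (- v r) = 2 * (- f r) * φ r ^ 2 := by
    intro r hr
    linear_combination 2 * φ r * heq r hr
  have hmono : MonotoneOn (fun r => φ r ^ 2) (Set.Ioo 0 R) := by
    apply monotoneOn_of_deriv_nonneg (convex_Ioo 0 R)
    · exact fun r hr => (hsq r hr).continuousAt.continuousWithinAt
    · rw [interior_Ioo]
      exact fun r hr => (hsq r hr).differentiableAt.differentiableWithinAt
    · rw [interior_Ioo]
      intro r hr
      rw [(hsq r hr).deriv]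
      by_contra hcon
      push Not at hcon
      have h1 := mul_neg_of_neg_of_pos hcon (hvneg r hr)
      rw [hkey r hr] at h1
      have h2 := hfneg r ⟨hr.1.le, hr.2.le⟩
      have h3 : 0 ≤ 2 * (- f r) * φ r ^ 2 := mul_nonneg (by linarith) (sq_nonneg _)
      linarith
  obtain ⟨a, ha⟩ : ∃ a, a = φ r₀ ^ 2 := ⟨_, rfl⟩
  have hapos : 0 < a := by rw [ha]; positivity
  obtain ⟨C, hC⟩ : ∃ C, C = 2 * m * a / (c₁ * R) := ⟨_, rfl⟩
  have hCpos : 0 < C := by rw [hC]; positivity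
  have hg : ∀ r ∈ Set.Ioo 0 R, HasDerivAt (fun r => φ r ^ 2 + C * Real.log (R - r))
      (2 * φ r * deriv φ r + C * (-1 / (R - r))) r := by
    intro r hr
    have h1 : HasDerivAt (fun r => R - r) (-1) r := by
      simpa using (hasDerivAt_id r).const_sub R
    exact (hsq r hr).add ((h1.log (by linarith [hr.2])).const_mul C)
  have hsub : Set.Ico r₀ R ⊆ Set.Ioo 0 R := fun r hr => ⟨lt_of_lt_of_le hr₀.1 hr.1, hr.2⟩
  have hgmono : MonotoneOn (fun r => φ r ^ 2 + C * Real.log (R - r)) (Set.Ico r₀ R) := by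
    apply monotoneOn_of_deriv_nonneg (convex_Ico r₀ R)
    · exact fun r hr => (hg r (hsub hr)).continuousAt.continuousWithinAt
    · exact fun r hr =>
        (hg r (hsub (interior_subset hr))).differentiableAt.differentiableWithinAt
    · intro r hr
      have hr1 := interior_subset hr
      have hr' := hsub hr1
      rw [(hg r hr').deriv]
      have hRr : 0 < R - r := by linarith [hr'.2]
      have h1 := hvneg r hr'
      have h2 : a ≤ φ r ^ 2 := by rw [ha]; exact hmono hr₀ hr' hr1.1
      have h3 := hfx r ⟨hr'.1.le, hr'.2.le⟩
      have h4 := (hvb r ⟨hr'.1.le, hr'.2.le⟩).1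
      have h5 : - v r ≤ c₁ * R * (R - r) := by
        have : c₁ * (r * (R - r)) ≤ c₁ * (R * (R - r)) := by
          gcongr
          exact hr'.2.le
        linarith
      have h6 : 2 * m * a ≤ 2 * (- f r) * φ r ^ 2 := by
        apply mul_le_mul _ h2 hapos.le <;> linarith
      have h7 : 2 * φ r * deriv φ r = 2 * (- f r) * φ r ^ 2 / (- v r) := by
        rw [eq_div_iff h1.ne']; exact hkey r hr'
      have h8 : 2 * m * a / (c₁ * R * (R - r)) ≤ 2 * (- f r) * φ r ^ 2 / (- v r) := by
        apply div_le_div₀ _ h6 h1 h5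
        exact le_trans (by positivity) h6
      have h9 : C * (-1 / (R - r)) = - (2 * m * a / (c₁ * R * (R - r))) := by
        rw [hC]; field_simp
      rw [h7, h9]
      linarith
  have hlog := Real.tendsto_log_nhdsGT_zero.eventually
    (eventually_lt_atBot ((a + C * Real.log (R - r₀) - M ^ 2) / C))
  have hnear : ∀ᶠ t in 𝓝[>] (0:ℝ), t ∈ Set.Ioo 0 (min δ (R - r₀)) :=
    Ioo_mem_nhdsGT (lt_min hδ (by linarith [hr₀.2]))
  obtain ⟨t, ht1, ht2, ht3⟩ := (hlog.and hnear).exists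
  have ht4 := lt_of_lt_of_le ht3 (min_le_left _ _)
  have ht5 := lt_of_lt_of_le ht3 (min_le_right _ _)
  have h1 := hM (R - t) ⟨by linarith, by linarith⟩
  have h2 : φ (R - t) ^ 2 ≤ M ^ 2 := by
    rw [← sq_abs]
    exact pow_le_pow_left₀ (abs_nonneg _) h1 2
  have h3 := hgmono (⟨le_refl _, hr₀.2⟩ : r₀ ∈ Set.Ico r₀ R)
    (⟨by linarith, by linarith⟩ : R - t ∈ Set.Ico r₀ R) (by linarith)
  simp only [sub_sub_cancel] at h3
  rw [lt_div_iff₀ hCpos] at ht1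
  rw [← ha] at h3
  linarith
end

section
/- Suppose h : [0,R] → ℝ is continuous and, in addition, h is C¹ on (0,R]. Then the unique solution φ ∈ C[0,R] ∩ C¹(0,R) of the singular ODE −v(r)φ′(r) + f(r)φ(r) = h(r) on (0,R) is continuously differentiable up to r = R; more precisely, lim_{r→R⁻} φ′(r) = (h′(R) − f′(R)·φ(R)) / (f(R) − v′(R)), where φ(R) = h(R)/f(R). -/
open MeasureTheory Set Filter Topology

theorem stmt_8
    (R : ℝ) (hR : 0 < R)
    (v f : ℝ → ℝ)
    (hv : ContDiff ℝ (⊤ : ℕ∞) v) (hf : ContDiff ℝ (⊤ : ℕ∞) f)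
    (hv0 : v 0 = 0) (hvR : v R = 0)
    (c₁ c₂ : ℝ) (hc₂ : 0 < c₂) (hc : c₂ ≤ c₁)
    (hvb : ∀ r ∈ Set.Icc 0 R,
      -c₁ * (r * (R - r)) ≤ v r ∧ v r ≤ -c₂ * (r * (R - r)))
    (hfneg : ∀ r ∈ Set.Icc 0 R, f r < 0)
    (h h' : ℝ → ℝ)
    (hh : ContinuousOn h (Set.Icc 0 R))
    -- h is C¹ on (0,R], with derivative h'
    (hh' : ∀ r ∈ Set.Ioc 0 R, HasDerivWithinAt h (h' r) (Set.Ioc 0 R) r)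
    (hh'c : ContinuousOn h' (Set.Ioc 0 R))
    (φ : ℝ → ℝ) (hφ : IsSingODESol v f h φ R) :
    φ R = h R / f R ∧
    Tendsto (deriv φ) (nhdsWithin R (Set.Iio R))
      (nhds ((h' R - deriv f R * (h R / f R)) / (f R - deriv v R))) := by
  obtain ⟨hφc, hφd, hφ'c, hode⟩ := hφ
  have hRm : R ∈ Icc 0 R := ⟨hR.le, le_rfl⟩
  have hvd : ∀ x, HasDerivAt v (deriv v x) x := fun x =>
    (hv.differentiable (by simp) x).hasDerivAt
  have hfd : ∀ x, HasDerivAt f (deriv f x) x := fun x =>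
    (hf.differentiable (by simp) x).hasDerivAt
  have hdvc : Continuous (deriv v) := hv.continuous_deriv (by simp)
  have hdfc : Continuous (deriv f) := hf.continuous_deriv (by simp)
  have hev : ∀ᶠ r in 𝓝[<] R, r ∈ Ioo (R / 2) R :=
    Ioo_mem_nhdsLT (by linarith)
  have hle : 𝓝[<] R ≤ 𝓝[Icc 0 R] R := by
    apply nhdsWithin_le_of_mem
    filter_upwards [hev] with r hr
    exact ⟨by linarith [hr.1], hr.2.le⟩
  have hle' : 𝓝[<] R ≤ 𝓝[Ioc 0 R] R := by
    apply nhdsWithin_le_of_mem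
    filter_upwards [hev] with r hr
    exact ⟨by linarith [hr.1], hr.2.le⟩
  have tφ : Tendsto φ (𝓝[<] R) (𝓝 (φ R)) := (hφc R hRm).mono_left hle
  have th : Tendsto h (𝓝[<] R) (𝓝 (h R)) := (hh R hRm).mono_left hle
  have th' : Tendsto h' (𝓝[<] R) (𝓝 (h' R)) := (hh'c R ⟨hR, le_rfl⟩).mono_left hle'
  have tv : Tendsto v (𝓝[<] R) (𝓝 0) := by
    have := hv.continuous.continuousAt (x := R)
    rw [ContinuousAt, hvR] at this
    exact this.mono_left nhdsWithin_le_nhds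
  have tf : Tendsto f (𝓝[<] R) (𝓝 (f R)) :=
    (hf.continuous.continuousAt (x := R)).tendsto.mono_left nhdsWithin_le_nhds
  have tdv : Tendsto (deriv v) (𝓝[<] R) (𝓝 (deriv v R)) :=
    (hdvc.continuousAt (x := R)).tendsto.mono_left nhdsWithin_le_nhds
  have tdf : Tendsto (deriv f) (𝓝[<] R) (𝓝 (deriv f R)) :=
    (hdfc.continuousAt (x := R)).tendsto.mono_left nhdsWithin_le_nhds
  have hvneg : ∀ r ∈ Ioo 0 R, v r < 0 := by
    intro r hr
    have h1 := (hvb r ⟨hr.1.le, hr.2.le⟩).2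
    have h2 : 0 < c₂ * (r * (R - r)) :=
      mul_pos hc₂ (mul_pos hr.1 (by linarith [hr.2]))
    linarith
  have hdvR : 0 < deriv v R := by
    have hs : Tendsto (slope v R) (𝓝[<] R) (𝓝 (deriv v R)) :=
      (hasDerivAt_iff_tendsto_slope.1 (hvd R)).mono_left
        (nhdsWithin_mono _ (fun x hx => ne_of_lt hx))
    have : c₂ * (R / 2) ≤ deriv v R := by
      refine ge_of_tendsto hs ?_
      filter_upwards [hev] with r hr
      have h1 := (hvb r ⟨by linarith [hr.1], hr.2.le⟩).2
      rw [slope_def_field, hvR, le_div_iff_of_neg (by linarith [hr.2])]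
      have : 0 ≤ c₂ * ((r - R / 2) * (R - r)) :=
        mul_nonneg hc₂.le (mul_nonneg (by linarith [hr.1]) (by linarith [hr.2]))
      nlinarith
    have : 0 < c₂ * (R / 2) := by positivity
    linarith
  have hfR := hfneg R hRm
  have evdv : ∀ᶠ r in 𝓝[<] R, 0 < deriv v r := tdv.eventually (lt_mem_nhds hdvR)
  -- Step 1
  have key1 : φ R = h R / f R := by
    have L := HasDerivAt.lhopital_zero_nhdsLT (a := R) (f := fun r => v r * φ r)
      (f' := fun r => deriv v r * φ r + v r * deriv φ r) (g := v) (g' := deriv v)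
      (l := 𝓝 ((deriv v R * φ R + (f R * φ R - h R)) / deriv v R))
      (by
        filter_upwards [hev] with r hr
        exact (hvd r).mul (hφd r ⟨by linarith [hr.1], hr.2⟩).hasDerivAt)
      (Eventually.of_forall hvd)
      (evdv.mono fun r hr => hr.ne')
      (by simpa using tv.mul tφ) tv
      (by
        refine Tendsto.congr' ?_ (((tdv.mul tφ).add ((tf.mul tφ).sub th)).div tdv hdvR.ne')
        filter_upwards [hev] with r hr
        have := hode r ⟨by linarith [hr.1], hr.2⟩
        simp only [Pi.div_apply]
        congr 2
        linarith)
    have L2 : Tendsto (fun r => v r * φ r / v r) (𝓝[<] R) (𝓝 (φ R)) := by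
      refine tφ.congr' ?_
      filter_upwards [hev] with r hr
      have := hvneg r ⟨by linarith [hr.1], hr.2⟩
      field_simp [this.ne]
    have := tendsto_nhds_unique L2 L
    rw [eq_div_iff hdvR.ne'] at this
    rw [eq_div_iff hfR.ne]
    linarith
  refine ⟨key1, ?_⟩
  rw [← key1]
  -- Step 2: integrating factor
  have hqc : ContinuousOn (fun r => f r / v r) (Ioo 0 R) :=
    hf.continuous.continuousOn.div hv.continuous.continuousOn (fun r hr => (hvneg r hr).ne)
  obtain ⟨F, hF⟩ : ∃ F : ℝ → ℝ, F = fun r => ∫ t in (R/2)..r, f t / v t := ⟨_, rfl⟩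
  have hFd : ∀ r ∈ Ioo (R / 2) R, HasDerivAt F (f r / v r) r := by
    intro r hr
    have hr0 : r ∈ Ioo 0 R := ⟨by linarith [hr.1], hr.2⟩
    rw [hF]
    refine intervalIntegral.integral_hasDerivAt_right ?_ ?_ ?_
    · apply ContinuousOn.intervalIntegrable
      apply hqc.mono
      rw [uIcc_of_le hr.1.le]
      intro t ht
      exact ⟨by linarith [ht.1], by linarith [ht.2, hr.2]⟩
    · exact hqc.stronglyMeasurableAtFilter isOpen_Ioo r hr0
    · exact hqc.continuousAt (isOpen_Ioo.mem_nhds hr0)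
  have hFnn : ∀ r ∈ Ioo (R / 2) R, 0 ≤ F r := by
    intro r hr
    rw [hF]
    refine intervalIntegral.integral_nonneg hr.1.le ?_
    intro t ht
    have ht0 : t ∈ Ioo 0 R := ⟨by linarith [ht.1], by linarith [ht.2, hr.2]⟩
    exact (div_pos_of_neg_of_neg (hfneg t ⟨ht0.1.le, ht0.2.le⟩) (hvneg t ht0)).le
  have hEd : ∀ r ∈ Ioo (R / 2) R,
      HasDerivAt (fun r => Real.exp (-F r)) (Real.exp (-F r) * (-(f r / v r))) r :=
    fun r hr => (hFd r hr).neg.exp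
  have tmul : ∀ g : ℝ → ℝ, Tendsto g (𝓝[<] R) (𝓝 0) →
      Tendsto (fun r => g r * Real.exp (-F r)) (𝓝[<] R) (𝓝 0) := by
    intro g hg
    refine squeeze_zero_norm' ?_ (by simpa using hg.norm)
    filter_upwards [hev] with r hr
    rw [norm_mul, Real.norm_eq_abs (Real.exp _), abs_of_pos (Real.exp_pos _)]
    have : Real.exp (-F r) ≤ 1 := Real.exp_le_one_iff.2 (by linarith [hFnn r hr])
    exact mul_le_of_le_one_right (norm_nonneg _) this
  have tw : Tendsto (fun r => f r * φ r - h r) (𝓝[<] R) (𝓝 0) := by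
    have := (tf.mul tφ).sub th
    rwa [key1, mul_div_cancel₀ _ hfR.ne, sub_self] at this
  have hne : f R - deriv v R ≠ 0 := by linarith
  have tden : Tendsto (fun r => deriv v r - f r) (𝓝[<] R) (𝓝 (deriv v R - f R)) := tdv.sub tf
  have L := HasDerivAt.lhopital_zero_nhdsLT (a := R)
      (f := fun r => (f r * φ r - h r) * Real.exp (-F r))
      (f' := fun r => (deriv f r * φ r - h' r) * Real.exp (-F r))
      (g := fun r => v r * Real.exp (-F r))
      (g' := fun r => (deriv v r - f r) * Real.exp (-F r))
      (l := 𝓝 ((deriv f R * φ R - h' R) / (deriv v R - f R)))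
      (by
        filter_upwards [hev] with r hr
        have hr0 : r ∈ Ioo 0 R := ⟨by linarith [hr.1], hr.2⟩
        have hhd : HasDerivAt h (h' r) r :=
          (hh' r ⟨hr0.1, hr0.2.le⟩).hasDerivAt (Ioc_mem_nhds hr0.1 hr0.2)
        have := (((hfd r).mul (hφd r hr0).hasDerivAt).sub hhd).mul (hEd r hr)
        refine this.congr_deriv ?_
        have hvr := (hvneg r hr0).ne
        have ho := hode r hr0
        have hw : f r * φ r - h r = v r * deriv φ r := by linarith
        simp only [Pi.sub_apply, Pi.mul_apply]
        rw [hw]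
        field_simp
        ring)
      (by
        filter_upwards [hev] with r hr
        have hr0 : r ∈ Ioo 0 R := ⟨by linarith [hr.1], hr.2⟩
        have hvr := (hvneg r hr0).ne
        refine ((hvd r).mul (hEd r hr)).congr_deriv ?_
        field_simp
        ring)
      (by
        filter_upwards [hev, evdv] with r hr hd
        have := hfneg r ⟨by linarith [hr.1], hr.2.le⟩
        exact mul_ne_zero (by linarith) (Real.exp_pos _).ne')
      (tmul _ tw) (tmul _ tv)
      (by
        refine Tendsto.congr' ?_ (((tdf.mul tφ).sub th').div tden (by linarith))
        filter_upwards with r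
        have := (Real.exp_pos (-F r)).ne'
        simp only [Pi.div_apply]
        rw [mul_div_mul_right _ _ this])
  have e : (h' R - deriv f R * φ R) / (f R - deriv v R)
      = (deriv f R * φ R - h' R) / (deriv v R - f R) := by
    rw [← neg_div_neg_eq, neg_sub, neg_sub]
  rw [e]
  refine L.congr' ?_
  filter_upwards [hev] with r hr
  have hr0 : r ∈ Ioo 0 R := ⟨by linarith [hr.1], hr.2⟩
  rw [mul_div_mul_right _ _ (Real.exp_pos _).ne', div_eq_iff (hvneg r hr0).ne]
  linarith [hode r hr0]
end

section
/- Define, for φ ∈ C[0,R], the function Kφ by Kφ(r) = r^{k−1} p(r) [ θ_k ∫_r^R ρ^{−k+1} g(ρ)φ(ρ) dρ + ((1−θ_k)/R^{n+2(k−1)}) ∫_0^R ρ^{n+k−1} g(ρ)φ(ρ) dρ − ((1−θ_k)/r^{n+2(k−1)}) ∫_0^r ρ^{n+k−1} g(ρ)φ(ρ) dρ ] for 0 < r ≤ R, and Kφ(0) = 0. Then Kφ ∈ C[0,R] for every φ ∈ C[0,R], and K is a bounded linear operator on the Banach space C[0,R] (with the supremum norm) which is compact. -/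
open MeasureTheory Set Filter Topology

theorem compact_of_dual {X : Type*} [TopologicalSpace X] [CompactSpace X]
    {E : Type*} [NormedAddCommGroup E] [NormedSpace ℝ E] (L : X → (E →L[ℝ] ℝ))
    (hL : Continuous L) :
    ∃ K : E →L[ℝ] C(X, ℝ), IsCompactOperator K ∧ ∀ φ x, K φ x = L x φ := by
  let L' : C(X, E →L[ℝ] ℝ) := ⟨L, hL⟩
  have hLn : ∀ x, ‖L x‖ ≤ ‖L'‖ := fun x => L'.norm_coe_le_norm x
  let K0 : E →ₗ[ℝ] C(X, ℝ) :=
    { toFun := fun φ => ⟨fun x => L x φ, by fun_prop⟩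
      map_add' := by intro a b; ext x; simp
      map_smul' := by intro a b; ext x; simp }
  have hK0 : ∀ φ x, K0 φ x = L x φ := fun _ _ => rfl
  let K : E →L[ℝ] C(X, ℝ) := K0.mkContinuous ‖L'‖ (by
    intro φ
    rw [ContinuousMap.norm_le _ (by positivity)]
    intro x
    rw [hK0]
    exact ((L x).le_opNorm φ).trans (by gcongr; exact hLn x))
  have hK : ∀ φ x, K φ x = L x φ := fun _ _ => rfl
  refine ⟨K, ?_, hK⟩
  rw [isCompactOperator_iff_exists_mem_nhds_image_subset_compact]
  refine ⟨Metric.closedBall 0 1, Metric.closedBall_mem_nhds _ one_pos, ?_⟩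
  let e := ContinuousMap.linearIsometryBoundedOfCompact X ℝ ℝ
  have hB : IsCompact (closure (e '' (K '' Metric.closedBall 0 1))) := by
    refine BoundedContinuousFunction.arzela_ascoli (Metric.closedBall 0 ‖L'‖)
      (isCompact_closedBall _ _) _ ?_ ?_
    · rintro f x ⟨_, ⟨φ, hφ, rfl⟩, rfl⟩
      have h1 : ‖φ‖ ≤ 1 := by simpa using hφ
      have : (e (K φ)) x = L x φ := rfl
      rw [this, mem_closedBall_zero_iff]
      calc _ ≤ ‖L x‖ * ‖φ‖ := (L x).le_opNorm φ
        _ ≤ ‖L'‖ * 1 := by gcongr; exact hLn x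
        _ = _ := mul_one _
    · intro x0
      rw [Metric.equicontinuousAt_iff_right]
      intro ε hε
      filter_upwards [Metric.tendsto_nhds.1 (hL.tendsto x0) ε hε] with x hx
      rintro ⟨_, _, ⟨φ, hφ, rfl⟩, rfl⟩
      have h1 : ‖φ‖ ≤ 1 := by simpa using hφ
      change dist (L x0 φ) (L x φ) < ε
      rw [dist_comm, dist_eq_norm, ← sub_apply]
      rw [dist_eq_norm] at hx
      calc _ ≤ ‖L x - L x0‖ * ‖φ‖ := (L x - L x0).le_opNorm φ
        _ ≤ ‖L x - L x0‖ * 1 := by gcongr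
        _ < ε := by rwa [mul_one]
  refine ⟨e.symm '' closure (e '' (K '' Metric.closedBall 0 1)),
    hB.image e.symm.continuous, ?_⟩
  intro f hf
  exact ⟨e f, subset_closure ⟨f, hf, rfl⟩, by simp⟩

theorem contOn_of_bound {E : Type*} [NormedAddCommGroup E] [NormedSpace ℝ E]
    (V : ℝ → (E →L[ℝ] ℝ)) (G : ℝ → ℝ) (S : Set ℝ)
    (h : ∀ s ∈ S, ∀ t ∈ S, ∀ φ, |V s φ - V t φ| ≤ |G s - G t| * ‖φ‖)
    (hG : ContinuousOn G S) : ContinuousOn V S := by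
  intro s hs
  have hGs := hG s hs
  rw [ContinuousWithinAt, tendsto_iff_dist_tendsto_zero] at hGs ⊢
  refine squeeze_zero' (Eventually.of_forall fun _ => dist_nonneg) ?_ hGs
  filter_upwards [self_mem_nhdsWithin] with x hx
  rw [dist_eq_norm]
  refine ContinuousLinearMap.opNorm_le_bound _ dist_nonneg fun φ => ?_
  exact h x hx s hs φ

theorem norm_comb {E : Type*} [NormedAddCommGroup E] [NormedSpace ℝ E]
    (q a b c : ℝ) (A B C : E →L[ℝ] ℝ) :
    ‖q • (a • A + b • B - c • C)‖ ≤ |q| * (|a| * ‖A‖ + |b| * ‖B‖ + |c| * ‖C‖) := by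
  rw [norm_smul, Real.norm_eq_abs]
  gcongr
  refine (norm_sub_le _ _).trans (add_le_add ((norm_add_le _ _).trans (add_le_add ?_ ?_)) ?_) <;>
  rw [norm_smul, Real.norm_eq_abs]

theorem contOn_zero {E : Type*} [NormedAddCommGroup E] [NormedSpace ℝ E] {R : ℝ} (hR : 0 < R)
    (F : ℝ → (E →L[ℝ] ℝ)) (H : ℝ → ℝ) (hFc : ContinuousOn F (Ioc 0 R))
    (hF : ∀ r ∈ Ioc 0 R, ‖F r‖ ≤ H r) (hH : Tendsto H (𝓝[>] 0) (𝓝 0)) :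
    ∃ L0 : ℝ → (E →L[ℝ] ℝ), ContinuousOn L0 (Icc 0 R) ∧ L0 0 = 0 ∧
      ∀ r ∈ Ioc 0 R, L0 r = F r := by
  let L0 : ℝ → (E →L[ℝ] ℝ) := fun r => if r ≤ 0 then 0 else F r
  have hL0 : ∀ r ∈ Ioc 0 R, L0 r = F r := fun r hr => if_neg (not_le.2 hr.1)
  have hL00 : L0 0 = 0 := if_pos le_rfl
  refine ⟨L0, ?_, hL00, hL0⟩
  rw [← Ioc_insert_left hR.le]
  intro r hr
  rcases eq_or_ne r 0 with rfl | hne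
  · rw [continuousWithinAt_insert_self, ContinuousWithinAt, hL00,
      tendsto_zero_iff_norm_tendsto_zero]
    refine squeeze_zero' (Eventually.of_forall fun _ => norm_nonneg _) ?_
      (hH.mono_left (nhdsWithin_mono 0 (fun x hx => hx.1 : Ioc 0 R ⊆ Ioi 0)))
    filter_upwards [self_mem_nhdsWithin] with x hx
    rw [hL0 x hx]
    exact hF x hx
  · have hr' : r ∈ Ioc 0 R := hr.resolve_left hne
    have := (hFc r hr').congr (g := L0) (fun y hy => hL0 y hy) (hL0 r hr')
    refine this.mono_of_mem_nhdsWithin ?_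
    filter_upwards [self_mem_nhdsWithin, mem_nhdsWithin_of_mem_nhds (Ioi_mem_nhds hr'.1)]
      with x hx hx2
    exact hx.resolve_left (ne_of_gt hx2)

theorem ext_bound {R : ℝ} (hR : 0 ≤ R) (φ : C(Set.Icc (0:ℝ) R, ℝ)) (x : ℝ) :
    |Set.IccExtend hR φ x| ≤ ‖φ‖ := by
  rw [Set.IccExtend, Function.comp]
  exact φ.norm_coe_le_norm _

theorem ext_cont {R : ℝ} (hR : 0 ≤ R) (φ : C(Set.Icc (0:ℝ) R, ℝ)) :
    Continuous (Set.IccExtend hR φ) := φ.continuous.Icc_extend'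

theorem int_bound {R : ℝ} (hR : 0 ≤ R) (w : ℝ → ℝ) (a b : ℝ)
    (hw : IntervalIntegrable w volume a b) (φ : C(Set.Icc (0:ℝ) R, ℝ)) :
    |∫ ρ in a..b, w ρ * Set.IccExtend hR φ ρ| ≤ |(∫ ρ in a..b, |w ρ|)| * ‖φ‖ := by
  have h := intervalIntegral.norm_integral_le_abs_of_norm_le (μ := volume) (a := a) (b := b)
    (f := fun ρ => w ρ * Set.IccExtend hR φ ρ) (g := fun ρ => |w ρ| * ‖φ‖)
    (Eventually.of_forall fun t => by
      rw [norm_mul]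
      exact mul_le_mul_of_nonneg_left (ext_bound hR φ t) (norm_nonneg _)) (hw.abs.mul_const _)
  rw [intervalIntegral.integral_mul_const, abs_mul, abs_norm] at h
  exact h

theorem dual_exists {R : ℝ} (hR : 0 ≤ R) (w : ℝ → ℝ) (a b : ℝ)
    (hw : IntervalIntegrable w volume a b) :
    ∃ V : C(Set.Icc (0:ℝ) R, ℝ) →L[ℝ] ℝ,
      (∀ φ, V φ = ∫ ρ in a..b, w ρ * Set.IccExtend hR φ ρ) ∧ ‖V‖ ≤ |(∫ ρ in a..b, |w ρ|)| := by
  have hi : ∀ φ : C(Set.Icc (0:ℝ) R, ℝ),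
      IntervalIntegrable (fun ρ => w ρ * Set.IccExtend hR φ ρ) volume a b :=
    fun φ => hw.mul_continuousOn (ext_cont hR φ).continuousOn
  let V0 : C(Set.Icc (0:ℝ) R, ℝ) →ₗ[ℝ] ℝ :=
    { toFun := fun φ => ∫ ρ in a..b, w ρ * Set.IccExtend hR φ ρ
      map_add' := by
        intro φ ψ
        rw [← intervalIntegral.integral_add (hi φ) (hi ψ)]
        refine intervalIntegral.integral_congr fun ρ _ => ?_
        simp [Set.IccExtend, mul_add]
      map_smul' := by
        intro c φ
        simp only [smul_eq_mul, RingHom.id_apply]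
        rw [← intervalIntegral.integral_const_mul]
        refine intervalIntegral.integral_congr fun ρ _ => ?_
        simp [Set.IccExtend]; ring }
  exact ⟨V0.mkContinuous _ (int_bound hR w a b hw), fun _ => rfl,
    V0.mkContinuous_norm_le (abs_nonneg _) _⟩

theorem V_exists {R : ℝ} (hR : 0 < R) (w : ℝ → ℝ) (hw : ContinuousOn w (Ioc 0 R)) :
    ∃ V : ℝ → (C(Set.Icc (0:ℝ) R, ℝ) →L[ℝ] ℝ), ContinuousOn V (Ioc 0 R) ∧
      ∀ s ∈ Ioc 0 R, (∀ φ, V s φ = ∫ ρ in s..R, w ρ * Set.IccExtend hR.le φ ρ) ∧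
        ‖V s‖ ≤ |(∫ ρ in s..R, |w ρ|)| := by
  have hii : ∀ s ∈ Ioc 0 R, ∀ t ∈ Ioc 0 R, IntervalIntegrable w volume s t := by
    intro s hs t ht
    refine (hw.mono ?_).intervalIntegrable
    exact (ordConnected_Ioc).uIcc_subset hs ht
  have hRm : R ∈ Ioc 0 R := ⟨hR, le_rfl⟩
  have : ∀ s : ℝ, ∃ V : C(Set.Icc (0:ℝ) R, ℝ) →L[ℝ] ℝ, s ∈ Ioc 0 R →
      (∀ φ, V φ = ∫ ρ in s..R, w ρ * Set.IccExtend hR.le φ ρ) ∧ ‖V‖ ≤ |(∫ ρ in s..R, |w ρ|)| := by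
    intro s
    by_cases hs : s ∈ Ioc 0 R
    · obtain ⟨V, hV⟩ := dual_exists hR.le w s R (hii s hs R hRm)
      exact ⟨V, fun _ => hV⟩
    · exact ⟨0, fun h => absurd h hs⟩
  choose V hV using this
  refine ⟨V, ?_, hV⟩
  refine contOn_of_bound V (fun s => ∫ ρ in s..R, |w ρ|) _ ?_ ?_
  · intro s hs t ht φ
    have hst := hii s hs t ht
    have htR := hii t ht R hRm
    rw [← intervalIntegral.integral_add_adjacent_intervals hst.abs htR.abs,
      add_sub_cancel_right, (hV s hs).1, (hV t ht).1,
      ← intervalIntegral.integral_add_adjacent_intervals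
        (hst.mul_continuousOn (ext_cont hR.le φ).continuousOn)
        (htR.mul_continuousOn (ext_cont hR.le φ).continuousOn), add_sub_cancel_right]
    exact int_bound hR.le w s t hst φ
  intro s hs
  have hG : ContinuousWithinAt (fun s => ∫ ρ in s..R, |w ρ|) (Ioc 0 R) s := by
    have h2 : 0 < s / 2 := half_pos hs.1
    have h3 : s / 2 ≤ R := by linarith [hs.2]
    have := intervalIntegral.continuousOn_primitive_interval_left (μ := volume) (a := s/2) (b := R)
      (f := fun ρ => |w ρ|) (by
        rw [uIcc_of_le h3]
        exact (ContinuousOn.integrableOn_Icc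
          ((hw.mono fun x hx => ⟨h2.trans_le hx.1, hx.2⟩).abs)))
    rw [uIcc_of_le h3] at this
    refine (this s ⟨by linarith, hs.2⟩).mono_of_mem_nhdsWithin ?_
    filter_upwards [self_mem_nhdsWithin, mem_nhdsWithin_of_mem_nhds (Ioi_mem_nhds (show s/2 < s by linarith))] with x hx hx2
    exact ⟨le_of_lt hx2, hx.2⟩
  exact hG

theorem W_bound {R : ℝ} (g : ℝ → ℝ) (M : ℝ)
    (hM : ∀ x ∈ Icc 0 R, |g x| ≤ M) (j : ℕ) (r : ℝ) (hr : r ∈ Ioc 0 R) :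
    |(∫ ρ in (0:ℝ)..r, |ρ ^ j * g ρ|)| ≤ M * r ^ j * r := by
  have := intervalIntegral.norm_integral_le_of_norm_le_const (a := 0) (b := r)
    (f := fun ρ => |ρ ^ j * g ρ|) (C := M * r ^ j) (by
      intro x hx
      rw [uIoc_of_le hr.1.le] at hx
      have h0 : 0 < x := hx.1
      rw [Real.norm_eq_abs, abs_abs, abs_mul, abs_of_pos (by positivity : 0 < x ^ j), mul_comm]
      exact mul_le_mul (hM x ⟨hx.1.le, hx.2.trans hr.2⟩) (pow_le_pow_left₀ h0.le hx.2 j)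
        (by positivity) ((abs_nonneg _).trans (hM x ⟨hx.1.le, hx.2.trans hr.2⟩)))
  rwa [sub_zero, abs_of_pos hr.1] at this

theorem V_bound {R : ℝ} (hR : 0 < R) (g : ℝ → ℝ) (M : ℝ)
    (hM : ∀ x ∈ Icc 0 R, |g x| ≤ M) (m : ℕ) (s : ℝ) (hs : s ∈ Ioc 0 R) :
    |(∫ ρ in s..R, |ρ ^ ((1:ℤ) - ((m + 2 : ℕ) : ℤ)) * g ρ|)| ≤
      M * (s ^ m)⁻¹ * (Real.log R - Real.log s) := by
  have hs0 := hs.1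
  have hlog : ∫ x in s..R, x⁻¹ = Real.log R - Real.log s := by
    rw [integral_inv_of_pos hs.1 hR, Real.log_div hR.ne' hs.1.ne']
  have hc : IntervalIntegrable (fun x : ℝ => M * (s ^ m)⁻¹ * x⁻¹) volume s R := by
    refine ContinuousOn.intervalIntegrable ?_
    rw [uIcc_of_le hs.2]
    exact continuousOn_const.mul (continuousOn_id.inv₀ fun x hx => (hs0.trans_le hx.1).ne')
  have h := intervalIntegral.norm_integral_le_of_norm_le (μ := volume) (a := s) (b := R)
    (f := fun ρ => |ρ ^ ((1:ℤ) - ((m + 2 : ℕ) : ℤ)) * g ρ|)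
    (g := fun x => M * (s ^ m)⁻¹ * x⁻¹) hs.2 (Eventually.of_forall (by
      intro x hx
      have h0 : 0 < x := hs0.trans hx.1
      have hgx := hM x ⟨h0.le, hx.2⟩
      have e : x ^ ((1:ℤ) - ((m + 2 : ℕ) : ℤ)) = (x ^ m)⁻¹ * x⁻¹ := by
        have : (1:ℤ) - ((m + 2 : ℕ) : ℤ) = -((m + 1 : ℕ) : ℤ) := by push_cast; ring
        rw [this, zpow_neg, zpow_natCast, pow_succ, mul_inv]
      have hM0 := (abs_nonneg _).trans hgx
      have h1 : (x ^ m)⁻¹ ≤ (s ^ m)⁻¹ := by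
        have := hx.1.le
        gcongr
      rw [Real.norm_eq_abs, abs_abs, abs_mul, e, abs_of_pos (by positivity)]
      calc _ ≤ (s ^ m)⁻¹ * x⁻¹ * M := by gcongr
        _ = _ := by ring)) hc
  rw [intervalIntegral.integral_const_mul, hlog] at h
  exact h

theorem H_tendsto (R Cp σ A B C : ℝ) (hσ : -1 < σ) (m : ℕ) :
    Tendsto (fun r : ℝ => Cp * (A * (Real.log R * r ^ (σ + 1) - Real.log r * r ^ (σ + 1)) +
      B * (r ^ (σ + 1) * r ^ m) + C * r ^ (σ + 1))) (𝓝[>] 0) (𝓝 0) := by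
  have h1 : Tendsto (fun r : ℝ => r ^ (σ + 1)) (𝓝[>] 0) (𝓝 0) := by
    have := (Real.continuousAt_rpow_const 0 (σ + 1) (Or.inr (by linarith))).tendsto
    rw [Real.zero_rpow (by linarith)] at this
    exact this.mono_left nhdsWithin_le_nhds
  have h2 := tendsto_log_mul_rpow_nhdsGT_zero (r := σ + 1) (by linarith)
  have h3 : Tendsto (fun r : ℝ => r ^ m) (𝓝[>] 0) (𝓝 (0 ^ m)) :=
    ((continuous_pow m).tendsto 0).mono_left nhdsWithin_le_nhds
  have := (((((h1.const_mul (Real.log R)).sub h2).const_mul A).add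
    ((h1.mul h3).const_mul B)).add (h1.const_mul C)).const_mul Cp
  simpa using this

theorem stmt_14
    (R : ℝ) (hR : 0 < R)
    (n k : ℕ) (hn : 2 ≤ n) (hk : 2 ≤ k)
    (g p : ℝ → ℝ)
    (hg : ContinuousOn g (Set.Icc 0 R))
    (hp : ContinuousOn p (Set.Ioc 0 R))
    (Cp σ : ℝ) (hCp : 0 < Cp) (hσ₁ : -1 < σ) (hσ₂ : σ ≤ 1)
    (hpb : ∀ r ∈ Set.Ioc 0 R, |p r| ≤ Cp * r ^ σ) :
    ∃ K : C(Set.Icc (0:ℝ) R, ℝ) →L[ℝ] C(Set.Icc (0:ℝ) R, ℝ),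
      IsCompactOperator K ∧
      ∀ φ : C(Set.Icc (0:ℝ) R, ℝ),
        K φ ⟨0, ⟨le_refl 0, hR.le⟩⟩ = 0 ∧
        ∀ r : Set.Icc (0:ℝ) R, (r : ℝ) ∈ Set.Ioc 0 R →
          K φ r =
            (r : ℝ) ^ (k - 1) * p r *
              (((k : ℝ) / ((n : ℝ) + 2 * ((k : ℝ) - 1))) *
                  (∫ ρ in (r : ℝ)..R,
                    ρ ^ ((1 : ℤ) - (k : ℤ)) * g ρ * Set.IccExtend hR.le φ ρ) +
                ((1 - (k : ℝ) / ((n : ℝ) + 2 * ((k : ℝ) - 1))) / R ^ (n + 2 * (k - 1))) *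
                  (∫ ρ in (0:ℝ)..R,
                    ρ ^ (n + k - 1) * g ρ * Set.IccExtend hR.le φ ρ) -
                ((1 - (k : ℝ) / ((n : ℝ) + 2 * ((k : ℝ) - 1))) / (r : ℝ) ^ (n + 2 * (k - 1))) *
                  (∫ ρ in (0:ℝ)..(r : ℝ),
                    ρ ^ (n + k - 1) * g ρ * Set.IccExtend hR.le φ ρ)) := by
  obtain ⟨m, rfl⟩ : ∃ m, k = m + 2 := ⟨k - 2, by omega⟩
  have e1 : m + 2 - 1 = m + 1 := by omega
  have e2 : n + (m + 2) - 1 = n + m + 1 := by omega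
  rw [e1, e2]
  set θ : ℝ := ((m + 2 : ℕ) : ℝ) / ((n : ℝ) + 2 * (((m + 2 : ℕ) : ℝ) - 1)) with hθ
  set N := n + 2 * (m + 1) with hN
  clear_value θ
  obtain ⟨M, hM⟩ : ∃ M, ∀ x ∈ Icc 0 R, |g x| ≤ M :=
    isCompact_Icc.exists_bound_of_continuousOn hg
  have hw1 : ContinuousOn (fun ρ : ℝ => ρ ^ ((1:ℤ) - ((m + 2 : ℕ) : ℤ)) * g ρ) (Ioc 0 R) :=
    (continuousOn_id.zpow₀ _ fun x hx => Or.inl hx.1.ne').mul (hg.mono Ioc_subset_Icc_self)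
  have hw2' : ContinuousOn (fun ρ : ℝ => ρ ^ (n + m + 1) * g ρ) (Icc 0 R) :=
    (continuousOn_pow _).mul hg
  have hw2 := hw2'.mono Ioc_subset_Icc_self
  obtain ⟨V, hVc, hV⟩ := V_exists hR _ hw1
  obtain ⟨U, hUc, hU⟩ := V_exists hR _ hw2
  have hi : ∀ a ∈ Icc 0 R, ∀ b ∈ Icc 0 R,
      IntervalIntegrable (fun ρ : ℝ => ρ ^ (n + m + 1) * g ρ) volume a b := fun a ha b hb =>
    (hw2'.mono (ordConnected_Icc.uIcc_subset ha hb)).intervalIntegrable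
  have h0m : (0:ℝ) ∈ Icc 0 R := ⟨le_rfl, hR.le⟩
  have hRm : R ∈ Icc 0 R := ⟨hR.le, le_rfl⟩
  obtain ⟨T, hT, -⟩ := dual_exists hR.le _ 0 R (hi 0 h0m R hRm)
  have hW : ∀ r ∈ Ioc 0 R, ∀ φ, (T - U r) φ =
      ∫ ρ in (0:ℝ)..r, ρ ^ (n + m + 1) * g ρ * Set.IccExtend hR.le φ ρ := by
    intro r hr φ
    have hr' := Ioc_subset_Icc_self hr
    rw [sub_apply, hT, (hU r hr).1, ← intervalIntegral.integral_add_adjacent_intervals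
        ((hi 0 h0m r hr').mul_continuousOn (ext_cont hR.le φ).continuousOn)
        ((hi r hr' R hRm).mul_continuousOn (ext_cont hR.le φ).continuousOn), add_sub_cancel_right]
  have hWn : ∀ r ∈ Ioc 0 R, ‖T - U r‖ ≤ M * r ^ (n + m + 1) * r := by
    intro r hr
    have hb := W_bound g M hM (n + m + 1) r hr
    refine ContinuousLinearMap.opNorm_le_bound _ ((abs_nonneg _).trans hb) fun φ => ?_
    rw [hW r hr]
    exact (int_bound hR.le _ 0 r (hi 0 h0m r (Ioc_subset_Icc_self hr)) φ).trans
      (by gcongr)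
  let F : ℝ → (C(Set.Icc (0:ℝ) R, ℝ) →L[ℝ] ℝ) := fun r =>
    (r ^ (m + 1) * p r) • (θ • V r + ((1 - θ) / R ^ N) • T - ((1 - θ) / r ^ N) • (T - U r))
  have hFc : ContinuousOn F (Ioc 0 R) := by
    have hN0 : ContinuousOn (fun r : ℝ => (1 - θ) / r ^ N) (Ioc 0 R) :=
      continuousOn_const.div (continuousOn_pow _) fun x hx => (pow_pos hx.1 _).ne'
    exact ((continuousOn_pow _).mul hp).smul
      (((hVc.const_smul θ).add continuousOn_const).sub (hN0.smul (continuousOn_const.sub hUc)))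
  have hFn : ∀ r ∈ Ioc 0 R, ‖F r‖ ≤
      Cp * ((|θ| * M) * (Real.log R * r ^ (σ + 1) - Real.log r * r ^ (σ + 1)) +
      (|(1 - θ) / R ^ N| * ‖T‖) * (r ^ (σ + 1) * r ^ m) + (|1 - θ| * M) * r ^ (σ + 1)) := by
    intro r hr
    have hr0 := hr.1
    have hv := (hV r hr).2.trans (V_bound hR g M hM m r hr)
    have hq : ‖r ^ (m + 1) * p r‖ ≤ r ^ (m + 1) * (Cp * r ^ σ) := by
      rw [Real.norm_eq_abs, abs_mul, abs_of_pos (pow_pos hr0 _)]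
      gcongr
      exact hpb r hr
    have hs : r ^ (σ + 1) = r ^ σ * r := by rw [Real.rpow_add_one hr0.ne']
    rw [Real.norm_eq_abs] at hq
    have hinner : |θ| * ‖V r‖ + |(1 - θ) / R ^ N| * ‖T‖ + |(1 - θ) / r ^ N| * ‖T - U r‖ ≤
        |θ| * (M * (r ^ m)⁻¹ * (Real.log R - Real.log r)) + |(1 - θ) / R ^ N| * ‖T‖ +
          |1 - θ| / r ^ N * (M * r ^ (n + m + 1) * r) := by
      rw [abs_div _ (r ^ N), abs_of_pos (pow_pos hr0 N)]
      have := hWn r hr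
      gcongr
    refine (norm_comb _ _ _ _ (V r) T (T - U r)).trans ?_
    refine (mul_le_mul hq hinner (by positivity) ((abs_nonneg _).trans hq)).trans (le_of_eq ?_)
    rw [hs, hN]
    field_simp
    ring
  obtain ⟨L0, hLc, hL00, hL0⟩ := contOn_zero hR F _ hFc hFn
    (H_tendsto R Cp σ (|θ| * M) (|(1 - θ) / R ^ N| * ‖T‖) (|1 - θ| * M) hσ₁ m)
  obtain ⟨K, hK, hKe⟩ := compact_of_dual (fun x : Icc (0:ℝ) R => L0 x)
    (continuousOn_iff_continuous_domRestrict.1 hLc)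
  refine ⟨K, hK, fun φ => ⟨?_, fun r hr => ?_⟩⟩
  · rw [hKe]
    simp [hL00]
  · rw [hKe, hL0 r hr, ← (hV r hr).1, ← hW r hr, ← hT]
    rfl
end

section
/- For every ε > 0 there exists a constant C > 0, depending on R, n, α₀, α₁, σ and ε but not on k, such that for every integer k ≥ 2: ∫_0^R ∫_0^η ξ^{n+k−1+α₀} η^{−(n+k+α₀−σ)} (R−η)^{α₁−1} (R−ξ)^{−α₁} dξ dη ≤ C k^{−min{α₁, 1/2} + ε}. -/
open MeasureTheory Set Filter Topology

lemma aux_pow (p η : ℝ) (hp : -1 < p) (hη : 0 < η) :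
    (∫⁻ ξ in Set.Ioo (0:ℝ) η, ENNReal.ofReal (ξ ^ p)) = ENNReal.ofReal (η ^ (p+1) / (p+1)) := by
  have hi : IntervalIntegrable (fun x : ℝ => x ^ p) volume 0 η :=
    intervalIntegral.intervalIntegrable_rpow' hp
  have h2 : ∫ x in (0:ℝ)..η, x ^ p = η ^ (p+1) / (p+1) := by
    rw [integral_rpow (Or.inl hp), Real.zero_rpow (by linarith), sub_zero]
  rw [intervalIntegrable_iff_integrableOn_Ioo_of_le hη.le] at hi
  rw [← h2, intervalIntegral.integral_of_le hη.le, integral_Ioc_eq_integral_Ioo]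
  rw [ofReal_integral_eq_lintegral_ofReal hi]
  filter_upwards [ae_restrict_mem measurableSet_Ioo] with x hx
  exact Real.rpow_nonneg hx.1.le _

lemma aux_pow' (p η : ℝ) (hp : -1 < p) (hη : 0 < η) :
    (∫⁻ ξ in Set.Ioo (0:ℝ) η, ENNReal.ofReal ((η - ξ) ^ p)) =
      ENNReal.ofReal (η ^ (p+1) / (p+1)) := by
  have hi : IntervalIntegrable (fun x : ℝ => (η - x) ^ p) volume 0 η := by
    have := (intervalIntegral.intervalIntegrable_rpow' (a := η) (b := 0) hp).comp_sub_left η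
    simpa using this
  have h2 : ∫ x in (0:ℝ)..η, (η - x) ^ p = η ^ (p+1) / (p+1) := by
    rw [intervalIntegral.integral_comp_sub_left (fun x => x ^ p), sub_self, sub_zero,
      integral_rpow (Or.inl hp), Real.zero_rpow (by linarith), sub_zero]
  rw [intervalIntegrable_iff_integrableOn_Ioo_of_le hη.le] at hi
  rw [← h2, intervalIntegral.integral_of_le hη.le, integral_Ioc_eq_integral_Ioo]
  rw [ofReal_integral_eq_lintegral_ofReal hi]
  filter_upwards [ae_restrict_mem measurableSet_Ioo] with x hx
  exact Real.rpow_nonneg (by linarith [hx.2]) _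

lemma aux_lin (p q A B η : ℝ) (hp : -1 < p) (hq : -1 < q) (hA : 0 ≤ A) (hB : 0 ≤ B)
    (hη : 0 < η) :
    (∫⁻ ξ in Set.Ioo (0:ℝ) η, ENNReal.ofReal (A * ξ ^ p + B * (η - ξ) ^ q)) =
      ENNReal.ofReal (A * (η ^ (p+1) / (p+1)) + B * (η ^ (q+1) / (q+1))) := by
  have h1 : (∫⁻ ξ in Set.Ioo (0:ℝ) η, ENNReal.ofReal (A * ξ ^ p + B * (η - ξ) ^ q)) =
      ∫⁻ ξ in Set.Ioo (0:ℝ) η, (ENNReal.ofReal A * ENNReal.ofReal (ξ ^ p)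
        + ENNReal.ofReal B * ENNReal.ofReal ((η - ξ) ^ q)) := by
    refine setLIntegral_congr_fun measurableSet_Ioo ?_
    intro x hx
    have a1 : 0 ≤ x ^ p := Real.rpow_nonneg hx.1.le _
    have a2 : 0 ≤ (η - x) ^ q := Real.rpow_nonneg (by linarith [hx.2]) _
    simp only
    rw [ENNReal.ofReal_add (by positivity) (by positivity), ENNReal.ofReal_mul hA,
      ENNReal.ofReal_mul hB]
  rw [h1, lintegral_add_left (by fun_prop), lintegral_const_mul _ (by fun_prop),
    lintegral_const_mul _ (by fun_prop), aux_pow p η hp hη, aux_pow' q η hq hη,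
    ← ENNReal.ofReal_mul hA, ← ENNReal.ofReal_mul hB, ENNReal.ofReal_add]
  · have := Real.rpow_pos_of_pos hη (p+1)
    have : 0 < p + 1 := by linarith
    positivity
  · have := Real.rpow_pos_of_pos hη (q+1)
    have : 0 < q + 1 := by linarith
    positivity

/-- inner integral bound -/
lemma aux_inner (m b η : ℝ) (hm : 1 ≤ m) (hb : 0 < b) (hb4 : b ≤ 1/4) (hη : 0 < η) :
    (∫⁻ ξ in Set.Ioo (0:ℝ) η, ENNReal.ofReal (ξ ^ (m-1) * (η - ξ) ^ (-b))) ≤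
      ENNReal.ofReal (3 * m ^ (-(1/2) : ℝ) * η ^ (m - b)) := by
  have hm0 : 0 < m := by linarith
  set A : ℝ := m ^ (1/2 : ℝ) * η ^ (1 - m - b) with hA
  set B : ℝ := m ^ (-(1/2) : ℝ) * η ^ (m - 1 + b) with hB
  have hA0 : 0 < A := by positivity
  have hB0 : 0 < B := by positivity
  have hAB : A * B = 1 := by
    rw [hA, hB, mul_mul_mul_comm, ← Real.rpow_add hm0, ← Real.rpow_add hη]
    ring_nf; simp
  calc _ ≤ ∫⁻ ξ in Set.Ioo (0:ℝ) η,
        ENNReal.ofReal (A * ξ ^ (2*(m-1)) + B * (η - ξ) ^ (2*(-b))) := by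
        refine setLIntegral_mono (by fun_prop) ?_
        intro x hx
        apply ENNReal.ofReal_le_ofReal
        have e1 : x ^ (2*(m-1)) = (x ^ (m-1))^2 := by
          rw [mul_comm, Real.rpow_mul hx.1.le]; norm_num
        have e2 : (η - x) ^ (2*(-b)) = ((η - x) ^ (-b))^2 := by
          rw [mul_comm, Real.rpow_mul (by linarith [hx.2])]; norm_num
        rw [e1, e2]
        have p1 : 0 ≤ x ^ (m-1) := Real.rpow_nonneg hx.1.le _
        have p2 : 0 ≤ (η - x) ^ (-b) := Real.rpow_nonneg (by linarith [hx.2]) _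
        generalize x ^ (m-1) = u at *
        generalize (η - x) ^ (-b) = v at *
        have hBe : B = 1 / A := by field_simp; linarith
        have : A * u^2 + B * v^2 - 2 * (u * v) = (A * u - v)^2 / A := by
          rw [hBe]; field_simp; ring
        have h3 : 0 ≤ (A * u - v)^2 / A := by positivity
        have h4 : 0 ≤ u * v := by positivity
        linarith
    _ = _ := aux_lin _ _ A B η (by linarith) (by linarith) hA0.le hB0.le hη
    _ ≤ _ := by
        apply ENNReal.ofReal_le_ofReal
        have f1 : A * η ^ (2*(m-1)+1) = m ^ (1/2 : ℝ) * η ^ (m - b) := by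
          rw [hA, mul_assoc, ← Real.rpow_add hη]; ring_nf
        have f2 : B * η ^ (2*(-b)+1) = m ^ (-(1/2) : ℝ) * η ^ (m - b) := by
          rw [hB, mul_assoc, ← Real.rpow_add hη]; ring_nf
        have f3 : m ^ (1/2 : ℝ) = m ^ (-(1/2) : ℝ) * m := by
          rw [← Real.rpow_add_one hm0.ne']; norm_num
        rw [← mul_div_assoc, ← mul_div_assoc, f1, f2, f3]
        set X := m ^ (-(1/2) : ℝ) * η ^ (m - b) with hX
        have hX0 : 0 < X := by positivity
        have g1 : m ^ (-(1/2) : ℝ) * m * η ^ (m - b) / (2*(m-1)+1) ≤ X := by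
          rw [div_le_iff₀ (by linarith)]
          have : m ^ (-(1/2) : ℝ) * m * η ^ (m - b) = X * m := by rw [hX]; ring
          rw [this]
          exact mul_le_mul_of_nonneg_left (by linarith) hX0.le
        have g2 : X / (2*(-b)+1) ≤ 2 * X := by
          rw [div_le_iff₀ (by linarith)]
          nlinarith
        have : 3 * m ^ (-(1/2) : ℝ) * η ^ (m - b) = 3 * X := by rw [hX]; ring
        linarith

/-- monotone-or-antitone bound for powers away from zero -/
lemma aux_mid (R x p : ℝ) (hR : 0 < R) (h1 : R/2 ≤ x) (h2 : x ≤ R) :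
    x ^ p ≤ (R/2) ^ p + R ^ p := by
  have a : 0 < (R/2) ^ p := by positivity
  have b : 0 < R ^ p := by positivity
  rcases le_total 0 p with h | h
  · linarith [Real.rpow_le_rpow (by linarith) h2 h]
  · linarith [Real.rpow_le_rpow_of_nonpos (by linarith) h1 h]

lemma aux_outer (R p q : ℝ) (hR : 0 < R) (hp : -1 < p) (hq : -1 < q) :
    ∃ D > (0:ℝ), (∫⁻ η in Set.Ioo (0:ℝ) R, ENNReal.ofReal (η ^ p * (R - η) ^ q)) ≤
      ENNReal.ofReal D := by
  set A := (R/2) ^ q + R ^ q with hA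
  set B := (R/2) ^ p + R ^ p with hB
  have hA0 : 0 < A := by positivity
  have hB0 : 0 < B := by positivity
  have : 0 < p + 1 := by linarith
  have : 0 < q + 1 := by linarith
  refine ⟨A * (R ^ (p+1) / (p+1)) + B * (R ^ (q+1) / (q+1)), by positivity, ?_⟩
  rw [← aux_lin p q A B R hp hq hA0.le hB0.le hR]
  refine setLIntegral_mono (by fun_prop) ?_
  intro x hx
  apply ENNReal.ofReal_le_ofReal
  have p1 : 0 ≤ x ^ p := Real.rpow_nonneg hx.1.le _
  have p2 : 0 ≤ (R - x) ^ q := Real.rpow_nonneg (by linarith [hx.2]) _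
  rcases le_total x (R/2) with h | h
  · have := aux_mid R (R - x) q hR (by linarith) (by linarith [hx.1])
    nlinarith [mul_le_mul_of_nonneg_left this p1, mul_nonneg hB0.le p2]
  · have := aux_mid R x p hR h hx.2.le
    nlinarith [mul_le_mul_of_nonneg_right this p2, mul_nonneg hA0.le p1]

theorem stmt_18
    (R : ℝ) (hR : 0 < R)
    (n : ℕ) (hn : 2 ≤ n)
    (α₀ α₁ σ : ℝ) (hα₀ : 0 < α₀) (hα₁ : 0 < α₁) (hσ₁ : -1 < σ) (hσ₂ : σ ≤ 1) :
    ∀ ε > (0:ℝ), ∃ C > (0:ℝ), ∀ k : ℕ, 2 ≤ k →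
      (∫⁻ η in Set.Ioo (0:ℝ) R, ∫⁻ ξ in Set.Ioo (0:ℝ) η,
          ENNReal.ofReal (ξ ^ ((n : ℝ) + k - 1 + α₀) * η ^ (-((n : ℝ) + k + α₀ - σ)) *
            (R - η) ^ (α₁ - 1) * (R - ξ) ^ (-α₁)))
        ≤ ENNReal.ofReal (C * (k : ℝ) ^ (-min α₁ (1/2 : ℝ) + ε)) := by
  intro ε hε
  obtain ⟨b, hb, hb4, hbα, hbσ⟩ : ∃ b : ℝ, 0 < b ∧ b ≤ 1/4 ∧ b ≤ α₁ ∧ b < 1 + σ := by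
    refine ⟨min (1/4) (min α₁ ((1+σ)/2)), ?_, min_le_left _ _,
      (min_le_right _ _).trans (min_le_left _ _), ?_⟩
    · refine lt_min (by norm_num) (lt_min hα₁ (by linarith))
    · refine ((min_le_right _ _).trans (min_le_right _ _)).trans_lt (by linarith)
  obtain ⟨D, hD, hDle⟩ := aux_outer R (σ - b) (b - 1) hR (by linarith) (by linarith)
  refine ⟨3 * D, by positivity, ?_⟩
  intro k hk
  have hk' : (2:ℝ) ≤ k := by exact_mod_cast hk
  have hn' : (2:ℝ) ≤ n := by exact_mod_cast hn
  set m : ℝ := (n:ℝ) + k + α₀ with hm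
  have hm1 : 1 ≤ m := by linarith
  have hm0 : 0 < m := by linarith
  have hM : 0 < m ^ (-(1/2) : ℝ) := by positivity
  calc _ ≤ ∫⁻ η in Set.Ioo (0:ℝ) R, ENNReal.ofReal (3 * m ^ (-(1/2) : ℝ)) *
        ENNReal.ofReal (η ^ (σ - b) * (R - η) ^ (b - 1)) := by
        refine setLIntegral_mono (by fun_prop) ?_
        intro η hη
        have hη0 : 0 < η := hη.1
        have hRη : 0 < R - η := by linarith [hη.2]
        set K : ℝ := η ^ (-(m - σ)) * (R - η) ^ (b - 1) with hK
        have hK0 : 0 < K := by positivity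
        calc _ ≤ ∫⁻ ξ in Set.Ioo (0:ℝ) η, ENNReal.ofReal K *
              ENNReal.ofReal (ξ ^ (m-1) * (η - ξ) ^ (-b)) := by
              refine setLIntegral_mono (by fun_prop) ?_
              intro ξ hξ
              rw [← ENNReal.ofReal_mul hK0.le]
              apply ENNReal.ofReal_le_ofReal
              have hξ0 : 0 < ξ := hξ.1
              have hηξ : 0 < η - ξ := by linarith [hξ.2]
              have hRξ : 0 < R - ξ := by linarith
              have e0 : (n:ℝ) + k - 1 + α₀ = m - 1 := by rw [hm]; ring
              rw [e0]
              have e1 : (R - ξ) ^ (-α₁) ≤ (R - η) ^ (b - α₁) * (η - ξ) ^ (-b) := by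
                have : (R - ξ) ^ (-α₁) = (R - ξ) ^ (b - α₁) * (R - ξ) ^ (-b) := by
                  rw [← Real.rpow_add hRξ]; ring_nf
                rw [this]
                refine mul_le_mul ?_ ?_ (by positivity) (by positivity)
                · exact Real.rpow_le_rpow_of_nonpos hRη (by linarith) (by linarith)
                · exact Real.rpow_le_rpow_of_nonpos hηξ (by linarith) (by linarith)
              have e2 : (R - η) ^ (b - 1) = (R - η) ^ (α₁ - 1) * (R - η) ^ (b - α₁) := by
                rw [← Real.rpow_add hRη]; ring_nf
              calc _ ≤ ξ ^ (m - 1) * η ^ (-(m - σ)) * (R - η) ^ (α₁ - 1) *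
                    ((R - η) ^ (b - α₁) * (η - ξ) ^ (-b)) :=
                    mul_le_mul_of_nonneg_left e1 (by positivity)
                _ = _ := by rw [hK, e2]; ring
          _ = ENNReal.ofReal K * ∫⁻ ξ in Set.Ioo (0:ℝ) η,
              ENNReal.ofReal (ξ ^ (m-1) * (η - ξ) ^ (-b)) :=
              lintegral_const_mul _ (by fun_prop)
          _ ≤ ENNReal.ofReal K * ENNReal.ofReal (3 * m ^ (-(1/2) : ℝ) * η ^ (m - b)) := by
              gcongr
              exact aux_inner m b η hm1 hb hb4 hη0
          _ = _ := by
              rw [← ENNReal.ofReal_mul hK0.le, ← ENNReal.ofReal_mul (by positivity)]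
              congr 1
              have : η ^ (σ - b) = η ^ (-(m - σ)) * η ^ (m - b) := by
                rw [← Real.rpow_add hη0]; ring_nf
              rw [this, hK]; ring
    _ = ENNReal.ofReal (3 * m ^ (-(1/2) : ℝ)) * ∫⁻ η in Set.Ioo (0:ℝ) R,
        ENNReal.ofReal (η ^ (σ - b) * (R - η) ^ (b - 1)) :=
        lintegral_const_mul _ (by fun_prop)
    _ ≤ ENNReal.ofReal (3 * m ^ (-(1/2) : ℝ)) * ENNReal.ofReal D := by gcongr
    _ ≤ _ := by
        rw [← ENNReal.ofReal_mul (by positivity)]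
        apply ENNReal.ofReal_le_ofReal
        have h1 : m ^ (-(1/2) : ℝ) ≤ (k:ℝ) ^ (-(1/2) : ℝ) :=
          Real.rpow_le_rpow_of_nonpos (by linarith) (by linarith) (by norm_num)
        have h2 : (k:ℝ) ^ (-(1/2) : ℝ) ≤ (k:ℝ) ^ (-min α₁ (1/2 : ℝ) + ε) :=
          Real.rpow_le_rpow_of_exponent_le (by linarith)
            (by linarith [min_le_right α₁ (1/2:ℝ)])
        have := mul_le_mul_of_nonneg_left (h1.trans h2) hD.le
        linarith
end

section
/- There exists a constant C > 0, depending on R, n, α₀, α₁ and σ but not on k, such that for every integer k ≥ 2: R^{−(n+k−1)} ∫_0^R ∫_ξ^R ξ^{n+k−1+α₀} η^{−(α₀−σ+1)} (R−η)^{α₁−1} (R−ξ)^{−α₁} dη dξ ≤ C/k. -/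
open MeasureTheory Set Filter Topology

theorem aux_lint (f : ℝ → ℝ) (a b : ℝ) (hab : a ≤ b) (hf : IntervalIntegrable f volume a b)
    (h0 : ∀ x ∈ Ioo a b, 0 ≤ f x) :
    ∫⁻ x in Ioo a b, ENNReal.ofReal (f x) = ENNReal.ofReal (∫ x in a..b, f x) := by
  rw [intervalIntegral.integral_of_le hab, integral_Ioc_eq_integral_Ioo,
    ofReal_integral_eq_lintegral_ofReal]
  · exact ((intervalIntegrable_iff_integrableOn_Ioo_of_le hab).1 hf)
  · exact (ae_restrict_iff' measurableSet_Ioo).2 (Eventually.of_forall h0)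

theorem aux_one (s a : ℝ) (hs : -1 < s) (ha : 0 < a) :
    ∫⁻ x in Ioo 0 a, ENNReal.ofReal (x ^ s) = ENNReal.ofReal (a ^ (s + 1) / (s + 1)) := by
  rw [aux_lint (fun x => x ^ s) 0 a ha.le (intervalIntegral.intervalIntegrable_rpow' hs)
    (fun x hx => Real.rpow_nonneg hx.1.le _), integral_rpow (Or.inl hs),
    Real.zero_rpow (by linarith), sub_zero]

theorem aux_two (s ξ R : ℝ) (hs : -1 < s) (ha : ξ < R) :
    ∫⁻ x in Ioo ξ R, ENNReal.ofReal ((R - x) ^ s)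
      = ENNReal.ofReal ((R - ξ) ^ (s + 1) / (s + 1)) := by
  have hi : IntervalIntegrable (fun x : ℝ => (R - x) ^ s) volume ξ R := by
    have h := (intervalIntegral.intervalIntegrable_rpow' (a := R - ξ) (b := 0) hs).comp_sub_left R
    simpa using h
  rw [aux_lint (fun x => (R - x) ^ s) ξ R ha.le hi
    (fun x hx => Real.rpow_nonneg (by linarith [hx.2]) _)]
  rw [intervalIntegral.integral_comp_sub_left (fun x => x ^ s) R, sub_self,
    integral_rpow (Or.inl hs), Real.zero_rpow (by linarith), sub_zero]

theorem stmt_19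
    (R : ℝ) (hR : 0 < R)
    (n : ℕ) (hn : 2 ≤ n)
    (α₀ α₁ σ : ℝ) (hα₀ : 0 < α₀) (hα₁ : 0 < α₁) (hσ₁ : -1 < σ) (hσ₂ : σ ≤ 1) :
    ∃ C > (0:ℝ), ∀ k : ℕ, 2 ≤ k →
      ENNReal.ofReal (R ^ (-((n : ℝ) + k - 1))) *
          (∫⁻ ξ in Set.Ioo (0:ℝ) R, ∫⁻ η in Set.Ioo ξ R,
            ENNReal.ofReal (ξ ^ ((n : ℝ) + k - 1 + α₀) * η ^ (-(α₀ - σ + 1)) *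
              (R - η) ^ (α₁ - 1) * (R - ξ) ^ (-α₁)))
        ≤ ENNReal.ofReal (C / k) := by
  refine ⟨R ^ σ / α₁, by positivity, fun k hk => ?_⟩
  have hn' : (2:ℝ) ≤ n := by exact_mod_cast hn
  have hk' : (2:ℝ) ≤ k := by exact_mod_cast hk
  set s : ℝ := (n : ℝ) + k - 2 + σ with hs
  have hinner : ∀ ξ ∈ Ioo (0:ℝ) R, (∫⁻ η in Set.Ioo ξ R,
            ENNReal.ofReal (ξ ^ ((n : ℝ) + k - 1 + α₀) * η ^ (-(α₀ - σ + 1)) *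
              (R - η) ^ (α₁ - 1) * (R - ξ) ^ (-α₁)))
        ≤ ENNReal.ofReal (1 / α₁) * ENNReal.ofReal (ξ ^ s) := by
    intro ξ hξ
    have hξ0 : 0 < ξ := hξ.1
    have hRξ : 0 < R - ξ := sub_pos.2 hξ.2
    calc _ ≤ ∫⁻ η in Set.Ioo ξ R, ENNReal.ofReal (ξ ^ s * (R - ξ) ^ (-α₁)) *
            ENNReal.ofReal ((R - η) ^ (α₁ - 1)) := by
          refine setLIntegral_mono' measurableSet_Ioo fun η hη => ?_
          rw [← ENNReal.ofReal_mul (by positivity)]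
          apply ENNReal.ofReal_le_ofReal
          have h1 : η ^ (-(α₀ - σ + 1)) ≤ ξ ^ (-(α₀ - σ + 1)) :=
            Real.rpow_le_rpow_of_nonpos hξ0 hη.1.le (by linarith)
          have h2 : ξ ^ s = ξ ^ ((n : ℝ) + k - 1 + α₀) * ξ ^ (-(α₀ - σ + 1)) := by
            rw [← Real.rpow_add hξ0]; congr 1; rw [hs]; ring
          have h3 : 0 < R - η := sub_pos.2 hη.2
          rw [h2, mul_right_comm _ ((R - ξ) ^ (-α₁))]
          gcongr
      _ = _ := by
          rw [lintegral_const_mul' _ _ ENNReal.ofReal_ne_top,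
            aux_two _ _ _ (by linarith) hξ.2, ← ENNReal.ofReal_mul (by positivity),
            ← ENNReal.ofReal_mul (by positivity), sub_add_cancel, Real.rpow_neg hRξ.le]
          congr 1
          have : (R - ξ) ^ α₁ ≠ 0 := by positivity
          field_simp
  have hs1 : (k:ℝ) ≤ s + 1 := by rw [hs]; linarith
  calc _ ≤ ENNReal.ofReal (R ^ (-((n : ℝ) + k - 1))) *
          ∫⁻ ξ in Set.Ioo (0:ℝ) R, ENNReal.ofReal (1 / α₁) * ENNReal.ofReal (ξ ^ s) := by
        exact mul_le_mul_right (setLIntegral_mono' measurableSet_Ioo hinner) _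
    _ = ENNReal.ofReal (R ^ σ / α₁ / (s + 1)) := by
        have : 0 < s + 1 := by linarith
        rw [lintegral_const_mul' _ _ ENNReal.ofReal_ne_top, aux_one _ _ (by linarith) hR,
          ← ENNReal.ofReal_mul (by positivity), ← ENNReal.ofReal_mul (by positivity)]
        congr 1
        have h : R ^ σ = R ^ (-((n : ℝ) + k - 1)) * R ^ (s + 1) := by
          rw [← Real.rpow_add hR]; congr 1; rw [hs]; ring
        rw [h]; field_simp
    _ ≤ _ := by
        apply ENNReal.ofReal_le_ofReal
        gcongr
end
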